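/- Assume that a finite solvable group G of odd order acts faithfully and irreducibly on a finite vector space V over a finite field of odd characteristic. If G has a p-regular orbit on V for every prime p dividing |G|, then G has a regular orbit on V. -/

import Mathlib

open scoped Pointwise commutatorElement

universe u

/-- An element of odd order that fixes a point after two steps fixes it. -/
lemma smul_eq_of_odd_pow_smul_eq {G X : Type*} [Group G] [MulAction G X] {g : G}
    (hg : Odd (orderOf g)) {x : X} {k : ℕ} (h : (g ^ 2 ^ k) • x = x) : g • x = x := by
  have hc : (orderOf g).Coprime (2 ^ k) := Nat.Coprime.pow_right _ (Nat.coprime_two_right.2 hg)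
  obtain ⟨m, hm⟩ := exists_pow_eq_self_of_coprime (n := 2 ^ k) (x := g) hc.symm
  have h1 : g ^ 2 ^ k ∈ MulAction.stabilizer G x := h
  have h2 := Subgroup.pow_mem _ h1 m
  rw [hm] at h2
  exact h2

lemma odd_orderOf_of_odd_card {G : Type*} [Group G] (hG : Odd (Nat.card G)) (g : G) :
    Odd (orderOf g) := hG.of_dvd_nat (orderOf_dvd_natCard g)

/-- An involution commuting with a group of odd order is separated from the identity by an
invariant two-colouring. -/
lemma exists_invariant_sign {G P : Type*} [Group G] [MulAction G P] (hG : Odd (Nat.card G))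
    (ν : P → P) (hν : ∀ p, ν (ν p) = p) (hc : ∀ (g : G) p, ν (g • p) = g • ν p) :
    ∃ κ : P → Bool, (∀ (g : G) p, κ (g • p) = κ p) ∧ ∀ p, ν p ≠ p → κ (ν p) = !κ p := by
  classical
  let Q := MulAction.orbitRel.Quotient G P
  let : LinearOrder Q := IsWellOrder.linearOrder WellOrderingRel
  let π : P → Q := fun p => Quotient.mk'' p
  have hπ : ∀ (g : G) p, π (g • p) = π p := fun g p =>
    Quotient.sound' (MulAction.orbitRel_apply.2 ⟨g, rfl⟩)
  refine ⟨fun p => decide (π p < π (ν p)), fun g p => ?_, fun p hp => ?_⟩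
  · beta_reduce
    rw [hc, hπ, hπ]
  · have hne : π p ≠ π (ν p) := by
      intro h
      obtain ⟨g, hg⟩ := MulAction.orbitRel_apply.1 (Quotient.exact h.symm)
      replace hg : g • p = ν p := hg
      apply hp
      rw [← hg]
      apply smul_eq_of_odd_pow_smul_eq (k := 1) (odd_orderOf_of_odd_card hG g)
      rw [pow_one, pow_two, mul_smul, hg, ← hc, hg, hν]
    beta_reduce
    rw [hν]
    rcases lt_or_gt_of_ne hne with h | h
    · simp [h, h.le]
    · simp [h, h.le]

lemma exists_normal_commutator_le {G : Type*} [Group G] (hG : Group.IsSolvable G)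
    (D Z : Subgroup G) [D.Normal] (hDZ : ¬ D ≤ Z) :
    ∃ D₀ : Subgroup G, D₀.Normal ∧ D₀ ≤ D ∧ ¬ D₀ ≤ Z ∧ ⁅D₀, D₀⁆ ≤ Z := by
  obtain ⟨n, hn⟩ := hG.solvable
  have key : ∀ k m : ℕ, m + k = n → ∀ E : Subgroup G, E.Normal → E ≤ derivedSeries G m → E ≤ D →
      ¬ E ≤ Z → ∃ D₀ : Subgroup G, D₀.Normal ∧ D₀ ≤ D ∧ ¬ D₀ ≤ Z ∧ ⁅D₀, D₀⁆ ≤ Z := by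
    intro k
    induction k with
    | zero =>
      intro m hm E _ hE _ hZ
      obtain rfl : m = n := hm
      rw [hn, le_bot_iff] at hE
      exact absurd (hE ▸ bot_le) hZ
    | succ k ih =>
      intro m hm E hEn hE hED hZ
      by_cases h : ⁅E, E⁆ ≤ Z
      · exact ⟨E, hEn, hED, hZ, h⟩
      · exact ih (m + 1) (by omega) ⁅E, E⁆ inferInstance
          (by rw [derivedSeries_succ]; exact Subgroup.commutator_mono hE hE)
          ((Subgroup.commutator_le_left E E).trans hED) h
  exact key n 0 (by omega) D inferInstance (by simp) le_rfl hDZ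

/-- The two-point colour class argument on a plane of nine points. -/
lemma affine_square_fixed {A : Type*} [AddCommGroup A] (h3 : ∀ a : A, (3 : ℕ) • a = 0)
    {u w : A} (hu : u ≠ 0) (hw : w ≠ 0) (huw : u ≠ w) (huw' : u + w ≠ 0)
    {g : Equiv.Perm A} (hg : ∀ x y, g (x + y) + g 0 = g x + g y) (hodd : Odd (orderOf g))
    (hΔ : ∀ x, (x = 0 ∨ x = u ∨ x = w ∨ x = u + w) →
      (g x = 0 ∨ g x = u ∨ g x = w ∨ g x = u + w)) : g 0 = 0 ∧ g u = u ∧ g w = w := by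
  classical
  have fix : ∀ x, g (g (g (g x))) = x → g x = x := fun x hx =>
    smul_eq_of_odd_pow_smul_eq (k := 2) hodd (by simpa [pow_succ] using hx)
  let Δ : Finset A := {0, u, w, u + w}
  have hmem : ∀ x, x ∈ Δ ↔ (x = 0 ∨ x = u ∨ x = w ∨ x = u + w) := by simp [Δ]
  have himg : Δ.image g = Δ := by
    apply Finset.eq_of_subset_of_card_le
    · intro y hy
      obtain ⟨x, hx, rfl⟩ := Finset.mem_image.1 hy
      exact (hmem _).2 (hΔ x ((hmem x).1 hx))
    · rw [Finset.card_image_of_injective _ g.injective]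
  have hs0 : ∀ f : A → A, ∑ x ∈ Δ, f x = f 0 + f u + f w + f (u + w) := by
    intro f
    have e1 : (0 : A) ∉ ({u, w, u + w} : Finset A) := by
      simp [hu.symm, hw.symm, huw'.symm]
    have e2 : u ∉ ({w, u + w} : Finset A) := by simp [huw, hw]
    have e3 : w ∉ ({u + w} : Finset A) := by simp [hu]
    simp only [Δ]
    rw [Finset.sum_insert e1, Finset.sum_insert e2, Finset.sum_insert e3, Finset.sum_singleton]
    abel
  have hsum : ∑ x ∈ Δ, g x = ∑ x ∈ Δ, x := by
    conv_rhs => rw [← himg]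
    rw [Finset.sum_image (fun _ _ _ _ h => g.injective h)]
  have e0 := hs0 g
  rw [hsum, hs0 (fun x => x)] at e0
  have haff := hg u w
  have h0 : g 0 + g (u + w) = u + w := by
    have h4 : (4 : ℕ) • (g 0 + g (u + w)) = (4 : ℕ) • (u + w) := by
      have : (2 : ℕ) • (g 0 + g (u + w)) = (2 : ℕ) • (u + w) := by
        have e : g 0 + g u + g w + g (u + w) = (g 0 + g (u + w)) + (g u + g w) := by abel
        rw [e, ← haff] at e0
        calc _ = g 0 + g (u + w) + (g (u + w) + g 0) := by abel
          _ = _ := by rw [← e0]; abel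
      calc _ = (2 : ℕ) • (2 : ℕ) • (g 0 + g (u + w)) := by rw [← mul_nsmul']
        _ = _ := by rw [this, ← mul_nsmul']
    rw [succ_nsmul, succ_nsmul (u + w), h3, h3, zero_add, zero_add] at h4
    exact h4
  have h1 : g u + g w = u + w := by rw [← haff, add_comm, h0]
  have gi := g.injective
  have d1 : g 0 ≠ g u := fun h => hu (gi h).symm
  have d2 : g 0 ≠ g w := fun h => hw (gi h).symm
  rcases hΔ 0 (Or.inl rfl) with c | c | c | c
  · refine ⟨c, ?_⟩
    have h1' : g w = u + w - g u := by rw [← h1]; abel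
    rcases hΔ u (Or.inr (Or.inl rfl)) with d | d | d | d
    · exact absurd (c.trans d.symm) d1
    · exact ⟨d, by rw [h1', d]; abel⟩
    · have dw : g w = u := by rw [h1', d]; abel
      exact ⟨fix u (by rw [d, dw, d, dw]), fix w (by rw [dw, d, dw, d])⟩
    · exact absurd (by rw [c, h1', d]; abel) d2
  · exfalso
    rcases hΔ u (Or.inr (Or.inl rfl)) with d | d | d | d
    · exact d1 (by rw [d]; exact fix 0 (by rw [c, d, c, d]))
    · exact d1 (c.trans d.symm)
    · exact d2 (by
        rw [c]; rw [d] at h1; symm; have := h1; rw [add_comm] at this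
        exact add_right_cancel this)
    · have dw : g w = 0 := by rw [d] at h1; simpa using h1
      have e : g (u + w) = w := by rw [c] at h0; exact add_left_cancel h0
      have := fix 0 (by rw [c, d, e, dw])
      exact d2 (this.trans dw.symm)
  · exfalso
    rcases hΔ w (Or.inr (Or.inr (Or.inl rfl))) with d | d | d | d
    · exact d2 (by rw [d]; exact fix 0 (by rw [c, d, c, d]))
    · exact d1 (by rw [c]; rw [d, add_comm] at h1; exact (add_left_cancel h1).symm)
    · exact d2 (c.trans d.symm)
    · have dw : g u = 0 := by rw [d] at h1; simpa using h1
      have e : g (u + w) = u := by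
        rw [c, add_comm] at h0; exact add_right_cancel h0
      have := fix 0 (by rw [c, d, e, dw])
      exact d1 (this.trans dw.symm)
  · exfalso
    have e : g (u + w) = 0 := by rw [c] at h0; simpa using h0
    have := fix 0 (by rw [c, e, c, e])
    exact huw' (c.symm.trans this)

lemma eq_one_of_affine_of_fixed {A : Type*} [AddCommGroup A] (p : ℕ) [Module (ZMod p) A]
    {S : Set A} (hS : Submodule.span (ZMod p) S = ⊤)
    {g : Equiv.Perm A} (hg : ∀ x y, g (x + y) + g 0 = g x + g y)
    (h0 : g 0 = 0) (h : ∀ x ∈ S, g x = x) : g = 1 := by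
  let φ : A →+ A := AddMonoidHom.mk' g (fun x y => by simpa [h0] using hg x y)
  let ψ : A →ₗ[ZMod p] A := φ.toZModLinearMap p
  have : ψ = LinearMap.id := LinearMap.ext_on hS h
  ext x
  exact LinearMap.congr_fun this x

lemma exists_affine_coloring_aux {p : ℕ} [Fact p.Prime] (hp : p ≠ 2) (n : ℕ) :
    ∀ (A : Type*) [AddCommGroup A] [Finite A] [Module (ZMod p) A], Nat.card A = n →
      ∃ c : A → Bool, ∀ g : Equiv.Perm A, (∀ x y, g (x + y) + g 0 = g x + g y) →
        Odd (orderOf g) → (∀ a, c (g a) = c a) → g = 1 := by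
  classical
  induction n using Nat.strong_induction_on with
  | _ n ih =>
  intro A _ _ _ hA
  have hpp : p.Prime := Fact.out
  by_cases hsub : Subsingleton A
  · exact ⟨fun _ => true, fun g _ _ _ => Subsingleton.elim _ _⟩
  rw [not_subsingleton_iff_nontrivial] at hsub
  obtain ⟨w, hw⟩ := exists_ne (0 : A)
  obtain ⟨U, hUc⟩ := Submodule.exists_isCompl (Submodule.span (ZMod p) {w})
  have hUtop : Submodule.span (ZMod p) ((U : Set A) ∪ {w}) = ⊤ := by
    rw [Submodule.span_union, Submodule.span_eq, sup_comm]; exact hUc.sup_eq_top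
  have hwU : w ∉ U := by
    intro h
    have : w ∈ Submodule.span (ZMod p) {w} ⊓ U := ⟨Submodule.mem_span_singleton_self w, h⟩
    rw [hUc.inf_eq_bot] at this
    exact hw this
  have fix : ∀ g : Equiv.Perm A, Odd (orderOf g) → ∀ x, g (g x) = x → g x = x := fun g hg x hx =>
    smul_eq_of_odd_pow_smul_eq (k := 1) hg (by simpa [pow_succ] using hx)
  by_cases hU0 : U = ⊥
  · refine ⟨fun x => decide (x = 0 ∨ x = w), fun g hg ho hc => ?_⟩
    have hc' : ∀ a, (g a = 0 ∨ g a = w) ↔ (a = 0 ∨ a = w) := fun a => by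
      simpa only [decide_eq_decide] using hc a
    have gi := g.injective
    have key : g 0 = 0 := by
      rcases (hc' 0).2 (Or.inl rfl) with h | h
      · exact h
      · rcases (hc' w).2 (Or.inr rfl) with h' | h'
        · exact fix g ho 0 (by rw [h, h'])
        · exact absurd (gi (h'.trans h.symm)) hw
    have key2 : g w = w := by
      rcases (hc' w).2 (Or.inr rfl) with h' | h'
      · exact absurd (gi (h'.trans key.symm)) hw
      · exact h'
    refine eq_one_of_affine_of_fixed p hUtop hg key ?_
    rintro x (hx | rfl)
    · rw [hU0] at hx
      rw [show x = 0 from hx, key]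
    · exact key2
  obtain ⟨k, hfr⟩ := Nat.exists_eq_succ_of_ne_zero (n := Module.finrank (ZMod p) U)
    (by rw [Ne, Submodule.finrank_eq_zero]; exact hU0)
  have hk : Nat.card U = p ^ (k + 1) := by
    have := Fintype.ofFinite U
    have h1 := Module.card_eq_pow_finrank (K := ZMod p) (V := U)
    rw [ZMod.card, hfr] at h1
    rw [Nat.card_eq_fintype_card, h1]
  have hp3 : 3 ≤ p := by
    have := hpp.two_le; omega
  by_cases hsp : p = 3 ∧ k = 0
  · obtain ⟨rfl, rfl⟩ := hsp
    have h3A : ∀ a : A, (3 : ℕ) • a = 0 := by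
      intro a
      have : ((3 : ℕ) : ZMod 3) • a = 0 := by
        rw [show ((3 : ℕ) : ZMod 3) = 0 from rfl, zero_smul]
      rwa [Nat.cast_smul_eq_nsmul] at this
    obtain ⟨u, huU, hu⟩ := Submodule.exists_mem_ne_zero_of_ne_bot hU0
    have hUu : ∀ x ∈ U, ∃ a : ZMod 3, a • u = x := by
      intro x hx
      obtain ⟨a, ha⟩ := (finrank_eq_one_iff_of_nonzero' (K := ZMod 3) (⟨u, huU⟩ : U)
        (by simpa using hu)).1 hfr ⟨x, hx⟩
      exact ⟨a, congrArg Subtype.val ha⟩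
    have hspan : Submodule.span (ZMod 3) ({u, w} : Set A) = ⊤ := by
      rw [eq_top_iff, ← hUtop]
      refine Submodule.span_le.2 ?_
      rintro x (hx | rfl)
      · obtain ⟨a, rfl⟩ := hUu x hx
        exact Submodule.smul_mem _ _ (Submodule.subset_span (by simp))
      · exact Submodule.subset_span (by simp)
    refine ⟨fun x => decide (x = 0 ∨ x = u ∨ x = w ∨ x = u + w), fun g hg ho hc => ?_⟩
    obtain ⟨a1, a2, a3⟩ := affine_square_fixed h3A hu hw (by rintro rfl; exact hwU huU)
      (fun h => hwU (by rw [eq_neg_of_add_eq_zero_right h]; exact U.neg_mem huU)) hg ho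
      (fun x hx => of_decide_eq_true ((hc x).trans (decide_eq_true hx)))
    refine eq_one_of_affine_of_fixed 3 hspan hg a1 ?_
    rintro x (rfl | rfl)
    · exact a2
    · exact a3
  have hUlt : Nat.card U < n := by
    rw [← hA]
    exact Finite.card_subtype_lt hwU
  obtain ⟨c₀, hc₀⟩ := ih _ hUlt U rfl
  -- pass to the majority colour
  obtain ⟨c, hc, hmaj⟩ : ∃ c : U → Bool, (∀ g : Equiv.Perm U,
      (∀ x y, g (x + y) + g 0 = g x + g y) → Odd (orderOf g) → (∀ a, c (g a) = c a) → g = 1) ∧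
      Nat.card U ≤ 2 * Nat.card {x : U // c x = true} := by
    have hsum := Nat.card_congr (Equiv.sumCompl (fun x : U => c₀ x = true))
    rw [Nat.card_sum] at hsum
    by_cases h : Nat.card U ≤ 2 * Nat.card {x : U // c₀ x = true}
    · exact ⟨c₀, hc₀, h⟩
    · refine ⟨fun x => !c₀ x, fun g h1 h2 h3 => hc₀ g h1 h2 fun a => by simpa using h3 a, ?_⟩
      have : Nat.card {x : U // (!c₀ x) = true} = Nat.card {x : U // ¬ c₀ x = true} :=
        Nat.card_congr (Equiv.subtypeEquivRight fun x => by simp)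
      beta_reduce
      rw [this]
      omega
  refine ⟨fun x => if hx : x ∈ U then c ⟨x, hx⟩ else decide (x = w), fun g hg ho hcg => ?_⟩
  have gi := g.injective
  let φ : A →+ A := AddMonoidHom.mk' (fun x => g x - g 0) (fun x y => by
    rw [← add_right_cancel_iff (a := g 0 + g 0)]
    calc _ = g (x + y) + g 0 := by abel
      _ = g x + g y := hg x y
      _ = _ := by abel)
  have hφ : ∀ x y, g (x + y) = g x + φ y := fun x y => by
    change _ = g x + (g y - g 0)
    rw [← add_right_cancel_iff (a := g 0), hg]; abel
  let T : Set U := {x | g x ∈ U}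
  have hcount : Nat.card {x : U // c x = true} ≤ Nat.card T + 1 := by
    rw [← Finite.card_option]
    refine Nat.card_le_card_of_injective
      (fun x : {x : U // c x = true} => if h : g x.1 ∈ U then some (⟨x.1, h⟩ : T) else none) ?_
    intro x y hxy
    have hw' : ∀ x : {x : U // c x = true}, g x.1 ∉ U → g x.1 = w := by
      intro x hx
      have := hcg x.1.1
      beta_reduce at this
      rw [dif_neg hx, dif_pos x.1.2] at this
      exact of_decide_eq_true (this.trans x.2)
    by_cases h1 : g x.1 ∈ U <;> by_cases h2 : g y.1 ∈ U
    · simp only [h1, h2, dif_pos, Option.some.injEq] at hxy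
      exact Subtype.ext (Subtype.ext (congrArg (fun z : T => (z.1 : A)) hxy))
    · simp [h1, h2] at hxy
    · simp [h1, h2] at hxy
    · exact Subtype.ext (Subtype.ext (gi ((hw' x h1).trans (hw' y h2).symm)))
  have hpk : 3 * p ^ k ≤ p ^ (k + 1) := by rw [pow_succ, mul_comm]; exact Nat.mul_le_mul_left _ hp3
  have hpk1 : 2 * p ^ k + 3 ≤ p ^ (k + 1) := by
    by_cases hk0 : k = 0
    · subst hk0
      have h3 : p ≠ 3 := fun h => hsp ⟨h, rfl⟩
      have h4 : p ≠ 4 := by rintro rfl; exact absurd hpp (by decide)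
      simp only [pow_zero, zero_add, pow_one]; omega
    · have : 3 ≤ p ^ k := hp3.trans (Nat.le_self_pow hk0 p)
      omega
  have hT2 : p ^ k < Nat.card T := by rw [hk] at hmaj; omega
  have hTne : Nonempty T := by
    by_contra hcon
    rw [not_nonempty_iff] at hcon
    rw [Nat.card_of_isEmpty] at hT2
    omega
  obtain ⟨t, ht⟩ := hTne
  have hφU : ∀ y ∈ U, φ y ∈ U := by
    let T' : AddSubgroup U := (U.toAddSubgroup.comap φ).comap U.toAddSubgroup.subtype
    have hle : Nat.card T ≤ Nat.card T' := by
      refine Nat.card_le_card_of_injective (fun x : T => (⟨x.1 - t, ?_⟩ : T')) ?_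
      · change φ (x.1.1 - t.1) ∈ U
        have : φ (x.1.1 - t.1) = g x.1 - g t := by
          have := hφ t (x.1.1 - t.1)
          rw [add_sub_cancel] at this
          rw [this]; abel
        rw [this]
        exact U.sub_mem x.2 ht
      · intro x y h
        have := congrArg Subtype.val h
        exact Subtype.ext (sub_left_injective this)
    have htop : T' = ⊤ := by
      have hd : Nat.card T' ∣ Nat.card U := T'.card_addSubgroup_dvd_card
      rw [hk] at hd
      obtain ⟨j, hj, hj'⟩ := (Nat.dvd_prime_pow hpp).1 hd
      have : k < j := by
        by_contra hcon
        have := Nat.pow_le_pow_right hpp.pos (not_lt.1 hcon)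
        omega
      apply AddSubgroup.eq_top_of_card_eq
      rw [hj', hk]
      congr 1; omega
    intro y hy
    have : (⟨y, hy⟩ : U) ∈ T' := htop ▸ AddSubgroup.mem_top _
    exact this
  have hgU : ∀ x ∈ U, g x ∈ U := fun x hx => by
    have := hφ t (x - t)
    rw [add_sub_cancel] at this
    rw [this]
    exact U.add_mem ht (hφU _ (U.sub_mem hx t.2))
  have hgU' : ∀ x, g x ∈ U ↔ x ∈ U := by
    have : Function.Surjective (fun x : U => (⟨g x, hgU x x.2⟩ : U)) :=
      Finite.surjective_of_injective fun x y h => Subtype.ext (gi (congrArg Subtype.val h))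
    refine fun x => ⟨fun h => ?_, hgU x⟩
    obtain ⟨y, hy⟩ := this ⟨g x, h⟩
    have := gi (congrArg Subtype.val hy)
    exact this ▸ y.2
  have hgw : g w = w := by
    have h1 := hcg w
    have h2 : g w ∉ U := fun h => hwU ((hgU' w).1 h)
    beta_reduce at h1
    rw [dif_neg h2, dif_neg hwU] at h1
    simpa using h1
  let gU : Equiv.Perm U := g.subtypePerm (fun x => hgU' x)
  have hgU1 : gU = 1 := by
    apply hc
    · exact fun x y => Subtype.ext (hg x y)
    · refine ho.of_dvd_nat (orderOf_dvd_of_pow_eq_one ?_)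
      rw [Equiv.Perm.subtypePerm_pow]
      ext x
      simp [pow_orderOf_eq_one]
    · intro a
      have := hcg a.1
      beta_reduce at this
      rwa [dif_pos (hgU a a.2), dif_pos a.2] at this
  have hfixU : ∀ x ∈ U, g x = x := fun x hx =>
    congrArg Subtype.val (Equiv.Perm.congr_fun hgU1 ⟨x, hx⟩)
  refine eq_one_of_affine_of_fixed p hUtop hg (hfixU 0 U.zero_mem) ?_
  rintro x (hx | rfl)
  · exact hfixU x hx
  · exact hgw

/-- A regular normal elementary abelian subgroup gives affine coordinates, hence a colouring. -/
lemma exists_coloring_of_regular_normal {X : Type*} [Finite X] (Γ : Subgroup (Equiv.Perm X))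
    (hodd : Odd (Nat.card Γ)) (N : Subgroup Γ) [N.Normal] (p : ℕ) [Fact p.Prime] (hp : p ≠ 2)
    (hcomm : ∀ x ∈ N, ∀ y ∈ N, x * y = y * x) (hexp : ∀ x ∈ N, x ^ p = 1) (x₀ : X)
    (htrans : ∀ x, ∃ n ∈ N, n • x₀ = x) :
    ∃ c : X → Bool, ∀ g : Γ, (∀ x, c (g • x) = c x) → g = 1 := by
  classical
  let : CommGroup N := { (inferInstance : Group N) with
    mul_comm := fun x y => Subtype.ext (hcomm x x.2 y y.2) }
  let A := Additive N
  let : Module (ZMod p) A := AddCommGroup.zmodModule (n := p) (fun x =>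
    Subtype.ext (hexp (Additive.toMul x).1 (Additive.toMul x).2))
  have hinj : Function.Injective (fun n : N => n.1 • x₀) := by
    intro n m h
    apply Subtype.ext
    apply Subtype.ext
    ext x
    obtain ⟨k, hk, rfl⟩ := htrans x
    change n.1 • k • x₀ = m.1 • k • x₀
    rw [← mul_smul, ← mul_smul, hcomm _ n.2 _ hk, hcomm _ m.2 _ hk, mul_smul, mul_smul]
    exact congrArg (k • ·) h
  let e : A ≃ X := Equiv.ofBijective (fun a => (Additive.toMul a).1 • x₀)
    ⟨fun a b h => hinj h, fun x => by
      obtain ⟨n, hn, h⟩ := htrans x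
      exact ⟨Additive.ofMul ⟨n, hn⟩, h⟩⟩
  have he : ∀ a : A, e a = (Additive.toMul a).1 • x₀ := fun a => rfl
  obtain ⟨c, hc⟩ := exists_affine_coloring_aux hp _ A rfl
  refine ⟨fun x => c (e.symm x), fun g hg => ?_⟩
  let g' : Equiv.Perm A := (e.trans g.1).trans e.symm
  have hg' : ∀ a, e (g' a) = g • e a := fun a => e.apply_symm_apply _
  have haff : ∀ a : A, (Additive.toMul (g' a)).1 = g * (Additive.toMul a).1 * g⁻¹ *
      (Additive.toMul (g' 0)).1 := by
    intro a
    have hmem : g * (Additive.toMul a).1 * g⁻¹ * (Additive.toMul (g' 0)).1 ∈ N :=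
      N.mul_mem (Subgroup.Normal.conj_mem inferInstance _ (Additive.toMul a).2 g)
        (Additive.toMul (g' 0)).2
    have : g' a = Additive.ofMul ⟨_, hmem⟩ := by
      apply e.injective
      rw [hg', he, he, toMul_ofMul]
      rw [mul_smul, ← he (g' 0), hg', he, toMul_zero, ← mul_smul, ← mul_smul]
      simp
    rw [this]; rfl
  have h1 : g' = 1 := by
    apply hc
    · intro x y
      apply Subtype.ext
      change (Additive.toMul (g' (x + y))).1 * (Additive.toMul (g' 0)).1 =
        (Additive.toMul (g' x)).1 * (Additive.toMul (g' y)).1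
      rw [haff (x + y), haff x, haff y, toMul_add, Subgroup.coe_mul]
      have k0 := (Additive.toMul (g' 0)).2
      have kx : g * (Additive.toMul x).1 * g⁻¹ ∈ N :=
        Subgroup.Normal.conj_mem inferInstance _ (Additive.toMul x).2 g
      have ky : g * (Additive.toMul y).1 * g⁻¹ ∈ N :=
        Subgroup.Normal.conj_mem inferInstance _ (Additive.toMul y).2 g
      generalize (Additive.toMul (g' 0)).1 = k at *
      have : g * ((Additive.toMul x).1 * (Additive.toMul y).1) * g⁻¹ =
        (g * (Additive.toMul x).1 * g⁻¹) * (g * (Additive.toMul y).1 * g⁻¹) := by group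
      rw [this]
      generalize (g * (Additive.toMul x).1 * g⁻¹) = a at *
      generalize (g * (Additive.toMul y).1 * g⁻¹) = b at *
      rw [mul_assoc a, mul_assoc a, mul_assoc a, hcomm _ (N.mul_mem ky k0) _ k0]
    · refine (odd_orderOf_of_odd_card hodd g).of_dvd_nat (orderOf_dvd_of_pow_eq_one ?_)
      have : ∀ k : ℕ, ∀ a, e ((g' ^ k) a) = g ^ k • e a := by
        intro k
        induction k with
        | zero => intro a; simp
        | succ k ih => intro a; rw [pow_succ', pow_succ', mul_smul, ← ih, ← hg']; rfl
      ext a : 1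
      apply e.injective
      rw [this, pow_orderOf_eq_one, one_smul]; rfl
    · intro a
      have := hg (e a)
      rw [← hg'] at this
      simpa using this
  apply Subtype.ext
  ext x
  have := hg' (e.symm x)
  rw [h1] at this
  exact (by simpa using this.symm : g • x = x)

/-- Gluing a colouring of a block with a colouring of the block system. -/
lemma exists_coloring_of_block {G X : Type*} [Group G] [MulAction G X]
    (hodd : Odd (Nat.card G)) (x₀ : X) (htrans : ∀ x, ∃ g : G, g • x₀ = x)
    (M : Subgroup G) (hM : MulAction.stabilizer G x₀ ≤ M)
    (c₁ : X → Bool) (hc₁ : ∀ m ∈ M, (∀ k ∈ M, c₁ (m • k • x₀) = c₁ (k • x₀)) →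
      ∀ k ∈ M, m • k • x₀ = k • x₀)
    (c₂ : G ⧸ M → Bool) (hc₂ : ∀ g : G, (∀ q : G ⧸ M, c₂ (g • q) = c₂ q) → ∀ q : G ⧸ M, g • q = q) :
    ∃ c : X → Bool, ∀ g : G, (∀ x : X, c (g • x) = c x) → ∀ x : X, g • x = x := by
  classical
  choose τ hτ using htrans
  let f : X → G ⧸ M := fun x => (τ x : G ⧸ M)
  have hf : ∀ (g : G), f (g • x₀) = (g : G ⧸ M) := by
    intro g
    refine QuotientGroup.eq.2 (hM ?_)
    rw [MulAction.mem_stabilizer_iff, mul_smul, ← hτ (g • x₀), ← mul_smul]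
    simp [hτ]
  refine ⟨fun x => xor (c₁ ((f x).out⁻¹ • x)) (c₂ (f x)), fun g hg => ?_⟩
  have hmem : ∀ (h : G), ((h : G ⧸ M).out)⁻¹ * h ∈ M := fun h => by
    rw [← QuotientGroup.eq, QuotientGroup.out_eq']
  have hmq : ∀ q : G ⧸ M, ((g • q).out)⁻¹ * g * q.out ∈ M := by
    intro q
    have := hmem (g * q.out)
    rw [mul_assoc]
    convert this
    conv_lhs => rw [← QuotientGroup.out_eq' q]
    rfl
  have hrel : ∀ q : G ⧸ M, ∀ k ∈ M, xor (c₁ ((((g • q).out)⁻¹ * g * q.out) • k • x₀)) (c₂ (g • q)) =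
      xor (c₁ (k • x₀)) (c₂ q) := by
    intro q k hk
    have h1 : f ((q.out * k) • x₀) = q := by
      rw [hf]
      conv_rhs => rw [← QuotientGroup.out_eq' q]
      exact QuotientGroup.eq.2 (by simpa using hk)
    have h2 : f (g • (q.out * k) • x₀) = g • q := by
      conv_rhs => rw [← h1]
      rw [hf, ← mul_smul, hf]; rfl
    have := hg ((q.out * k) • x₀)
    beta_reduce at this
    rw [h2, h1] at this
    simpa [mul_smul] using this
  have hfixq : ∀ q : G ⧸ M, g • q = q := by
    refine hc₂ g fun q => ?_
    by_contra hne
    obtain ⟨m, hm⟩ : ∃ m, m = ((g • q).out)⁻¹ * g * q.out := ⟨_, rfl⟩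
    have hmM : m ∈ M := hm ▸ hmq q
    have hflip : ∀ k ∈ M, c₁ (m • k • x₀) = !c₁ (k • x₀) := by
      intro k hk
      have := hrel q k hk
      revert hne this
      rw [← hm]
      generalize c₁ (m • k • x₀) = a
      generalize c₁ (k • x₀) = b
      generalize c₂ (g • q) = c
      generalize c₂ q = d
      revert a b c d
      decide
    have hpow : ∀ j : ℕ, c₁ (m ^ (2 * j) • x₀) = c₁ x₀ := by
      intro j
      induction j with
      | zero => simp
      | succ j ih =>
        have hk := M.pow_mem hmM (2 * j)
        have a1 := hflip _ hk
        have a2 := hflip _ (M.mul_mem hmM hk)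
        rw [mul_smul, a1, Bool.not_not, ih] at a2
        rw [← a2]
        congr 1
        rw [← mul_smul, ← mul_smul]
        congr 1
        rw [show 2 * (j + 1) = 2 * j + 1 + 1 by ring, pow_succ', pow_succ', mul_assoc]
    obtain ⟨j, hj⟩ := odd_orderOf_of_odd_card hodd m
    have h1 := hflip _ (M.pow_mem hmM (2 * j))
    rw [← mul_smul, ← pow_succ', ← hj, pow_orderOf_eq_one, one_smul, hpow] at h1
    revert h1
    cases c₁ x₀ <;> decide
  intro x
  obtain ⟨k, hk, q, hx⟩ : ∃ k ∈ M, ∃ q : G ⧸ M, q.out • k • x₀ = x := by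
    refine ⟨_, hmem (τ x), (τ x : G ⧸ M), ?_⟩
    rw [← mul_smul]
    simp [hτ]
  have h1 := hc₁ _ (hmq q) (fun k hk => by
    have := hrel q k hk
    rw [hfixq q] at this
    rw [hfixq q]
    simpa using this) k hk
  rw [hfixq q, ← mul_smul, mul_assoc, mul_assoc, mul_smul, inv_smul_eq_iff] at h1
  rw [← hx]
  simpa [mul_smul] using h1

lemma coloring_of_perm {Y : Type*} [Finite Y]
    (hY : ∀ Γ : Subgroup (Equiv.Perm Y), Odd (Nat.card Γ) → Group.IsSolvable Γ →
      ∃ c : Y → Bool, ∀ g : Γ, (∀ x, c (g • x) = c x) → g = 1)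
    (G : Type*) [Group G] [MulAction G Y] (hodd : Odd (Nat.card G)) (hs : Group.IsSolvable G) :
    ∃ c : Y → Bool, ∀ g : G, (∀ x, c (g • x) = c x) → ∀ x : Y, g • x = x := by
  let φ := MulAction.toPermHom G Y
  obtain ⟨c, hc⟩ := hY φ.range (hodd.of_dvd_nat (Subgroup.card_range_dvd φ))
    (Group.isSolvable_of_surjective φ.rangeRestrict_surjective)
  refine ⟨c, fun g hg x => ?_⟩
  have := hc ⟨φ g, g, rfl⟩ hg
  exact Equiv.Perm.congr_fun (congrArg Subtype.val this) x

lemma exists_coloring_perm (n : ℕ) : ∀ (X : Type*) [Finite X], Nat.card X = n →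
    ∀ Γ : Subgroup (Equiv.Perm X), Odd (Nat.card Γ) → Group.IsSolvable Γ →
      ∃ c : X → Bool, ∀ g : Γ, (∀ x, c (g • x) = c x) → g = 1 := by
  classical
  induction n using Nat.strong_induction_on with
  | _ n ih =>
  intro X _ hX Γ hodd hs
  have ih' : ∀ (Y : Type _) [Finite Y], Nat.card Y < n → ∀ (G : Type _) [Group G] [MulAction G Y],
      Odd (Nat.card G) → Group.IsSolvable G →
      ∃ c : Y → Bool, ∀ g : G, (∀ x, c (g • x) = c x) → ∀ x : Y, g • x = x :=
    fun Y _ hY G _ _ h1 h2 => coloring_of_perm (ih _ hY Y rfl) G h1 h2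
  have toOne : ∀ g : Γ, (∀ x, g • x = x) → g = 1 := fun g hg =>
    Subtype.ext (Equiv.ext fun x => hg x)
  have toOne' : (∃ c : X → Bool, ∀ g : Γ, (∀ x, c (g • x) = c x) → ∀ x, g • x = x) →
      ∃ c : X → Bool, ∀ g : Γ, (∀ x, c (g • x) = c x) → g = 1 := fun ⟨c, hc⟩ =>
    ⟨c, fun g hg => toOne g (hc g hg)⟩
  by_cases htr : ∀ x y : X, ∃ g : Γ, g • x = y
  swap
  · -- intransitive case
    push Not at htr
    obtain ⟨x₁, y₁, hxy⟩ := htr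
    have horb : ∀ x : X, ∃ c : X → Bool, ∀ g : Γ, (∀ y ∈ MulAction.orbit Γ x, c (g • y) = c y) →
        ∀ y ∈ MulAction.orbit Γ x, g • y = y := by
      intro x
      have hlt : Nat.card (MulAction.orbit Γ x) < n := by
        rw [← hX]
        have : ∃ y, y ∉ MulAction.orbit Γ x := by
          by_contra hcon
          push Not at hcon
          obtain ⟨a, ha⟩ := hcon x₁
          obtain ⟨b, hb⟩ := hcon y₁
          replace ha : a • x = x₁ := ha
          replace hb : b • x = y₁ := hb
          exact hxy (b * a⁻¹) (by rw [mul_smul, ← ha, inv_smul_smul, hb])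
        obtain ⟨y, hy⟩ := this
        exact Finite.card_subtype_lt hy
      obtain ⟨c, hc⟩ := ih' _ hlt Γ hodd hs
      refine ⟨fun y => if h : y ∈ MulAction.orbit Γ x then c ⟨y, h⟩ else true, fun g hg y hy => ?_⟩
      have := hc g (fun z => by
        have h1 := hg z.1 z.2
        have h2 : g • z.1 ∈ MulAction.orbit Γ x := (g • z).2
        beta_reduce at h1
        rw [dif_pos z.2, dif_pos h2] at h1
        exact h1) ⟨y, hy⟩
      exact congrArg Subtype.val this
    choose C hC using horb
    apply toOne'
    let π : X → MulAction.orbitRel.Quotient Γ X := fun x => Quotient.mk'' x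
    have hπ : ∀ (g : Γ) x, π (g • x) = π x := fun g p =>
      Quotient.sound' (MulAction.orbitRel_apply.2 ⟨g, rfl⟩)
    have hπ' : ∀ x, x ∈ MulAction.orbit Γ (π x).out := fun x =>
      MulAction.orbitRel_apply.1 (Quotient.exact (Quotient.out_eq (π x)).symm)
    refine ⟨fun x => C (π x).out x, fun g hg x => ?_⟩
    refine hC (π x).out g (fun y hy => ?_) x (hπ' x)
    have h1 := hg y
    beta_reduce at h1
    rw [hπ] at h1
    have : π y = π x := by
      obtain ⟨a, ha⟩ := hy
      rw [← ha]
      change π (a • (π x).out) = _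
      rw [hπ]
      exact Quotient.out_eq (π x)
    rwa [this] at h1
  by_cases hΓ : Subsingleton Γ
  · exact ⟨fun _ => true, fun g _ => Subsingleton.elim _ _⟩
  rw [not_subsingleton_iff_nontrivial] at hΓ
  have hXne : Nonempty X := by
    by_contra h
    rw [not_nonempty_iff] at h
    obtain ⟨g, hg⟩ := exists_ne (1 : Γ)
    exact hg (toOne g fun x => isEmptyElim x)
  obtain ⟨x₀⟩ := hXne
  set H := MulAction.stabilizer Γ x₀ with hH
  have hcardX : Nat.card X = H.index := by
    have : MulAction.orbit Γ x₀ = Set.univ := by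
      exact Set.eq_univ_of_forall fun y => htr x₀ y
    rw [hH, MulAction.index_stabilizer, this, Set.ncard_univ]
  by_cases himp : ∃ M : Subgroup Γ, H < M ∧ M < ⊤
  · obtain ⟨M, hHM, hMT⟩ := himp
    have hcQ : Nat.card (Γ ⧸ M) < n := by
      rw [← hX, hcardX]
      have h1 := Subgroup.relIndex_mul_index hHM.le
      have h2 : H.relIndex M ≠ 1 := by
        rw [Ne, Subgroup.relIndex_eq_one]; exact not_le_of_gt hHM
      have h3 : H.index ≠ 0 := Subgroup.index_ne_zero_of_finite
      change M.index < _
      rcases Nat.eq_zero_or_pos (H.relIndex M) with h | h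
      · rw [h] at h1; omega
      · have h4 : M.index ≠ 0 := Subgroup.index_ne_zero_of_finite
        have : 2 ≤ H.relIndex M := by omega
        have := Nat.mul_le_mul_right M.index this
        omega
    have hcB : Nat.card (MulAction.orbit M x₀) < n := by
      rw [← hX]
      have : ∃ y, y ∉ MulAction.orbit M x₀ := by
        by_contra hcon
        push Not at hcon
        apply hMT.ne
        rw [eq_top_iff]
        intro g _
        obtain ⟨m, hm⟩ := hcon (g • x₀)
        replace hm : m.1 • x₀ = g • x₀ := hm
        have : m.1⁻¹ * g ∈ H := by
          rw [hH, MulAction.mem_stabilizer_iff, mul_smul, ← hm, inv_smul_smul]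
        have := M.mul_mem m.2 (hHM.le this)
        simpa using this
      obtain ⟨y, hy⟩ := this
      exact Finite.card_subtype_lt hy
    obtain ⟨c₁, hc₁⟩ := ih' _ hcB M (hodd.of_dvd_nat M.card_subgroup_dvd_card) inferInstance
    obtain ⟨c₂, hc₂⟩ := ih' _ hcQ Γ hodd hs
    apply toOne'
    refine exists_coloring_of_block hodd x₀ (htr x₀) M hHM.le
      (fun y => if h : y ∈ MulAction.orbit M x₀ then c₁ ⟨y, h⟩ else true) ?_ c₂ hc₂
    intro m hm hcm k hk
    have hin : ∀ k ∈ M, k • x₀ ∈ MulAction.orbit M x₀ := fun k hk => ⟨⟨k, hk⟩, rfl⟩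
    have := hc₁ ⟨m, hm⟩ (fun z => by
      obtain ⟨z, ⟨k, hk⟩, rfl⟩ := z
      have h1 := hcm k hk
      have h2 : m • k • x₀ ∈ MulAction.orbit M x₀ := by
        rw [← mul_smul]; exact hin _ (M.mul_mem hm hk)
      beta_reduce at h1
      rw [dif_pos h2, dif_pos (hin _ hk)] at h1
      exact h1) ⟨k • x₀, hin k hk⟩
    exact congrArg Subtype.val this
  -- primitive case
  obtain ⟨D, hDn, -, hDne, hDab⟩ := exists_normal_commutator_le hs ⊤ ⊥ (by
    intro h; exact not_subsingleton Γ (Subgroup.subsingleton_iff.1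
      (subsingleton_of_bot_eq_top (le_antisymm bot_le h))))
  rw [le_bot_iff] at hDne
  have hDcomm : ∀ x ∈ D, ∀ y ∈ D, x * y = y * x := fun x hx y hy =>
    commutatorElement_eq_one_iff_mul_comm.1
      ((Subgroup.mem_bot).1 (hDab (Subgroup.commutator_mem_commutator hx hy)))
  have hcD : Nat.card D ≠ 1 := fun h => hDne (Subgroup.card_eq_one.1 h)
  set p := (Nat.card D).minFac with hp
  have hpp : p.Prime := Nat.minFac_prime hcD
  have : Fact p.Prime := ⟨hpp⟩
  have hp2 : p ≠ 2 := by
    rintro h2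
    have : Odd p := (hodd.of_dvd_nat D.card_subgroup_dvd_card).of_dvd_nat (Nat.minFac_dvd _)
    rw [h2] at this
    exact absurd this (by decide)
  let N : Subgroup Γ :=
    { carrier := {x | x ∈ D ∧ x ^ p = 1}
      mul_mem' := fun {a b} ha hb => ⟨D.mul_mem ha.1 hb.1, by
        rw [Commute.mul_pow (hDcomm a ha.1 b hb.1), ha.2, hb.2, one_mul]⟩
      one_mem' := ⟨D.one_mem, one_pow _⟩
      inv_mem' := fun {a} ha => ⟨D.inv_mem ha.1, by rw [inv_pow, ha.2, inv_one]⟩ }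
  have hNn : N.Normal := ⟨fun a ha g => ⟨hDn.conj_mem a ha.1 g, by
    rw [conj_pow, ha.2]; simp⟩⟩
  obtain ⟨d, hd⟩ := exists_prime_orderOf_dvd_card' (G := D) p (Nat.minFac_dvd _)
  have hdN : d.1 ∈ N := ⟨d.2, by
    have := pow_orderOf_eq_one d
    rw [hd] at this
    exact congrArg Subtype.val this⟩
  have hHN : ¬ N ≤ H := by
    intro hle
    have : d.1 = 1 := by
      apply toOne
      intro x
      obtain ⟨g, rfl⟩ := htr x₀ x
      have h1 : g⁻¹ * d.1 * g ∈ H := hle (by simpa using hNn.conj_mem _ hdN g⁻¹)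
      rw [hH, MulAction.mem_stabilizer_iff, mul_smul, mul_smul, inv_smul_eq_iff] at h1
      exact h1
    have h2 : d = 1 := Subtype.ext this
    rw [h2, orderOf_one] at hd
    exact hpp.one_lt.ne hd
  have htop : H ⊔ N = ⊤ := by
    by_contra hne
    exact himp ⟨H ⊔ N, lt_of_le_of_ne le_sup_left (fun h => hHN (h ▸ le_sup_right)),
      lt_top_iff_ne_top.2 hne⟩
  refine exists_coloring_of_regular_normal Γ hodd N p hp2 (fun x hx y hy => hDcomm x hx.1 y hy.1)
    (fun x hx => hx.2) x₀ (fun x => ?_)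
  obtain ⟨g, rfl⟩ := htr x₀ x
  have hg : g ∈ N ⊔ H := by rw [sup_comm, htop]; trivial
  obtain ⟨n, hn, h, hh, rfl⟩ := Subgroup.mem_sup_of_normal_left.1 hg
  exact ⟨n, hn, by rw [mul_smul, show h • x₀ = x₀ from hh]⟩

/-- A solvable group of odd order acting on a finite set admits a two-colouring preserved only
by the elements acting trivially. -/
theorem exists_coloring (G X : Type*) [Group G] [Finite X] [MulAction G X]
    (hodd : Odd (Nat.card G)) (hs : Group.IsSolvable G) :
    ∃ c : X → Bool, ∀ g : G, (∀ x, c (g • x) = c x) → ∀ x : X, g • x = x :=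
  coloring_of_perm (exists_coloring_perm _ X rfl) G hodd hs

/-- Multiplication by a suitable integer projects a finite commutative group to its `r`-part. -/
lemma exists_primary_idempotent (n : ℕ) (hn : n ≠ 0) :
    ∃ u : ℕ → ℕ, ∀ r : ℕ, r.Prime → (n ∣ r ^ n.factorization r * u r) ∧
      (u r ≡ 1 [MOD r ^ n.factorization r]) := by
  have : ∀ r : ℕ, ∃ u : ℕ, r.Prime → (n ∣ r ^ n.factorization r * u) ∧
      (u ≡ 1 [MOD r ^ n.factorization r]) := by
    intro r
    by_cases hr : r.Prime
    · have hco : (r ^ n.factorization r).Coprime (n / r ^ n.factorization r) :=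
        (Nat.coprime_ordCompl hr hn).pow_left _
      obtain ⟨u, hu1, hu2⟩ := Nat.chineseRemainder hco 1 0
      refine ⟨u, fun _ => ⟨?_, hu1⟩⟩
      have h1 : n / r ^ n.factorization r ∣ u := (Nat.modEq_zero_iff_dvd).1 hu2
      have h2 := Nat.mul_dvd_mul_left (r ^ n.factorization r) h1
      rwa [Nat.mul_div_cancel' (Nat.ordProj_dvd n r)] at h2
    · exact ⟨0, fun h => absurd h hr⟩
  choose u hu using this
  exact ⟨u, hu⟩

lemma eq_zero_of_coprime_nsmul {A : Type*} [AddGroup A] {m n : ℕ} (h : m.Coprime n) {x : A}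
    (hm : m • x = 0) (hn : n • x = 0) : x = 0 := by
  rw [← AddMonoid.addOrderOf_eq_one_iff, ← Nat.dvd_one, ← Nat.coprime_iff_gcd_eq_one.1 h]
  exact Nat.dvd_gcd (addOrderOf_dvd_of_nsmul_eq_zero hm) (addOrderOf_dvd_of_nsmul_eq_zero hn)

section Affine

variable {A B : Type*} [AddCommGroup A] [CommGroup B] [MulAction B A]

/-- The linear part of an affine action. -/
def linPart (haff : ∀ (b : B) (x y : A), b • (x + y) + b • (0 : A) = b • x + b • y) (b : B) :
    A →+ A :=
  AddMonoidHom.mk' (fun x => b • x - b • (0 : A)) (fun x y => by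
    rw [← add_right_cancel_iff (a := b • (0 : A) + b • (0 : A))]
    calc _ = b • (x + y) + b • (0 : A) := by abel
      _ = b • x + b • y := haff b x y
      _ = _ := by abel)

lemma smul_add_linPart
    (haff : ∀ (b : B) (x y : A), b • (x + y) + b • (0 : A) = b • x + b • y) (b : B) (x y : A) :
    b • (x + y) = b • x + linPart haff b y := by
  change _ = b • x + (b • y - b • (0 : A))
  rw [← add_right_cancel_iff (a := b • (0 : A)), haff]; abel

lemma linPart_mul
    (haff : ∀ (b : B) (x y : A), b • (x + y) + b • (0 : A) = b • x + b • y) (b c : B) (x : A) :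
    linPart haff (b * c) x = linPart haff b (linPart haff c x) := by
  have h := smul_add_linPart haff (b * c) 0 x
  rw [mul_smul, smul_add_linPart haff c, smul_add_linPart haff b, ← mul_smul] at h
  exact (add_left_cancel h).symm

lemma linPart_one
    (haff : ∀ (b : B) (x y : A), b • (x + y) + b • (0 : A) = b • x + b • y) (x : A) :
    linPart haff 1 x = x := by
  change (1 : B) • x - (1 : B) • (0 : A) = x
  simp

lemma linPart_comm
    (haff : ∀ (b : B) (x y : A), b • (x + y) + b • (0 : A) = b • x + b • y) (b c : B) (x : A) :
    linPart haff b (linPart haff c x) = linPart haff c (linPart haff b x) := by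
  rw [← linPart_mul, mul_comm, linPart_mul]

/-- A point whose `r`-part has small stabilizer, without creating new stabilizing elements of
order `r`. -/
lemma exists_point_primary [Finite A] [Finite B]
    (haff : ∀ (b : B) (x y : A), b • (x + y) + b • (0 : A) = b • x + b • y)
    (r : ℕ) (hr : r.Prime) (u k : ℕ)
    (huk : ∀ x : A, (r ^ k * u) • x = 0) (hu1 : u ≡ 1 [MOD r ^ k]) (a₀ : A) :
    ∃ a : A, (∀ x : B, x ^ r = 1 → u • (x • a - a) = 0 → u • (x • a₀ - a₀) = 0) ∧
      ∀ c : B, ¬ r ∣ orderOf c → u • (c • a - a) = 0 → ∀ x : A, u • (c • x - x) = 0 := by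
  classical
  have hker : ∀ x : A, r ^ k • x = 0 → u • x = x := by
    intro x hx
    have h1 : addOrderOf x ∣ r ^ k := addOrderOf_dvd_of_nsmul_eq_zero hx
    have h2 : u • x = 1 • x := (nsmul_eq_nsmul_iff_modEq).2 (hu1.of_dvd h1)
    rw [h2, one_nsmul]
  let S : A → Finset B := fun a => {c : B | ¬ r ∣ orderOf c ∧ u • (c • a - a) = 0}.toFinite.toFinset
  have hS : ∀ a c, c ∈ S a ↔ (¬ r ∣ orderOf c ∧ u • (c • a - a) = 0) := by
    intro a c; simp [S]
  let good : Set A := {a | ∀ x : B, x ^ r = 1 → u • (x • a - a) = 0 → u • (x • a₀ - a₀) = 0}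
  obtain ⟨a, ha, hmin⟩ := Set.exists_min_image good (fun a => (S a).card) (Set.toFinite _)
    ⟨a₀, fun _ _ h => h⟩
  refine ⟨a, ha, fun y hy hya => ?_⟩
  by_contra hcon
  push Not at hcon
  obtain ⟨x₁, hx₁⟩ := hcon
  let ψ : A →+ A := (nsmulAddMonoidHom u).comp (linPart haff y - AddMonoidHom.id A)
  have hψ : ∀ x, ψ x = u • (linPart haff y x - x) := fun x => rfl
  have hinv : ∀ (b : B) (z : A), z ∈ ψ.range → linPart haff b z ∈ ψ.range := by
    rintro b _ ⟨z, rfl⟩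
    refine ⟨linPart haff b z, ?_⟩
    rw [hψ, hψ, map_nsmul, map_sub, linPart_comm]
  have hpow : ∀ z ∈ ψ.range, r ^ k • z = 0 := by
    rintro _ ⟨z, rfl⟩
    rw [hψ, ← mul_nsmul', huk]
  have hdisj : ∀ z ∈ ψ.range, linPart haff y z = z → z = 0 := by
    rintro z ⟨w, hw⟩ hz
    have hfix : ∀ n : ℕ, u • (linPart haff (y ^ n) w - w) = n • z := by
      intro n
      induction n with
      | zero => rw [pow_zero, linPart_one]; simp
      | succ n ih =>
        have h1 : linPart haff y (n • z) = n • z := by rw [map_nsmul, hz]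
        rw [pow_succ', linPart_mul]
        have h2 : u • (linPart haff y (linPart haff (y ^ n) w) - w) =
            linPart haff y (u • (linPart haff (y ^ n) w - w)) + u • (linPart haff y w - w) := by
          rw [map_nsmul, map_sub, ← nsmul_add]
          congr 1; abel
        rw [h2, ih, h1, ← hψ, hw, succ_nsmul]
    have h1 := hfix (orderOf y)
    rw [pow_orderOf_eq_one, linPart_one, sub_self, nsmul_zero] at h1
    have h2 := hpow z ⟨w, hw⟩
    exact eq_zero_of_coprime_nsmul (Nat.Coprime.pow_right _
      ((Nat.Prime.coprime_iff_not_dvd hr).2 hy).symm) h1.symm h2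
  -- a nonzero vector of the range fixed by all elements of order `r`
  obtain ⟨z, hzX, hz0, hzfix⟩ : ∃ z ∈ ψ.range, z ≠ 0 ∧ ∀ x : B, x ^ r = 1 →
      linPart haff x z = z := by
    let P : Subgroup B := (powMonoidHom r).ker
    have hP : ∀ x : P, x.1 ^ r = 1 := fun x => x.2
    let : MulAction P ψ.range :=
      { smul := fun b z => ⟨linPart haff b.1 z.1, hinv _ _ z.2⟩
        one_smul := fun z => Subtype.ext (linPart_one haff z.1)
        mul_smul := fun b c z => Subtype.ext (linPart_mul haff b.1 c.1 z.1) }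
    have : Fact r.Prime := ⟨hr⟩
    have hPp : IsPGroup r P := fun x => ⟨1, Subtype.ext (by simpa using hP x)⟩
    have hcard : r ∣ Nat.card ψ.range := by
      have hne : Nontrivial ψ.range := by
        refine ⟨⟨⟨ψ (x₁ - a), _, rfl⟩, 0, fun h => hx₁ ?_⟩⟩
        have h1 : ψ (x₁ - a) = 0 := congrArg Subtype.val h
        have h2 : y • x₁ = y • a + linPart haff y (x₁ - a) := by
          rw [← smul_add_linPart, add_sub_cancel]
        have h3 : y • x₁ - x₁ = (y • a - a) + (linPart haff y (x₁ - a) - (x₁ - a)) := by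
          rw [h2]; abel
        rw [h3, nsmul_add, hya, ← hψ, h1, add_zero]
      obtain ⟨q, hq, hqd⟩ := Nat.exists_prime_and_dvd
        (n := Nat.card ψ.range) (Finite.one_lt_card).ne'
      have : Fact q.Prime := ⟨hq⟩
      obtain ⟨z, hz⟩ := exists_prime_addOrderOf_dvd_card' q hqd
      have h1 : r ^ k • z = 0 := Subtype.ext (hpow _ z.2)
      have h2 := addOrderOf_dvd_of_nsmul_eq_zero h1
      rw [hz] at h2
      rwa [(Nat.prime_dvd_prime_iff_eq hq hr).1 (hq.dvd_of_dvd_pow h2)] at hqd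
    have h0 : (0 : ψ.range) ∈ MulAction.fixedPoints P ψ.range :=
      fun b => Subtype.ext (map_zero (linPart haff b.1))
    obtain ⟨z, hz, hz'⟩ := hPp.exists_fixed_point_of_prime_dvd_card_of_fixed_point
      ψ.range hcard h0
    exact ⟨z.1, z.2, fun h => hz' (Subtype.ext h.symm), fun x hx =>
      congrArg Subtype.val (hz ⟨x, hx⟩)⟩
  have huz : u • z = z := hker z (hpow z hzX)
  have hD : ∀ b : B, u • (b • (a + z) - (a + z)) = u • (b • a - a) + (linPart haff b z - z) := by
    intro b
    have : linPart haff b z - z = u • (linPart haff b z - z) := by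
      rw [nsmul_sub, ← map_nsmul, huz]
    rw [this, smul_add_linPart haff, ← nsmul_add]
    congr 1; abel
  have hsub : S (a + z) ⊂ S a := by
    refine Finset.ssubset_iff_of_subset ?_ |>.2 ⟨y, (hS _ _).2 ⟨hy, hya⟩, fun h => ?_⟩
    · intro c hc
      obtain ⟨hc1, hc2⟩ := (hS _ _).1 hc
      refine (hS _ _).2 ⟨hc1, ?_⟩
      rw [hD] at hc2
      have hX : u • (c • a - a) ∈ ψ.range := by
        rw [eq_neg_of_add_eq_zero_left hc2]
        exact neg_mem (sub_mem (hinv c z hzX) hzX)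
      refine hdisj _ hX ?_
      have e1 : linPart haff y (c • a - a) = y • c • a - y • a := by
        have := smul_add_linPart haff y a (c • a - a)
        rw [add_sub_cancel] at this
        rw [this]; abel
      have e2 : c • y • a = c • a + linPart haff c (y • a - a) := by
        rw [← smul_add_linPart, add_sub_cancel]
      rw [map_nsmul, e1, smul_comm y c a, e2]
      have e3 : u • (c • a + linPart haff c (y • a - a) - y • a) =
          u • (c • a - a) + linPart haff c (u • (y • a - a)) - u • (y • a - a) := by
        rw [map_nsmul, ← nsmul_add, ← nsmul_sub]
        congr 1; abel
      rw [e3, hya, map_zero, add_zero, sub_zero]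
    · have h1 := ((hS _ _).1 h).2
      rw [hD, hya, zero_add, sub_eq_zero] at h1
      exact hz0 (hdisj z hzX h1)
  have hgood : a + z ∈ good := by
    intro x hx h
    rw [hD, hzfix x hx, sub_self, add_zero] at h
    exact ha x hx h
  exact absurd (Finset.card_lt_card hsub) (not_lt.2 (hmin _ hgood))

/-- Commuting affine actions: if for every prime `p` some point is fixed by no element of order
`p`, then some point has trivial stabilizer. -/
lemma exists_free_point_of_comm [Finite A] [Finite B]
    (haff : ∀ (b : B) (x y : A), b • (x + y) + b • (0 : A) = b • x + b • y)
    (hp : ∀ p : ℕ, p.Prime → ∃ a : A, ∀ b : B, b ^ p = 1 → b • a = a → b = 1) :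
    ∃ a : A, ∀ b : B, b • a = a → b = 1 := by
  classical
  have hn : Nat.card A ≠ 0 := Nat.card_pos.ne'
  obtain ⟨u, hu⟩ := exists_primary_idempotent (Nat.card A) hn
  have hkill : ∀ r : ℕ, r.Prime → ∀ x : A, (r ^ (Nat.card A).factorization r * u r) • x = 0 := by
    intro r hr x
    obtain ⟨m, hm⟩ := (hu r hr).1
    rw [hm, mul_comm, mul_nsmul', card_nsmul_eq_zero', nsmul_zero]
  have key : ∀ r : ℕ, ∃ a a₀ : A, r.Prime → ((∀ b : B, b ^ r = 1 → b • a₀ = a₀ → b = 1) ∧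
      (∀ x : B, x ^ r = 1 → u r • (x • a - a) = 0 → u r • (x • a₀ - a₀) = 0) ∧
      ∀ c : B, ¬ r ∣ orderOf c → u r • (c • a - a) = 0 → ∀ x : A, u r • (c • x - x) = 0) := by
    intro r
    by_cases hr : r.Prime
    · obtain ⟨a₀, ha₀⟩ := hp r hr
      obtain ⟨a, h1, h2⟩ := exists_point_primary haff r hr (u r) _ (hkill r hr) (hu r hr).2 a₀
      exact ⟨a, a₀, fun _ => ⟨ha₀, h1, h2⟩⟩
    · exact ⟨0, 0, fun h => absurd h hr⟩
  choose α α₀ hα using key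
  have hself : ∀ r : ℕ, r.Prime → ∀ x : A, u r • u r • x = u r • x := by
    intro r hr x
    have h1 : addOrderOf (u r • x) ∣ r ^ (Nat.card A).factorization r :=
      addOrderOf_dvd_of_nsmul_eq_zero (by rw [← mul_nsmul', hkill r hr])
    have h2 : u r • u r • x = 1 • u r • x :=
      (nsmul_eq_nsmul_iff_modEq).2 ((hu r hr).2.of_dvd h1)
    rw [h2, one_nsmul]
  have hcross : ∀ r s : ℕ, r.Prime → s.Prime → r ≠ s → ∀ x : A, u r • u s • x = 0 := by
    intro r s hr hs hrs x
    refine eq_zero_of_coprime_nsmul (m := r ^ (Nat.card A).factorization r)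
      (n := s ^ (Nat.card A).factorization s)
      (Nat.Coprime.pow _ _ ((Nat.coprime_primes hr hs).2 hrs)) ?_ ?_
    · rw [← mul_nsmul', hkill r hr]
    · rw [nsmul_left_comm, ← mul_nsmul' x, hkill s hs, nsmul_zero]
  have hsep : ∀ x : A, (∀ r : ℕ, r.Prime → u r • x = 0) → x = 0 := by
    intro x hx
    rw [← AddMonoid.addOrderOf_eq_one_iff]
    by_contra hne
    obtain ⟨q, hq, hqd⟩ := Nat.exists_prime_and_dvd hne
    have h1 : q ∣ u q := hqd.trans (addOrderOf_dvd_of_nsmul_eq_zero (hx q hq))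
    have h2 : q ∣ q ^ (Nat.card A).factorization q :=
      dvd_pow_self _ (hq.factorization_pos_of_dvd hn (hqd.trans (addOrderOf_dvd_natCard x))).ne'
    have h3 := (hu q hq).2.of_dvd h2
    have h4 := (Nat.modEq_zero_iff_dvd.2 h1).symm.trans h3
    exact hq.one_lt.ne' (Nat.dvd_one.1 (Nat.modEq_zero_iff_dvd.1 h4.symm))
  let a : A := ∑ s ∈ (Nat.card A).primeFactors, u s • α s
  have ha : ∀ r : ℕ, r.Prime → u r • a = u r • α r := by
    intro r hr
    by_cases hrn : r ∈ (Nat.card A).primeFactors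
    · rw [Finset.smul_sum, Finset.sum_eq_single r]
      · exact hself r hr _
      · intro s hs hsr
        exact hcross r s hr (Nat.prime_of_mem_primeFactors hs) hsr.symm _
      · exact fun h => absurd hrn h
    · have : ∀ x : A, u r • x = 0 := by
        intro x
        have h0 : (Nat.card A).factorization r = 0 := by
          rw [← Nat.support_factorization, Finsupp.notMem_support_iff] at hrn
          exact hrn
        have := hkill r hr x
        rwa [h0, pow_zero, one_mul] at this
      rw [this, this]
  have hloc : ∀ r : ℕ, r.Prime → ∀ c : B, u r • (c • a - a) = u r • (c • α r - α r) := by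
    intro r hr c
    have h1 : c • a = c • α r + linPart haff c (a - α r) := by
      rw [← smul_add_linPart, add_sub_cancel]
    have h2 : u r • (a - α r) = 0 := by rw [nsmul_sub, ha r hr, sub_self]
    have h3 : c • a - a = (c • α r - α r) + (linPart haff c (a - α r) - (a - α r)) := by
      rw [h1]; abel
    rw [h3, nsmul_add, nsmul_sub (linPart haff c _), ← map_nsmul, h2, map_zero, sub_zero, add_zero]
  refine ⟨a, fun b hb => ?_⟩
  rw [← orderOf_eq_one_iff]
  by_contra hne
  obtain ⟨q, hq, hqd⟩ := Nat.exists_prime_and_dvd hne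
  set c := b ^ (orderOf b / q) with hc
  have hcq : orderOf c = q := orderOf_pow_orderOf_div (orderOf_pos b).ne' hqd
  have hca : c • a = a := by
    have : c ∈ MulAction.stabilizer B a := Subgroup.pow_mem _ hb _
    exact this
  have hc1 : c = 1 := by
    refine (hα q hq).1 c (by rw [← hcq, pow_orderOf_eq_one]) ?_
    rw [← sub_eq_zero]
    apply hsep
    intro r hr
    by_cases hrq : r = q
    · subst hrq
      refine (hα r hr).2.1 c (by rw [← hcq, pow_orderOf_eq_one]) ?_
      rw [← hloc r hr, hca, sub_self, nsmul_zero]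
    · refine (hα r hr).2.2 c ?_ ?_ _
      · rw [hcq]
        exact fun h => hrq ((Nat.prime_dvd_prime_iff_eq hr hq).1 h)
      · rw [← hloc r hr, hca, sub_self, nsmul_zero]
  rw [hc1, orderOf_one] at hcq
  exact hq.one_lt.ne hcq

end Affine

/-- A semiregular-type criterion for a group acting by twisted translations on a finite
commutative group, with commuting twists. -/
lemma exists_free_point_of_twisted {K T : Type*} [Group K] [Finite K] [AddCommGroup T] [Finite T]
    [MulAction K T] (σ : K → T → T) (hσ : ∀ (k : K) (t s : T), k • (t + s) = σ k t + k • s)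
    (hcomm : ∀ (k l : K) (t : T), σ k (σ l t) = σ l (σ k t))
    (hp : ∀ p : ℕ, p.Prime → ∃ t : T, ¬ p ∣ Nat.card (MulAction.stabilizer K t)) :
    ∃ t : T, MulAction.stabilizer K t = ⊥ := by
  classical
  have hσ' : ∀ k t, k • t = σ k t + k • (0 : T) := fun k t => by
    have := hσ k t 0
    rwa [add_zero] at this
  have hσmul : ∀ k l t, σ (k * l) t = σ k (σ l t) := by
    intro k l t
    have h1 := hσ' (k * l) t
    rw [mul_smul, hσ' l t, hσ, ← mul_smul] at h1
    exact (add_right_cancel h1).symm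
  have hσone : ∀ t, σ 1 t = t := fun t => by
    have := hσ' 1 t
    rw [one_smul, one_smul, add_zero] at this
    exact this.symm
  have hσadd : ∀ k t s, σ k (t + s) = σ k t + σ k s := by
    intro k t s
    have h1 := hσ' k (t + s)
    rw [hσ, hσ' k s, ← add_assoc] at h1
    exact (add_right_cancel h1).symm
  have hker : ∀ h : K, (∀ t, σ h t = t) → ∀ t, h • t = t + h • (0 : T) := fun h hh t => by
    rw [hσ' h t, hh]
  let M : AddSubgroup T :=
    { carrier := {m | ∃ h : K, (∀ t, σ h t = t) ∧ h • (0 : T) = m}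
      zero_mem' := ⟨1, hσone, one_smul _ _⟩
      add_mem' := by
        rintro _ _ ⟨h, hh, rfl⟩ ⟨l, hl, rfl⟩
        refine ⟨l * h, fun t => by rw [hσmul, hh, hl], ?_⟩
        rw [mul_smul, hker l hl]
      neg_mem' := by
        rintro _ ⟨h, hh, rfl⟩
        refine ⟨h⁻¹, fun t => ?_, ?_⟩
        · have := hσmul h⁻¹ h t
          rw [inv_mul_cancel, hσone, hh] at this
          exact this.symm
        · rw [inv_smul_eq_iff, hker h hh, neg_add_cancel] }
  have hMσ : ∀ k : K, ∀ m ∈ M, σ k m ∈ M := by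
    rintro k _ ⟨h, hh, rfl⟩
    refine ⟨k * h * k⁻¹, fun t => ?_, ?_⟩
    · rw [hσmul, hσmul, hh, ← hσmul, mul_inv_cancel, hσone]
    · rw [mul_smul, mul_smul, hker h hh, add_comm, hσ, smul_inv_smul, add_zero]
  let A := T ⧸ M
  let actFun : K → A → A := fun k => Quotient.map' (fun t => k • t) (by
    intro t s hts
    rw [QuotientAddGroup.leftRel_apply] at hts ⊢
    have h1 : k • s = σ k (-t + s) + k • t := by rw [← hσ]; congr 1; abel
    rw [h1, add_comm, add_assoc, add_neg_cancel, add_zero]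
    exact hMσ k _ hts)
  have hact : ∀ (k : K) (t : T), actFun k (t : A) = ((k • t : T) : A) := fun k t => rfl
  let act : MulAction K A :=
    { smul := actFun
      one_smul := fun a => by
        induction a using QuotientAddGroup.induction_on with
        | H t => exact (hact 1 t).trans (by rw [one_smul])
      mul_smul := fun k l a => by
        induction a using QuotientAddGroup.induction_on with
        | H t => exact congrArg _ (mul_smul k l t) }
  have hsm : ∀ (k : K) (t : T), k • (t : A) = ((k • t : T) : A) := fun k t => rfl
  have hmk : ∀ t s : T, (t : A) = (s : A) ↔ ∃ h : K, (∀ t, σ h t = t) ∧ h • t = s := by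
    intro t s
    rw [QuotientAddGroup.eq]
    constructor
    · rintro ⟨h, hh, hm⟩
      exact ⟨h, hh, by rw [hker h hh, hm, add_neg_cancel_left]⟩
    · rintro ⟨h, hh, rfl⟩
      exact ⟨h, hh, by rw [hker h hh t, neg_add_cancel_left]⟩
  have htriv : ∀ h : K, (∀ t, σ h t = t) → ∀ a : A, h • a = a := by
    intro h hh a
    induction a using QuotientAddGroup.induction_on with
    | H t => rw [hsm]; exact ((hmk _ _).2 ⟨h, hh, rfl⟩).symm
  let φ := MulAction.toPermHom K A
  have hφ : ∀ k a, φ k a = k • a := fun k a => rfl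
  have hφcomm : ∀ k l, φ k * φ l = φ l * φ k := by
    intro k l
    rw [← map_mul, ← map_mul]
    have : l * k = (k * l) * (l⁻¹ * k⁻¹ * l * k) := by group
    rw [this, map_mul φ (k * l)]
    have h1 : φ (l⁻¹ * k⁻¹ * l * k) = 1 := by
      ext a
      refine htriv _ (fun t => ?_) a
      rw [hσmul, hσmul, hσmul, hcomm l k, ← hσmul k⁻¹, inv_mul_cancel, hσone, ← hσmul,
        inv_mul_cancel, hσone]
    rw [h1, mul_one]
  let B := φ.range
  let : CommGroup B := { (inferInstance : Group B) with
    mul_comm := by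
      rintro ⟨_, k, rfl⟩ ⟨_, l, rfl⟩
      exact Subtype.ext (hφcomm k l) }
  have hB : ∀ (k : K) (a : A), (⟨φ k, k, rfl⟩ : B) • a = k • a := fun k a => rfl
  obtain ⟨a, ha⟩ := exists_free_point_of_comm (A := A) (B := B) (by
    rintro ⟨_, k, rfl⟩ x y
    induction x using QuotientAddGroup.induction_on with
    | H t =>
    induction y using QuotientAddGroup.induction_on with
    | H s =>
      rw [hB, hB, hB, hB]
      have e : ((k • (t + s) : T) : A) + ((k • (0 : T) : T) : A) =
          ((k • t : T) : A) + ((k • s : T) : A) := by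
        rw [← QuotientAddGroup.mk_add, ← QuotientAddGroup.mk_add, hσ, hσ' k t]
        congr 1; abel
      exact e) (by
    intro p hpp
    obtain ⟨t, ht⟩ := hp p hpp
    refine ⟨(t : A), ?_⟩
    rintro ⟨_, k, rfl⟩ hb hfix
    rw [hB, hsm] at hfix
    obtain ⟨h, hh, hht⟩ := (hmk _ _).1 hfix
    have hmem : h * k ∈ MulAction.stabilizer K t := by
      rw [MulAction.mem_stabilizer_iff, mul_smul, hht]
    have hφhk : φ (h * k) = φ k := by
      rw [map_mul]
      have : φ h = 1 := by ext a; exact htriv h hh a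
      rw [this, one_mul]
    have h1 : orderOf (φ k) ∣ p := orderOf_dvd_of_pow_eq_one (congrArg Subtype.val hb)
    have h2 : orderOf (φ k) ∣ Nat.card (MulAction.stabilizer K t) := by
      rw [← hφhk]
      refine (orderOf_map_dvd φ _).trans ?_
      have := orderOf_dvd_natCard (⟨h * k, hmem⟩ : MulAction.stabilizer K t)
      rwa [Subgroup.orderOf_mk] at this
    have h3 : orderOf (φ k) = 1 := by
      rcases (Nat.dvd_prime hpp).1 h1 with h | h
      · exact h
      · exact absurd (h ▸ h2) ht
    exact Subtype.ext (orderOf_eq_one_iff.1 h3))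
  induction a using QuotientAddGroup.induction_on with
  | H t =>
  refine ⟨t, ?_⟩
  rw [← Subgroup.card_eq_one]
  by_contra hne
  obtain ⟨p, hpp, hpd⟩ := Nat.exists_prime_and_dvd hne
  obtain ⟨s, hs⟩ := hp p hpp
  let K₁ := φ.ker
  have horb : ∀ t : T, Nat.card K₁ = Nat.card M * Nat.card (MulAction.stabilizer K₁ t) := by
    intro t
    rw [← (MulAction.stabilizer K₁ t).card_mul_index, MulAction.index_stabilizer, mul_comm,
      ← Nat.card_coe_set_eq]
    congr 1
    refine Nat.card_congr (Equiv.subtypeEquiv (Equiv.addLeft (-t)) fun s => ?_)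
    have : s ∈ MulAction.orbit K₁ t ↔ (t : A) = (s : A) := by
      constructor
      · rintro ⟨k, rfl⟩
        have : k.1 • (t : A) = t := Equiv.Perm.congr_fun (MonoidHom.mem_ker.1 k.2) (t : A)
        exact this.symm
      · intro hts
        obtain ⟨h, hh, rfl⟩ := (hmk _ _).1 hts
        exact ⟨⟨h, by ext a; exact htriv h hh a⟩, rfl⟩
    rw [this, QuotientAddGroup.eq]
    rfl
  have hcard : Nat.card (MulAction.stabilizer K₁ t) = Nat.card (MulAction.stabilizer K₁ s) := by
    have := (horb t).symm.trans (horb s)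
    exact Nat.eq_of_mul_eq_mul_left Nat.card_pos this
  apply hs
  have h1 : Nat.card (MulAction.stabilizer K t) ∣ Nat.card (MulAction.stabilizer K₁ t) := by
    refine dvd_of_eq (Nat.card_congr ⟨fun k => ⟨⟨k.1, ?_⟩, k.2⟩, fun k => ⟨k.1.1, k.2⟩,
      fun k => rfl, fun k => rfl⟩)
    have := ha ⟨φ k.1, k.1, rfl⟩ (by rw [hB, hsm, show k.1 • t = t from k.2])
    exact congrArg Subtype.val this
  have h2 : Nat.card (MulAction.stabilizer K₁ s) ∣ Nat.card (MulAction.stabilizer K s) := by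
    let ψ : MulAction.stabilizer K₁ s →* MulAction.stabilizer K s :=
      { toFun := fun k => ⟨k.1.1, k.2⟩
        map_one' := rfl
        map_mul' := fun _ _ => rfl }
    exact Subgroup.card_dvd_of_injective ψ fun k l h =>
      Subtype.ext (Subtype.ext (congrArg (fun z => z.1) h))
  exact (hpd.trans h1).trans (hcard ▸ h2)

/-- The endomorphism by which a group element acts. -/
abbrev actEnd {G : Type*} (V : Type*) [Group G] [AddCommGroup V] [DistribMulAction G V] (g : G) :
    AddMonoid.End V := DistribMulAction.toAddMonoidEnd G V g

/-- The range of an additive endomorphism. -/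
def endRange {V : Type*} [AddCommGroup V] (a : AddMonoid.End V) : AddSubgroup V :=
  AddMonoidHom.range a

lemma mem_endRange {V : Type*} [AddCommGroup V] {a : AddMonoid.End V} {x : V} :
    x ∈ endRange a ↔ ∃ v, a v = x := Iff.rfl

/-- Conjugation of an endomorphism by a group element. -/
def conjEnd {G V : Type*} [Group G] [AddCommGroup V] [DistribMulAction G V] (g : G)
    (a : AddMonoid.End V) : AddMonoid.End V := actEnd V g * a * actEnd V g⁻¹

/-- Irreducibility over the integers. -/
def IsIrr (G V : Type*) [Group G] [AddCommGroup V] [DistribMulAction G V] : Prop :=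
  Nontrivial V ∧ ∀ W : AddSubgroup V, (∀ g : G, ∀ w ∈ W, g • w ∈ W) → W = ⊥ ∨ W = ⊤

/-- A projection whose conjugates are pairwise equal or orthogonal. -/
def IsBlock (G : Type*) {V : Type*} [Group G] [AddCommGroup V] [DistribMulAction G V]
    (ε : AddMonoid.End V) : Prop :=
  ε * ε = ε ∧ ε ≠ 0 ∧ ∀ g : G, conjEnd g ε = ε ∨ ε * conjEnd g ε = 0

/-- Primitivity of a linear action: there is no proper block projection. -/
def IsPrim (G V : Type*) [Group G] [AddCommGroup V] [DistribMulAction G V] : Prop :=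
  ∀ ε : AddMonoid.End V, IsBlock G ε → ε = 1

/-- The action is by semilinear maps of a one-dimensional space over a field. -/
def IsSemiLin (G : Type*) (V : Type u) [Group G] [AddCommGroup V] [DistribMulAction G V] : Prop :=
  ∃ (L : Type u) (_ : Field L) (_ : Module L V) (_ : MulSemiringAction G L),
    (∀ (g : G) (a : L) (v : V), g • a • v = (g • a) • g • v) ∧ ∃ v : V, ∀ w : V, ∃ a : L, a • v = w

section Conj

variable {G V : Type*} [Group G] [AddCommGroup V] [DistribMulAction G V]

lemma conjEnd_apply (g : G) (a : AddMonoid.End V) (v : V) : conjEnd g a v = g • a (g⁻¹ • v) := rfl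

lemma smul_end_apply (g : G) (a : AddMonoid.End V) (v : V) : g • a v = conjEnd g a (g • v) := by
  rw [conjEnd_apply, inv_smul_smul]

lemma conjEnd_mul_left (g h : G) (a : AddMonoid.End V) :
    conjEnd (g * h) a = conjEnd g (conjEnd h a) := by
  simp only [conjEnd, mul_inv_rev, actEnd, map_mul, mul_assoc]

@[simp] lemma conjEnd_one_left (a : AddMonoid.End V) : conjEnd (1 : G) a = a := by
  ext v; rw [conjEnd_apply, inv_one, one_smul, one_smul]

/-- Conjugation by a group element as a ring homomorphism. -/
def conjEndHom (g : G) : AddMonoid.End V →+* AddMonoid.End V where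
  toFun := conjEnd g
  map_one' := by
    ext v; rw [conjEnd_apply]; exact smul_inv_smul g v
  map_zero' := by
    ext v; rw [conjEnd_apply]; exact smul_zero g
  map_mul' a b := by
    ext v
    change g • a (b (g⁻¹ • v)) = g • a (g⁻¹ • g • b (g⁻¹ • v))
    rw [inv_smul_smul]
  map_add' a b := by
    ext v
    change g • (a (g⁻¹ • v) + b (g⁻¹ • v)) = _
    rw [smul_add]; rfl

lemma conjEnd_mul (g : G) (a b : AddMonoid.End V) :
    conjEnd g (a * b) = conjEnd g a * conjEnd g b := map_mul (conjEndHom g) a b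

@[simp] lemma conjEnd_zero (g : G) : conjEnd g (0 : AddMonoid.End V) = 0 := map_zero (conjEndHom g)

lemma conjEnd_inv_conjEnd (g : G) (a : AddMonoid.End V) : conjEnd g⁻¹ (conjEnd g a) = a := by
  rw [← conjEnd_mul_left, inv_mul_cancel, conjEnd_one_left]

lemma conjEnd_conjEnd_inv (g : G) (a : AddMonoid.End V) : conjEnd g (conjEnd g⁻¹ a) = a := by
  rw [← conjEnd_mul_left, mul_inv_cancel, conjEnd_one_left]

end Conj

/-- Restriction of an action to an invariant subgroup. -/
abbrev restrictAction {V : Type*} [AddCommGroup V] (G : Type*) [Group G] [DistribMulAction G V]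
    (X : AddSubgroup V) (h : ∀ g : G, ∀ x ∈ X, g • x ∈ X) : DistribMulAction G X where
  smul g x := ⟨g • x.1, h g x.1 x.2⟩
  one_smul x := Subtype.ext (one_smul G x.1)
  mul_smul a b x := Subtype.ext (mul_smul a b x.1)
  smul_zero g := Subtype.ext (smul_zero g)
  smul_add g x y := Subtype.ext (smul_add g x.1 y.1)

/-- A transitive system of orthogonal projections, indexed by the cosets of a stabilizer. -/
structure BlockSystem {G V : Type*} [Group G] [AddCommGroup V] [DistribMulAction G V]
    (N : Subgroup G) [Finite (G ⧸ N)] (e : G ⧸ N → AddMonoid.End V) : Prop where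
  idem : ∀ q, e q * e q = e q
  orth : ∀ q r, q ≠ r → e q * e r = 0
  conj : ∀ (g : G) q, conjEnd g (e q) = e (g • q)
  sum : ∀ v, ∑ᶠ q, e q v = v

namespace BlockSystem

variable {G V : Type*} [Group G] [AddCommGroup V] [DistribMulAction G V]
    {N : Subgroup G}

lemma conj_mem {g : G} {q : G ⧸ N} (hg : g • q = q) : q.out⁻¹ * g * q.out ∈ N := by
  rw [mul_assoc, ← QuotientGroup.eq, QuotientGroup.out_eq']
  conv_lhs => rw [← hg]
  conv_lhs => rw [← QuotientGroup.out_eq' q]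
  rfl

variable [Finite (G ⧸ N)] {e : G ⧸ N → AddMonoid.End V}

lemma smul_apply (h : BlockSystem N e) (g : G) (q : G ⧸ N) (v : V) :
    g • e q v = e (g • q) (g • v) := by
  rw [smul_end_apply, h.conj]

lemma apply_self (h : BlockSystem N e) (q : G ⧸ N) (v : V) : e q (e q v) = e q v :=
  DFunLike.congr_fun (h.idem q) v

lemma apply_ne (h : BlockSystem N e) {q r : G ⧸ N} (hqr : q ≠ r) (v : V) : e q (e r v) = 0 :=
  DFunLike.congr_fun (h.orth q r hqr) v

lemma apply_sum (h : BlockSystem N e) [Fintype (G ⧸ N)] {y : G ⧸ N → V}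
    (hy : ∀ q, e q (y q) = y q) (q : G ⧸ N) : e q (∑ r, y r) = y q := by
  rw [map_sum, Finset.sum_eq_single q, hy]
  · intro r _ hr
    rw [← hy r, h.apply_ne hr.symm]
  · simp

lemma sum_eq (h : BlockSystem N e) [Fintype (G ⧸ N)] (v : V) : ∑ q, e q v = v := by
  rw [← finsum_eq_sum_of_fintype, h.sum]

lemma smul_mem (h : BlockSystem N e) (g : N) (x : V) (hx : x ∈ (endRange (e (1 : G)))) :
    g • x ∈ (endRange (e (1 : G))) := by
  obtain ⟨w, rfl⟩ := mem_endRange.1 hx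
  refine ⟨g • w, ?_⟩
  have : g.1 • ((1 : G) : G ⧸ N) = ((1 : G) : G ⧸ N) := by
    rw [MulAction.Quotient.smul_coe, smul_eq_mul, mul_one]
    exact (QuotientGroup.eq).2 (by simp)
  have h2 := h.smul_apply g.1 ((1 : G) : G ⧸ N) w
  rw [this] at h2
  exact h2.symm

lemma eq_of_mem (h : BlockSystem N e) {x : V} (hx : x ∈ (endRange (e (1 : G)))) :
    e (1 : G) x = x := by
  obtain ⟨w, rfl⟩ := mem_endRange.1 hx
  exact h.apply_self _ w

lemma out_smul (h : BlockSystem N e) (q : G ⧸ N) (v : V) :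
    q.out • e (1 : G) v = e q (q.out • v) := by
  rw [h.smul_apply, MulAction.Quotient.smul_coe, smul_eq_mul, mul_one, QuotientGroup.out_eq']

lemma out_smul_mem (h : BlockSystem N e) (q : G ⧸ N) {x : V} (hx : x ∈ (endRange (e (1 : G)))) :
    e q (q.out • x) = q.out • x := by
  obtain ⟨w, rfl⟩ := mem_endRange.1 hx
  rw [h.out_smul, h.apply_self]

lemma out_inv_smul_mem (h : BlockSystem N e) (q : G ⧸ N) (v : V) :
    q.out⁻¹ • e q v ∈ (endRange (e (1 : G))) := by
  refine mem_endRange.2 ⟨q.out⁻¹ • v, ?_⟩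
  rw [eq_inv_smul_iff, h.out_smul, smul_inv_smul]

/-- An element fixing all blocks and acting trivially on each transported block acts trivially. -/
lemma smul_eq_of_forall (h : BlockSystem N e) {g : G}
    (hfix : ∀ q : G ⧸ N, ∀ x ∈ (endRange (e (1 : G))), (q.out⁻¹ * g * q.out) • x = x) (v : V) :
    g • v = v := by
  have := Fintype.ofFinite (G ⧸ N)
  rw [← h.sum_eq v, Finset.smul_sum]
  refine Finset.sum_congr rfl fun q _ => ?_
  have := hfix q _ (h.out_inv_smul_mem q v)
  rw [← mul_smul, mul_assoc, mul_inv_cancel, mul_one, mul_smul] at this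
  exact smul_left_cancel _ this

lemma card_eq (h : BlockSystem N e) [Finite V] :
    Nat.card V = Nat.card (endRange (e (1 : G))) ^ N.index := by
  have := Fintype.ofFinite (G ⧸ N)
  have h1 : Nat.card V = Nat.card (G ⧸ N → (endRange (e (1 : G)))) := by
    refine Nat.card_congr
      { toFun := fun v q => ⟨_, h.out_inv_smul_mem q v⟩
        invFun := fun x => ∑ q, q.out • (x q).1
        left_inv := fun v => ?_
        right_inv := fun x => ?_ }
    · change ∑ q : G ⧸ N, q.out • q.out⁻¹ • e q v = v
      simp only [smul_inv_smul]
      exact h.sum_eq v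
    · funext q
      apply Subtype.ext
      change q.out⁻¹ • e q (∑ r : G ⧸ N, r.out • (x r).1) = (x q).1
      rw [h.apply_sum (fun r => h.out_smul_mem r (x r).2), inv_smul_smul]
  rw [h1, Nat.card_fun]; rfl

/-- Signs can be chosen in such a way that the stabilizer of the sum fixes each component. -/
lemma exists_signs (h : BlockSystem N e) [Finite V] (hV : Odd (Nat.card V))
    (hG : Odd (Nat.card G)) (hs : Group.IsSolvable G) (x : G ⧸ N → V)
    (hx : ∀ q, e q (x q) = x q) (hx0 : ∀ q, x q ≠ 0) :
    ∃ v : V, ∀ g : G, g • v = v → (∀ q : G ⧸ N, g • q = q) ∧ ∀ q, g • x q = x q := by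
  classical
  have := Fintype.ofFinite (G ⧸ N)
  obtain ⟨κ, hκ, hκ'⟩ := exists_invariant_sign (P := V) hG (fun v => -v) neg_neg
    (fun g v => (smul_neg g v).symm)
  obtain ⟨c, hc⟩ := exists_coloring G (G ⧸ N) hG hs
  have hne : ∀ v : V, v ≠ 0 → -v ≠ v := by
    intro v hv hv'
    have h2 : (2 : ℕ) • v = 0 := by rw [two_nsmul]; nth_rw 1 [← hv']; simp
    refine hv ?_
    rw [← AddMonoid.addOrderOf_eq_one_iff, ← Nat.dvd_one,
      ← Nat.coprime_iff_gcd_eq_one.1 (Nat.coprime_two_right.2 hV)]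
    exact Nat.dvd_gcd (addOrderOf_dvd_natCard v) (addOrderOf_dvd_of_nsmul_eq_zero h2)
  let y : G ⧸ N → V := fun q => if κ (x q) = c q then x q else - x q
  have hy : ∀ q, y q = x q ∨ y q = - x q := fun q => by
    simp only [y]; split_ifs <;> simp
  have hyκ : ∀ q, κ (y q) = c q := by
    intro q
    simp only [y]
    split_ifs with hq
    · exact hq
    · rw [hκ' _ (hne _ (hx0 q))]
      revert hq
      generalize κ (x q) = a
      generalize c q = b
      revert a b
      decide
  have hye : ∀ q, e q (y q) = y q := by
    intro q
    rcases hy q with h' | h' <;> rw [h'] <;> simp [hx q]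
  refine ⟨∑ q, y q, fun g hg => ?_⟩
  have hgy : ∀ q, g • y q = y (g • q) := by
    intro q
    have h1 := h.smul_apply g q (∑ r, y r)
    rwa [hg, h.apply_sum hye, h.apply_sum hye] at h1
  have hgq : ∀ q : G ⧸ N, g • q = q := hc g fun q => by rw [← hyκ, ← hgy, hκ, hyκ]
  refine ⟨hgq, fun q => ?_⟩
  have h1 := hgy q
  rw [hgq q] at h1
  rcases hy q with h' | h'
  · rwa [h'] at h1
  · rw [h', smul_neg] at h1
    exact neg_injective h1

end BlockSystem

/-- A block projection of an irreducible action gives rise to a block system. -/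
lemma IsBlock.exists_blockSystem {G V : Type*} [Group G] [Finite G] [AddCommGroup V]
    [DistribMulAction G V] (hirr : IsIrr G V) {ε : AddMonoid.End V} (hε : IsBlock G ε) :
    ∃ (N : Subgroup G) (e : G ⧸ N → AddMonoid.End V), BlockSystem N e ∧ e (1 : G) = ε ∧
      ∀ g, g ∈ N ↔ conjEnd g ε = ε := by
  classical
  obtain ⟨hid, hne, hcj⟩ := hε
  let N : Subgroup G :=
    { carrier := {g | conjEnd g ε = ε}
      one_mem' := conjEnd_one_left ε
      mul_mem' := fun {a b} ha hb => by
        change conjEnd (a * b) ε = ε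
        rw [conjEnd_mul_left, show conjEnd b ε = ε from hb, show conjEnd a ε = ε from ha]
      inv_mem' := fun {a} ha => by
        change conjEnd a⁻¹ ε = ε
        conv_lhs => rw [← show conjEnd a ε = ε from ha]
        rw [conjEnd_inv_conjEnd] }
  have hN : ∀ g, g ∈ N ↔ conjEnd g ε = ε := fun g => Iff.rfl
  have hcjN : ∀ g h : G, (g : G ⧸ N) = h → conjEnd g ε = conjEnd h ε := by
    intro g h hgh
    have := (hN _).1 ((QuotientGroup.eq).1 hgh)
    rw [conjEnd_mul_left] at this
    rw [← this, conjEnd_conjEnd_inv, this]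
  have hcjN' : ∀ g h : G, (g : G ⧸ N) ≠ h → conjEnd g ε * conjEnd h ε = 0 := by
    intro g h hgh
    rcases hcj (g⁻¹ * h) with h' | h'
    · exact absurd ((QuotientGroup.eq).2 ((hN _).2 h')) hgh
    · have := congrArg (conjEnd g) h'
      rwa [conjEnd_mul, conjEnd_zero, conjEnd_mul_left, conjEnd_conjEnd_inv] at this
  let e : G ⧸ N → AddMonoid.End V := fun q => conjEnd q.out ε
  have he : ∀ g : G, e (g : G ⧸ N) = conjEnd g ε := fun g =>
    hcjN _ _ (QuotientGroup.out_eq' _)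
  have he1 : e (1 : G) = ε := by rw [he, conjEnd_one_left]
  have hft := Fintype.ofFinite (G ⧸ N)
  have hconj : ∀ (g : G) q, conjEnd g (e q) = e (g • q) := by
    intro g q
    induction q using QuotientGroup.induction_on with
    | H h => rw [he, ← conjEnd_mul_left, MulAction.Quotient.smul_coe, he]; rfl
  have hidem : ∀ q, e q * e q = e q := fun q => by
    simp only [e]; rw [← conjEnd_mul, hid]
  have horth : ∀ q r, q ≠ r → e q * e r = 0 := by
    intro q r hqr
    refine hcjN' _ _ ?_
    rwa [QuotientGroup.out_eq', QuotientGroup.out_eq']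
  have hsum : ∀ v, ∑ᶠ q, e q v = v := by
    intro v
    rw [finsum_eq_sum_of_fintype]
    let s : AddMonoid.End V := ∑ q, e q
    have hsv : ∀ v, s v = ∑ q, e q v := fun v => by
      simp only [s]
      exact AddMonoidHom.finsetSum_apply (fun q => (e q : V →+ V)) _ v
    have hs2 : ∀ v, s (s v) = s v := by
      intro v
      rw [hsv (s v), hsv v]
      refine Finset.sum_congr rfl fun q _ => ?_
      rw [map_sum, Finset.sum_eq_single q]
      · exact DFunLike.congr_fun (hidem q) v
      · intro r _ hr; exact DFunLike.congr_fun (horth q r hr.symm) v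
      · simp
    have hsg : ∀ (g : G) v, g • s v = s (g • v) := by
      intro g v
      rw [hsv, hsv, Finset.smul_sum]
      refine Fintype.sum_equiv (MulAction.toPerm g) _ _ fun q => ?_
      rw [smul_end_apply, hconj]; rfl
    rcases hirr.2 (endRange s) (by
      intro g x hx
      obtain ⟨w, rfl⟩ := mem_endRange.1 hx
      exact ⟨g • w, (hsg g w).symm⟩) with h | h
    · exfalso
      apply hne
      have hz : ∀ v, s v = 0 := fun v => by
        have : s v ∈ endRange s := ⟨v, rfl⟩
        rw [h] at this; exact this
      ext v
      have h2 : e (1 : G) (s v) = e (1 : G) v := by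
        rw [hsv, map_sum, Finset.sum_eq_single ((1 : G) : G ⧸ N)]
        · exact DFunLike.congr_fun (hidem _) v
        · intro r _ hr; exact DFunLike.congr_fun (horth _ r hr.symm) v
        · simp
      rw [hz, map_zero, he1] at h2
      exact h2.symm
    · rw [← hsv]
      have : v ∈ endRange s := h ▸ AddSubgroup.mem_top v
      obtain ⟨w, rfl⟩ := mem_endRange.1 this
      exact hs2 w
  have hsys : BlockSystem N e := ⟨hidem, horth, hconj, hsum⟩
  exact ⟨N, e, hsys, he1, hN⟩

/-- A block of an irreducible action is irreducible under its stabilizer. -/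
lemma BlockSystem.eq_bot_or_le {G V : Type*} [Group G] [AddCommGroup V] [DistribMulAction G V]
    {N : Subgroup G} [Finite (G ⧸ N)] {e : G ⧸ N → AddMonoid.End V} (h : BlockSystem N e)
    (hirr : IsIrr G V) (X : AddSubgroup V) (hXe : X ≤ endRange (e (1 : G)))
    (hX : ∀ g ∈ N, ∀ x ∈ X, g • x ∈ X) : X = ⊥ ∨ endRange (e (1 : G)) ≤ X := by
  let Y : AddSubgroup V :=
    { carrier := {v | ∀ g : G, e (1 : G) (g • v) ∈ X}
      zero_mem' := fun g => by rw [smul_zero, map_zero]; exact X.zero_mem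
      add_mem' := fun {a b} ha hb g => by rw [smul_add, map_add]; exact X.add_mem (ha g) (hb g)
      neg_mem' := fun {a} ha g => by rw [smul_neg, map_neg]; exact X.neg_mem (ha g) }
  rcases hirr.2 Y (fun g w hw h => by have := hw (h * g); rwa [mul_smul] at this) with hY | hY
  · left
    rw [eq_bot_iff]
    intro x hx
    have hxY : x ∈ Y := by
      intro g
      by_cases hg : g ∈ N
      · rw [show e (1 : G) (g • x) = g • x from h.eq_of_mem (h.smul_mem ⟨g, hg⟩ x (hXe hx))]
        exact hX g hg x hx
      · convert X.zero_mem
        rw [← h.eq_of_mem (hXe hx), h.smul_apply, h.apply_ne]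
        intro h1
        rw [MulAction.Quotient.smul_coe, smul_eq_mul, mul_one, QuotientGroup.eq] at h1
        exact hg (by simpa using h1)
    rwa [hY] at hxY
  · right
    intro x hx
    have hx' : x ∈ Y := hY ▸ AddSubgroup.mem_top _
    have h1 := hx' 1
    rwa [one_smul, h.eq_of_mem hx] at h1

/-- Every irreducible action has a block system whose block is irreducible and primitive. -/
lemma exists_blockSystem {G V : Type*} [Group G] [Finite G] [AddCommGroup V] [Finite V]
    [DistribMulAction G V] (hirr : IsIrr G V) :
    ∃ (N : Subgroup G) (e : G ⧸ N → AddMonoid.End V) (h : BlockSystem N e),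
      let _ := restrictAction N (endRange (e (1 : G))) h.smul_mem
      IsIrr N (endRange (e (1 : G))) ∧ IsPrim N (endRange (e (1 : G))) := by
  classical
  have := hirr.1
  have h10 : (1 : AddMonoid.End V) ≠ 0 := by
    obtain ⟨x, hx⟩ := exists_ne (0 : V)
    exact fun h => hx (DFunLike.congr_fun h x)
  have h1 : IsBlock G (1 : AddMonoid.End V) :=
    ⟨one_mul 1, h10, fun g => Or.inl (map_one (conjEndHom g))⟩
  obtain ⟨ε, hε, hmin⟩ := Set.exists_min_image {ε : AddMonoid.End V | IsBlock G ε}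
    (fun ε => Nat.card (endRange ε)) (by
      have : Finite (V → V) := inferInstance
      have : Finite (AddMonoid.End V) := Finite.of_injective (fun f : AddMonoid.End V => (f : V → V))
        DFunLike.coe_injective
      exact Set.toFinite _) ⟨1, h1⟩
  obtain ⟨hid, hne, hcj⟩ := hε
  obtain ⟨N, e, hsys, he1, hN⟩ := IsBlock.exists_blockSystem hirr ⟨hid, hne, hcj⟩
  refine ⟨N, e, hsys, ?_⟩
  intro inst
  have hεr : ∀ x : V, x ∈ (endRange (e (1 : G))) → ε x = x := fun x hx => he1 ▸ hsys.eq_of_mem hx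
  have hεm : ∀ x : V, ε x ∈ (endRange (e (1 : G))) := fun x => mem_endRange.2 ⟨x, by rw [he1]⟩
  have hNε : ∀ g ∈ N, ∀ x, g • ε x = ε (g • x) := fun g hg x => by
    rw [smul_end_apply, (hN g).1 hg]
  have hNε' : ∀ g, g ∉ N → ∀ x, ε (g • ε x) = 0 := fun g hg x => by
    rw [smul_end_apply]
    rcases hcj g with h' | h'
    · exact absurd ((hN g).2 h') hg
    · exact DFunLike.congr_fun h' _
  have hsmul : ∀ (g : N) (x : (endRange (e (1 : G)))),
      ((g • x : (endRange (e (1 : G)))) : V) = g.1 • x.1 :=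
    fun _ _ => rfl
  refine ⟨⟨?_, ?_⟩, ?_⟩
  · obtain ⟨x, hx⟩ : ∃ x, ε x ≠ 0 := by
      by_contra hcon
      push Not at hcon
      exact hne (AddMonoidHom.ext hcon)
    exact ⟨⟨⟨ε x, hεm x⟩, 0, fun h => hx (congrArg Subtype.val h)⟩⟩
  · intro X hX
    rcases hsys.eq_bot_or_le hirr (X.map (endRange (e (1 : G))).subtype)
      (by rintro _ ⟨x, -, rfl⟩; exact x.2)
      (by rintro g hg _ ⟨x, hx, rfl⟩; exact ⟨_, hX ⟨g, hg⟩ x hx, rfl⟩) with hY | hY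
    · exact .inl ((AddSubgroup.map_eq_bot_iff_of_injective X (AddSubgroup.subtype_injective _)).1 hY)
    · refine .inr ((AddSubgroup.eq_top_iff' X).2 fun x => ?_)
      obtain ⟨x', hx', h⟩ := hY x.2
      rwa [← Subtype.ext h]
  · intro f hf
    obtain ⟨hf1, hf2, hf3⟩ := hf
    let π : V →+ (endRange (e (1 : G))) := AddMonoidHom.rangeRestrict (e (1 : G))
    have hπ : ∀ v, (π v).1 = ε v := fun v => by
      change e (1 : G) v = _
      rw [he1]
    have hπ' : ∀ x : (endRange (e (1 : G))), π x.1 = x := fun x =>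
      Subtype.ext (by rw [hπ, hεr _ x.2])
    let F : AddMonoid.End V := (endRange (e (1 : G))).subtype.comp (AddMonoidHom.comp f π)
    have hF : ∀ v, F v = (f (π v)).1 := fun v => rfl
    have hπg : ∀ (g : N) v, π (g.1 • v) = g • π v := fun g v => Subtype.ext (by
      rw [hπ, hsmul, hπ, hNε g.1 g.2])
    have hFF : ∀ v, F (F v) = F v := fun v => by
      rw [hF, hF, hπ']; exact congrArg Subtype.val (DFunLike.congr_fun hf1 (π v))
    have hblock : IsBlock G F := by
      refine ⟨AddMonoidHom.ext hFF, ?_, fun g => ?_⟩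
      · intro h0
        apply hf2
        ext x
        have := DFunLike.congr_fun h0 x.1
        rw [hF, hπ'] at this
        exact this
      · by_cases hg : g ∈ N
        · have hcF : ∀ v, conjEnd g F v = (conjEnd (⟨g, hg⟩ : N) f (π v)).1 := by
            intro v
            rw [conjEnd_apply, conjEnd_apply, hF, hsmul]
            have := hπg ⟨g, hg⟩⁻¹ v
            exact congrArg (fun z => g • (f z).1) this
          rcases hf3 ⟨g, hg⟩ with h' | h'
          · left
            ext v
            rw [hcF, h']; rfl
          · right
            ext v
            change F (conjEnd g F v) = 0
            rw [hcF, hF, hπ']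
            exact congrArg Subtype.val (DFunLike.congr_fun h' (π v))
        · right
          ext v
          change F (conjEnd g F v) = 0
          rw [hF, conjEnd_apply]
          have h0 : π (g • F (g⁻¹ • v)) = 0 := by
            apply Subtype.ext
            rw [hπ]
            have := hNε' g hg (F (g⁻¹ • v))
            rwa [hεr (F (g⁻¹ • v)) (f (π _)).2] at this
          rw [h0, map_zero]; rfl
    have hle := hmin F hblock
    have hsub : endRange F ≤ endRange ε := by
      intro x hx
      obtain ⟨v, rfl⟩ := mem_endRange.1 hx
      exact ⟨F v, hεr _ (f (π v)).2⟩
    have heq : endRange F = endRange ε := by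
      apply SetLike.coe_injective
      exact Set.eq_of_subset_of_ncard_le hsub hle (Set.toFinite _)
    ext x
    have hx : x.1 ∈ endRange F := heq ▸ ⟨x.1, hεr _ x.2⟩
    obtain ⟨w, hw⟩ := mem_endRange.1 hx
    have h2 := hFF w
    rw [hw, hF, hπ'] at h2
    exact h2

lemma exists_pow_idem {M : Type*} [Monoid M] [Finite M] (a : M) :
    ∃ k, 0 < k ∧ a ^ k * a ^ k = a ^ k := by
  obtain ⟨m, n, hmn, h⟩ : ∃ m n : ℕ, m < n ∧ a ^ m = a ^ n := by
    have : ¬ Function.Injective (fun n : ℕ => a ^ n) := not_injective_infinite_finite _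
    simp only [Function.Injective, not_forall] at this
    obtain ⟨m, n, h, hne⟩ := this
    rcases Nat.lt_or_gt_of_ne hne with h' | h'
    · exact ⟨m, n, h', h⟩
    · exact ⟨n, m, h', h.symm⟩
  obtain ⟨k, rfl⟩ := Nat.exists_eq_add_of_lt hmn
  have h1 : ∀ i, m ≤ i → a ^ (i + (k + 1)) = a ^ i := by
    intro i hi
    obtain ⟨j, rfl⟩ := Nat.exists_eq_add_of_le hi
    rw [show m + j + (k + 1) = (m + k + 1) + j by ring, pow_add, ← h, ← pow_add]
  have h2 : ∀ j i, m ≤ i → a ^ (i + j * (k + 1)) = a ^ i := by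
    intro j
    induction j with
    | zero => simp
    | succ j ih =>
      intro i hi
      rw [show i + (j + 1) * (k + 1) = (i + j * (k + 1)) + (k + 1) by ring, h1 _ (by omega), ih i hi]
  refine ⟨(m + 1) * (k + 1), by positivity, ?_⟩
  rw [← pow_add, h2 _ _ (by nlinarith)]

instance finite_addMonoidEnd {V : Type*} [AddCommGroup V] [Finite V] :
    Finite (AddMonoid.End V) :=
  Finite.of_injective (fun f : AddMonoid.End V => (f : V → V)) DFunLike.coe_injective

/-- For a primitive irreducible action, the only nonzero idempotent of an invariant commutative
ring of endomorphisms is the identity. -/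
lemma idem_eq_one_of_prim {G V : Type*} [Group G] [AddCommGroup V] [Finite V]
    [DistribMulAction G V] (hp : IsPrim G V) (R : Subring (AddMonoid.End V))
    (hc : ∀ a ∈ R, ∀ b ∈ R, a * b = b * a) (hR : ∀ g : G, ∀ a ∈ R, conjEnd g a ∈ R)
    {a : AddMonoid.End V} (ha : a ∈ R) (hid : a * a = a) (ha0 : a ≠ 0) : a = 1 := by
  obtain ⟨ε, ⟨hε, hεi, hε0⟩, hmin⟩ := Set.exists_min_image
    {ε : AddMonoid.End V | ε ∈ R ∧ ε * ε = ε ∧ ε ≠ 0}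
    (fun ε => Nat.card (endRange ε)) (Set.toFinite _) ⟨a, ha, hid, ha0⟩
  have key : ∀ {f : AddMonoid.End V}, f ∈ R → f * f = f → ε * f ≠ 0 → ε * f = ε := by
    intro f hf hfi h0
    have hle := hmin (ε * f) ⟨R.mul_mem hε hf, by
      rw [mul_assoc, ← mul_assoc f, hc f hf ε hε, mul_assoc, hfi, ← mul_assoc, hεi], h0⟩
    have hsub : endRange (ε * f) ≤ endRange ε := by
      intro x hx
      obtain ⟨v, rfl⟩ := mem_endRange.1 hx
      exact mem_endRange.2 ⟨f v, rfl⟩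
    have heq : endRange (ε * f) = endRange ε :=
      SetLike.coe_injective (Set.eq_of_subset_of_ncard_le hsub hle (Set.toFinite _))
    ext v
    have hv : ε v ∈ endRange (ε * f) := heq ▸ mem_endRange.2 ⟨v, rfl⟩
    obtain ⟨w, hw⟩ := mem_endRange.1 hv
    have h1 : (ε * f) (ε v) = ε v := by
      rw [← hw]
      change (ε * f * (ε * f)) w = _
      rw [mul_assoc, ← mul_assoc f, hc f hf ε hε, mul_assoc, hfi, ← mul_assoc, hεi]
    rw [← h1]
    change _ = (ε * f * ε) v
    rw [mul_assoc, hc f hf ε hε, ← mul_assoc, hεi]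
  have hcj : ∀ g : G, conjEnd g ε * conjEnd g ε = conjEnd g ε := fun g => by
    rw [← conjEnd_mul, hεi]
  have hblock : IsBlock G ε := by
    refine ⟨hεi, hε0, fun g => ?_⟩
    by_cases h0 : ε * conjEnd g ε = 0
    · exact Or.inr h0
    left
    have h1 := key (hR g ε hε) (hcj g) h0
    have h2 : ε * conjEnd g⁻¹ ε = ε := by
      refine key (hR g⁻¹ ε hε) (hcj g⁻¹) fun h => ?_
      have := congrArg (conjEnd g) h
      rw [conjEnd_mul, conjEnd_conjEnd_inv, conjEnd_zero, hc _ (hR g ε hε) _ hε] at this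
      exact h0 this
    have h3 := congrArg (conjEnd g) h2
    rw [conjEnd_mul, conjEnd_conjEnd_inv, hc _ (hR g ε hε) _ hε, h1] at h3
    exact h3.symm
  have h1 := hp ε hblock
  subst h1
  have := key ha hid (by rwa [one_mul])
  rwa [one_mul] at this

/-- An invariant commutative ring of endomorphisms of a primitive irreducible action is a field. -/
lemma exists_inv_of_prim {G V : Type*} [Group G] [AddCommGroup V] [Finite V]
    [DistribMulAction G V] (hirr : IsIrr G V) (hp : IsPrim G V) (R : Subring (AddMonoid.End V))
    (hc : ∀ a ∈ R, ∀ b ∈ R, a * b = b * a) (hR : ∀ g : G, ∀ a ∈ R, conjEnd g a ∈ R)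
    {a : AddMonoid.End V} (ha : a ∈ R) (ha0 : a ≠ 0) : ∃ b ∈ R, a * b = 1 := by
  have := hirr.1
  have hnil : ∀ b ∈ R, ∀ k, b ^ k = 0 → b = 0 := by
    obtain ⟨U, ⟨hUR, hU0⟩, hmin⟩ := Set.exists_min_image
      {U : AddSubgroup V | (∀ b ∈ R, ∀ v ∈ U, b v ∈ U) ∧ U ≠ ⊥}
      (fun U => Nat.card U) (by
        have : Finite (AddSubgroup V) := Finite.of_injective (fun U => (U : Set V))
          SetLike.coe_injective
        exact Set.toFinite _) ⟨⊤, fun _ _ _ _ => AddSubgroup.mem_top _, top_ne_bot⟩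
    have hkill : ∀ b ∈ R, ∀ k, b ^ k = 0 → ∀ v ∈ U, b v = 0 := by
      intro b hb k hk v hv
      by_contra hbv
      let X : AddSubgroup V := U.map (b : V →+ V)
      have hXle : X ≤ U := by
        rintro _ ⟨w, hw, rfl⟩
        exact hUR b hb w hw
      have h1 := hmin X ⟨by
        rintro c hcR _ ⟨w, hw, rfl⟩
        refine ⟨c w, hUR c hcR w hw, ?_⟩
        exact DFunLike.congr_fun (hc b hb c hcR) w, fun h => hbv (by
          have : b v ∈ X := ⟨v, hv, rfl⟩
          rw [h] at this; exact this)⟩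
      have hX : X = U :=
        SetLike.coe_injective (Set.eq_of_subset_of_ncard_le hXle h1 (Set.toFinite _))
      have hpow : ∀ k, ∀ w ∈ U, ∃ x ∈ U, (b ^ k) x = w := by
        intro k
        induction k with
        | zero => exact fun w hw => ⟨w, hw, rfl⟩
        | succ k ih =>
          intro w hw
          rw [← hX] at hw
          obtain ⟨y, hy, rfl⟩ := hw
          obtain ⟨x, hx, rfl⟩ := ih y hy
          exact ⟨x, hx, by rw [pow_succ']; rfl⟩
      apply hU0
      rw [eq_bot_iff]
      intro w hw
      obtain ⟨x, -, rfl⟩ := hpow k w hw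
      rw [hk]; exact AddSubgroup.zero_mem _
    let Y : AddSubgroup V :=
      { carrier := {v | ∀ b ∈ R, ∀ k, b ^ k = 0 → b v = 0}
        zero_mem' := fun b _ _ _ => map_zero b
        add_mem' := fun {x y} hx hy b hb k hk => by
          rw [map_add, hx b hb k hk, hy b hb k hk, add_zero]
        neg_mem' := fun {x} hx b hb k hk => by rw [map_neg, hx b hb k hk, neg_zero] }
    have hY : Y = ⊤ := by
      refine (hirr.2 Y fun g w hw b hb k hk => ?_).resolve_left fun h => hU0 ?_
      · have h1 := hw (conjEnd g⁻¹ b) (hR _ b hb) k (by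
          have := (map_pow (conjEndHom (V := V) g⁻¹) b k).symm
          rw [hk, map_zero] at this
          exact this)
        have h2 := smul_end_apply g (conjEnd g⁻¹ b) w
        rw [h1, conjEnd_conjEnd_inv, smul_zero] at h2
        exact h2.symm
      · rw [eq_bot_iff, ← h]
        exact fun w hw b hb k hk => hkill b hb k hk w hw
    intro b hb k hk
    ext v
    have : v ∈ Y := hY ▸ AddSubgroup.mem_top v
    exact this b hb k hk
  obtain ⟨k, hk, hidem⟩ := exists_pow_idem a
  have h1 := idem_eq_one_of_prim hp R hc hR (R.pow_mem ha k) hidem fun h => ha0 (hnil a ha k h)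
  refine ⟨a ^ (k - 1), R.pow_mem ha _, ?_⟩
  rw [← pow_succ', Nat.sub_add_cancel hk, h1]

/-- An abelian normal subgroup of a primitive irreducible group generates a field. -/
lemma exists_field_of_normal {G : Type*} {V : Type u} [Group G] [AddCommGroup V] [Finite V]
    [DistribMulAction G V] (hirr : IsIrr G V) (hp : IsPrim G V) (A : Subgroup G) [A.Normal]
    (hA : ∀ a ∈ A, ∀ b ∈ A, a * b = b * a) :
    ∃ (L : Type u) (_ : Field L) (_ : Finite L) (_ : Module L V) (_ : MulSemiringAction G L)
      (χ : A →* Lˣ), (∀ (g : G) (a : L) (v : V), g • a • v = (g • a) • g • v) ∧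
      (∀ (z : A) (v : V), z.1 • v = (χ z : L) • v) ∧
      ∀ g : G, (∀ z : A, g • (χ z : L) = χ z) → ∀ a : L, g • a = a := by
  have := hirr.1
  let S : Set (AddMonoid.End V) := {f | ∃ a ∈ A, f = actEnd V a}
  let R : Subring (AddMonoid.End V) := Subring.closure S
  have hcc : IsMulCommutative R := Subring.isMulCommutative_closure (by
    rintro _ ⟨a, ha, rfl⟩ _ ⟨b, hb, rfl⟩
    rw [← map_mul, ← map_mul, hA a ha b hb])
  have hc : ∀ a ∈ R, ∀ b ∈ R, a * b = b * a := fun a ha b hb =>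
    congrArg Subtype.val (mul_comm' (⟨a, ha⟩ : R) ⟨b, hb⟩)
  have hcact : ∀ g a : G, conjEnd g (actEnd V a) = actEnd V (g * a * g⁻¹) := fun g a => by
    ext v
    change g • a • g⁻¹ • v = (g * a * g⁻¹) • v
    rw [mul_smul, mul_smul]
  have hR : ∀ g : G, ∀ a ∈ R, conjEnd g a ∈ R := by
    intro g a ha
    have : R ≤ R.comap (conjEndHom g) := by
      refine (Subring.closure_le).2 ?_
      rintro _ ⟨a, ha, rfl⟩
      change conjEnd g (actEnd V a) ∈ R
      rw [hcact]
      exact Subring.subset_closure ⟨_, Subgroup.Normal.conj_mem inferInstance a ha g, rfl⟩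
    exact this ha
  have hF : IsField R :=
    { exists_pair_ne := ⟨0, 1, fun h => by
        obtain ⟨x, hx⟩ := exists_ne (0 : V)
        exact hx (DFunLike.congr_fun (congrArg Subtype.val h) x).symm⟩
      mul_comm := fun a b => Subtype.ext (hc a a.2 b b.2)
      mul_inv_cancel := fun {a} ha => by
        obtain ⟨b, hb, hab⟩ := exists_inv_of_prim hirr hp R hc hR a.2
          (fun h => ha (Subtype.ext h))
        exact ⟨⟨b, hb⟩, Subtype.ext hab⟩ }
  let act : MulSemiringAction G R :=
    { smul := fun g a => ⟨conjEnd g a.1, hR g a a.2⟩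
      one_smul := fun a => Subtype.ext (conjEnd_one_left a.1)
      mul_smul := fun g h a => Subtype.ext (conjEnd_mul_left g h a.1)
      smul_zero := fun g => Subtype.ext (conjEnd_zero g)
      smul_add := fun g a b => Subtype.ext (map_add (conjEndHom g) a.1 b.1)
      smul_one := fun g => Subtype.ext (map_one (conjEndHom g))
      smul_mul := fun g a b => Subtype.ext (conjEnd_mul g a.1 b.1) }
  let χ₀ : A →* R :=
    { toFun := fun z => ⟨actEnd V z.1, Subring.subset_closure ⟨z.1, z.2, rfl⟩⟩
      map_one' := Subtype.ext (map_one _)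
      map_mul' := fun a b => Subtype.ext (map_mul _ _ _) }
  refine ⟨R, hF.toField, inferInstance, inferInstanceAs (Module R V), act, χ₀.toHomUnits,
    fun g a v => smul_end_apply g a.1 v, fun z v => rfl, fun g hg a => ?_⟩
  apply Subtype.ext
  change conjEnd g a.1 = a.1
  have hle : R ≤ RingHom.eqLocus (conjEndHom g) (RingHom.id _) := by
    refine (Subring.closure_le).2 ?_
    rintro _ ⟨a, ha, rfl⟩
    exact congrArg Subtype.val (hg ⟨a, ha⟩)
  exact hle a.2

/-- A semilinear irreducible action in which every linear element is scalar
is one-dimensional. -/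
lemma exists_generator_of_scalar {G L V : Type*} [Group G] [Finite G] [Field L] [Finite L]
    [AddCommGroup V] [DistribMulAction G V] [Module L V] [MulSemiringAction G L]
    (hirr : IsIrr G V) (hsl : ∀ (g : G) (a : L) (v : V), g • a • v = (g • a) • g • v)
    (hscal : ∀ g : G, (∀ a : L, g • a = a) → ∃ b : L, ∀ v : V, g • v = b • v) :
    ∃ v : V, ∀ w : V, ∃ a : L, a • v = w := by
  classical
  have := hirr.1
  let K := FixedPoints.subfield G L
  have := Fintype.ofFinite (L ≃ₐ[K] L)
  obtain ⟨τ, hτ⟩ := IsCyclic.exists_generator (α := L ≃ₐ[K] L)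
  obtain ⟨h, hh⟩ := FixedPoints.toAlgAut_surjective G L τ
  have hτh : ∀ a : L, τ a = h • a := fun a => by rw [← hh]; rfl
  have hτi : ∀ (i : ℕ) (a : L), (τ ^ i) a = h ^ i • a := fun i a => by
    rw [← hh, ← map_pow]; rfl
  have himg := IsCyclic.image_range_orderOf hτ
  have hgen : ∀ g : G, ∃ i : ℕ, ∀ a : L, g • a = h ^ i • a := by
    intro g
    have h1 : MulSemiringAction.toAlgAut G K L g ∈ Finset.univ := Finset.mem_univ _
    rw [← himg, Finset.mem_image] at h1
    obtain ⟨i, -, hi⟩ := h1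
    exact ⟨i, fun a => by rw [← hτi, hi]; rfl⟩
  set n := orderOf τ with hn
  have hnpos : 0 < n := orderOf_pos τ
  obtain ⟨b, hb⟩ := hscal (h ^ n) fun a => by rw [← hτi, hn, pow_orderOf_eq_one]; rfl
  have hb0 : b ≠ 0 := by
    rintro rfl
    obtain ⟨x, hx⟩ := exists_ne (0 : V)
    have := hb x
    rw [zero_smul, smul_eq_zero_iff_eq] at this
    exact hx this
  have hbh : h • b = b := by
    obtain ⟨x, hx⟩ := exists_ne (0 : V)
    have h1 := hsl h b x
    rw [← hb, ← mul_smul, ← pow_succ', pow_succ, mul_smul, hb] at h1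
    exact (smul_left_injective L (m := h • x) (by rwa [Ne, smul_eq_zero_iff_eq]) h1).symm
  have hbi : ∀ i : ℕ, h ^ i • b = b := by
    intro i
    induction i with
    | zero => simp
    | succ i ih => rw [pow_succ', mul_smul, ih, hbh]
  have hbK : ∀ g : G, g • b = b := fun g => by
    obtain ⟨i, hi⟩ := hgen g
    rw [hi, hbi]
  obtain ⟨a, ha⟩ := FiniteField.norm_surjective K L (⟨b, hbK⟩ : K)
  have hprod : ∏ i ∈ Finset.range n, h ^ i • a = b := by
    have h1 := Algebra.norm_eq_prod_automorphisms K a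
    rw [ha] at h1
    change b = _ at h1
    have h2 : b = ∏ σ : L ≃ₐ[K] L, σ a := h1.trans (by congr!)
    rw [h2, ← himg, Finset.prod_image]
    · exact Finset.prod_congr rfl fun i _ => (hτi i a).symm
    · intro i hi j hj hij
      exact pow_injOn_Iio_orderOf (by simpa using hi) (by simpa using hj) hij
  have ha0 : a ≠ 0 := by
    rintro rfl
    refine hb0 (hprod.symm.trans (Finset.prod_eq_zero (Finset.mem_range.2 hnpos) ?_))
    simp
  let c : ℕ → L := fun k => ∏ i ∈ Finset.range k, h ^ i • a
  have hcs : ∀ k, c (k + 1) = a * h • c k := by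
    intro k
    simp only [c]
    rw [Finset.prod_range_succ', Finset.smul_prod', mul_comm, pow_zero, one_smul]
    congr 1
    refine Finset.prod_congr rfl fun i _ => ?_
    rw [pow_succ', mul_smul]
  have hcn : c n = b := hprod
  let y : V → ℕ → V := fun v k => (c k)⁻¹ • h ^ k • v
  have hy : ∀ v k, h • y v k = a • y v (k + 1) := by
    intro v k
    simp only [y]
    rw [hsl, hcs, smul_inv'', ← mul_smul h, ← pow_succ', ← mul_smul a, mul_inv,
      mul_inv_cancel_left₀ ha0]
  have hyn : ∀ v, y v n = y v 0 := by
    intro v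
    simp only [y, hcn]
    rw [hb, smul_smul, inv_mul_cancel₀ hb0]
    simp [c]
  have hS : ∀ v, h • ∑ k ∈ Finset.range n, y v k = a • ∑ k ∈ Finset.range n, y v k := by
    intro v
    rw [Finset.smul_sum, Finset.sum_congr rfl fun k _ => hy v k, ← Finset.smul_sum]
    congr 1
    have h1 := Finset.sum_range_succ (y v) n
    rw [Finset.sum_range_succ', hyn] at h1
    exact add_right_cancel h1
  obtain ⟨v, hv⟩ := exists_ne (0 : V)
  obtain ⟨l, hl⟩ : ∃ l : L, ∑ k ∈ Finset.range n, y (l • v) k ≠ 0 := by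
    by_contra hcon
    push Not at hcon
    have hyl : ∀ (l : L) k, y (l • v) k = (h ^ k • l) • y v k := fun l k => by
      simp only [y]
      rw [hsl, smul_comm]
    obtain ⟨φ, hφ⟩ : ∃ φ : Module.Dual L V, φ v ≠ 0 := by
      by_contra hcon
      push Not at hcon
      exact hv ((Module.forall_dual_apply_eq_zero_iff L v).1 hcon)
    have hind := (linearIndependent_monoidHom L L).comp
      (fun i : Fin n => ((τ ^ (i : ℕ) : L ≃ₐ[K] L) : L →* L)) (by
        intro i j hij
        apply Fin.ext
        apply pow_injOn_Iio_orderOf i.2 j.2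
        ext x
        exact DFunLike.congr_fun hij x)
    rw [Fintype.linearIndependent_iff] at hind
    have := hind (fun i => φ (y v i)) (by
      funext l
      rw [Finset.sum_apply]
      have h1 := congrArg φ (hcon l)
      rw [map_sum, map_zero, Finset.sum_range] at h1
      rw [Pi.zero_apply, ← h1]
      refine Finset.sum_congr rfl fun i _ => ?_
      rw [hyl, LinearMap.map_smul φ (h ^ (i : ℕ) • l) (y v i), ← hτi]
      exact mul_comm (φ (y v i)) _) ⟨0, hnpos⟩
    apply hφ
    simpa [y, c] using this
  set w := ∑ k ∈ Finset.range n, y (l • v) k with hw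
  have hwh : h • w = a • w := hS _
  have hwi : ∀ i : ℕ, ∃ e : L, h ^ i • w = e • w := by
    intro i
    induction i with
    | zero => exact ⟨1, by simp⟩
    | succ i ih =>
      obtain ⟨e, he⟩ := ih
      exact ⟨(h • e) * a, by rw [pow_succ', mul_smul, he, hsl, hwh, mul_smul]⟩
  refine ⟨w, ?_⟩
  let X : AddSubgroup V := (L ∙ w).toAddSubgroup
  have hX : ∀ x, x ∈ X ↔ ∃ e : L, e • w = x := fun x => Submodule.mem_span_singleton
  rcases hirr.2 X (fun g x hx => by
    obtain ⟨e, rfl⟩ := (hX x).1 hx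
    obtain ⟨i, hi⟩ := hgen g
    obtain ⟨d, hd⟩ := hscal ((h ^ i)⁻¹ * g) fun a => by
      rw [mul_smul, hi, inv_smul_smul]
    obtain ⟨f, hf⟩ := hwi i
    have h1 := hd w
    rw [mul_smul, inv_smul_eq_iff, hsl, hf] at h1
    rw [hX, hsl, h1]
    exact ⟨(g • e) * (h ^ i • d) * f, by rw [mul_smul, mul_smul]⟩) with h1 | h1
  · exfalso
    have : w ∈ X := (hX w).2 ⟨1, one_smul _ _⟩
    rw [h1] at this
    exact hl this
  · intro x
    exact (hX x).1 (h1 ▸ AddSubgroup.mem_top x)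

/-- The number of characters of a finite abelian group in a field is at most its order. -/
lemma card_addHom_units_le {B L : Type*} [AddCommGroup B] [Finite B] [Field L] :
    Finite (B →+ Additive Lˣ) ∧ Nat.card (B →+ Additive Lˣ) ≤ Nat.card B := by
  have := Fintype.ofFinite B
  let F : (B →+ Additive Lˣ) → (Multiplicative B →* L) := fun φ =>
    (Units.coeHom L).comp (AddMonoidHom.toMultiplicativeLeft φ)
  have hF : Function.Injective F := by
    intro φ ψ h
    ext b
    exact DFunLike.congr_fun h (Multiplicative.ofAdd b)
  have hind := (linearIndependent_monoidHom (Multiplicative B) L).comp F hF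
  have hfin : Finite (B →+ Additive Lˣ) := hind.finite
  refine ⟨hfin, ?_⟩
  have := Fintype.ofFinite (B →+ Additive Lˣ)
  have h1 := hind.fintype_card_le_finrank
  rw [Module.finrank_fintype_fun_eq_card] at h1
  rw [Nat.card_eq_fintype_card, Nat.card_eq_fintype_card]
  exact h1.trans_eq (Fintype.card_congr Multiplicative.toAdd)

section Perp

variable {W L : Type*} [AddCommGroup W] [Field L] (β : W →+ W →+ Additive Lˣ)

/-- The orthogonal complement of a subgroup under a pairing. -/
def perp (X : AddSubgroup W) : AddSubgroup W where
  carrier := {a | ∀ x ∈ X, β x a = 0}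
  zero_mem' := fun x _ => map_zero _
  add_mem' := fun {a b} ha hb x hx => by rw [map_add, ha x hx, hb x hx, add_zero]
  neg_mem' := fun {a} ha x hx => by rw [map_neg, ha x hx, neg_zero]

variable {β}

lemma mem_perp {X : AddSubgroup W} {a : W} : a ∈ perp β X ↔ ∀ x ∈ X, β x a = 0 := Iff.rfl

lemma pairing_antisymm (halt : ∀ a, β a a = 0) (a b : W) : β a b = - β b a := by
  have h := halt (a + b)
  simp only [map_add, AddMonoidHom.add_apply, halt, zero_add, add_zero] at h
  exact eq_neg_of_add_eq_zero_right h

lemma card_mul_card_perp [Finite W] (halt : ∀ a, β a a = 0) (hnd : ∀ a, (∀ b, β a b = 0) → a = 0)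
    (X : AddSubgroup W) : Nat.card X * Nat.card (perp β X) = Nat.card W := by
  apply le_antisymm
  · obtain ⟨hfin, hle⟩ := card_addHom_units_le (B := W ⧸ perp β X) (L := L)
    let f : X → ((W ⧸ perp β X) →+ Additive Lˣ) := fun x =>
      QuotientAddGroup.lift (perp β X) (β x.1) fun a ha => ha x.1 x.2
    have hf : Function.Injective f := by
      intro x y h
      apply Subtype.ext
      rw [← sub_eq_zero]
      refine hnd _ fun b => ?_
      have := DFunLike.congr_fun h (b : W ⧸ perp β X)
      change β x.1 b = β y.1 b at this
      rw [map_sub, AddMonoidHom.sub_apply, this, sub_self]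
    rw [AddSubgroup.card_eq_card_quotient_mul_card_addSubgroup (perp β X)]
    exact Nat.mul_le_mul_right _ ((Nat.card_le_card_of_injective f hf).trans hle)
  · obtain ⟨hfin, hle⟩ := card_addHom_units_le (B := X) (L := L)
    let f : W →+ (X →+ Additive Lˣ) :=
      { toFun := fun a => (β a).comp X.subtype
        map_zero' := by ext; simp
        map_add' := fun a b => by ext; simp }
    have hk : f.ker = perp β X := by
      ext a
      rw [AddMonoidHom.mem_ker, mem_perp]
      constructor
      · intro h x hx
        have := DFunLike.congr_fun h (⟨x, hx⟩ : X)
        change β a x = 0 at this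
        rw [pairing_antisymm halt, this, neg_zero]
      · intro h
        refine AddMonoidHom.ext fun x => ?_
        change β a x.1 = 0
        rw [pairing_antisymm halt, h x.1 x.2, neg_zero]
    have h1 := AddSubgroup.card_eq_card_quotient_mul_card_addSubgroup f.ker
    rw [h1, hk]
    refine Nat.mul_le_mul_right _ ?_
    rw [← hk, Nat.card_congr (QuotientAddGroup.quotientKerEquivRange f).toEquiv]
    exact (Nat.card_le_card_of_injective _ Subtype.val_injective).trans hle

/-- A finite group with a nondegenerate alternating pairing has square order. -/
lemma exists_card_eq_sq [Finite W] (halt : ∀ a, β a a = 0)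
    (hnd : ∀ a, (∀ b, β a b = 0) → a = 0) : ∃ e, Nat.card W = e ^ 2 := by
  have hfin : Finite (AddSubgroup W) := Finite.of_injective (fun U => (U : Set W))
    SetLike.coe_injective
  obtain ⟨A, hA, hmax⟩ := Set.exists_max_image {A : AddSubgroup W | A ≤ perp β A}
    (fun A => Nat.card A) (Set.toFinite _) ⟨⊥, (bot_le : ⊥ ≤ perp β ⊥)⟩
  have hAA : perp β A ≤ A := by
    intro a ha
    by_contra haA
    let B := A ⊔ AddSubgroup.zmultiples a
    have hBmem : ∀ b ∈ B, ∃ x ∈ A, ∃ k : ℤ, x + k • a = b := by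
      intro b hb
      obtain ⟨x, hx, y, hy, rfl⟩ := AddSubgroup.mem_sup.1 hb
      obtain ⟨k, rfl⟩ := AddSubgroup.mem_zmultiples_iff.1 hy
      exact ⟨x, hx, k, rfl⟩
    have hB : B ≤ perp β B := by
      intro b hb c hc
      obtain ⟨x, hx, k, rfl⟩ := hBmem b hb
      obtain ⟨y, hy, l, rfl⟩ := hBmem c hc
      have h1 : β y x = 0 := hA hx y hy
      have h2 : β y a = 0 := ha y hy
      have h3 : β a x = 0 := by rw [pairing_antisymm halt, ha x hx, neg_zero]
      simp [h1, h2, h3, halt]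
    have h1 := hmax B hB
    have hAB : A ≤ B := le_sup_left
    have h2 : A = B :=
      SetLike.coe_injective (Set.eq_of_subset_of_ncard_le hAB h1 (Set.toFinite _))
    apply haA
    rw [h2]
    exact le_sup_right (a := A) (AddSubgroup.mem_zmultiples a)
  refine ⟨Nat.card A, ?_⟩
  rw [sq, ← card_mul_card_perp halt hnd A, le_antisymm hAA hA]

end Perp

/-- An alternating pairing, invariant up to kernel, with no invariant isotropic subgroup. -/
structure IsAniso (G : Type*) {W L : Type*} [Group G] [AddCommGroup W] [DistribMulAction G W]
    [Field L] (β : W →+ W →+ Additive Lˣ) : Prop where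
  alt : ∀ a, β a a = 0
  inv : ∀ (g : G) a b, β a b = 0 → β (g • a) (g • b) = 0
  aniso : ∀ X : AddSubgroup W, (∀ (g : G), ∀ x ∈ X, g • x ∈ X) →
    (∀ a ∈ X, ∀ b ∈ X, β a b = 0) → X = ⊥

namespace IsAniso

variable {G W L : Type*} [Group G] [AddCommGroup W] [DistribMulAction G W]
    [Field L] {β : W →+ W →+ Additive Lˣ}

lemma perp_inv (h : IsAniso G β) {X : AddSubgroup W} (hX : ∀ (g : G), ∀ x ∈ X, g • x ∈ X)
    (g : G) (a : W) (ha : a ∈ perp β X) : g • a ∈ perp β X := fun x hx => by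
  have := h.inv g _ _ (ha _ (hX g⁻¹ x hx))
  rwa [smul_inv_smul] at this

lemma inf_perp (h : IsAniso G β) {X : AddSubgroup W} (hX : ∀ (g : G), ∀ x ∈ X, g • x ∈ X) :
    X ⊓ perp β X = ⊥ :=
  h.aniso _ (fun g x hx => ⟨hX g x hx.1, h.perp_inv hX g x hx.2⟩)
    fun _ ha _ hb => hb.2 _ ha.1

lemma nondeg (h : IsAniso G β) (a : W) (ha : ∀ b, β a b = 0) : a = 0 := by
  have h1 := h.inf_perp (X := ⊤) (fun _ _ _ => AddSubgroup.mem_top _)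
  have : a ∈ (⊤ : AddSubgroup W) ⊓ perp β ⊤ :=
    ⟨AddSubgroup.mem_top _, fun x _ => by rw [pairing_antisymm h.alt, ha, neg_zero]⟩
  rw [h1] at this
  exact this

lemma card_mul (h : IsAniso G β) [Finite W] (X : AddSubgroup W) :
    Nat.card X * Nat.card (perp β X) = Nat.card W :=
  card_mul_card_perp h.alt h.nondeg X

lemma exists_add (h : IsAniso G β) [Finite W] {X : AddSubgroup W}
    (hX : ∀ (g : G), ∀ x ∈ X, g • x ∈ X) (a : W) : ∃ x ∈ X, ∃ y ∈ perp β X, x + y = a := by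
  have h1 : Function.Injective (fun p : X × perp β X => p.1.1 + p.2.1) := by
    rintro ⟨x, y⟩ ⟨x', y'⟩ hxy
    simp only at hxy
    have h2 : x.1 - x'.1 ∈ X ⊓ perp β X := by
      refine ⟨X.sub_mem x.2 x'.2, ?_⟩
      rw [show x.1 - x'.1 = y'.1 - y.1 by rw [sub_eq_sub_iff_add_eq_add, hxy, add_comm]]
      exact AddSubgroup.sub_mem _ y'.2 y.2
    rw [h.inf_perp hX, AddSubgroup.mem_bot, sub_eq_zero] at h2
    rw [h2] at hxy
    exact Prod.ext (Subtype.ext h2) (Subtype.ext (add_left_cancel hxy))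
  have h2 := (Nat.bijective_iff_injective_and_card _).2 ⟨h1, by rw [Nat.card_prod, h.card_mul]⟩
  obtain ⟨⟨x, y⟩, hxy⟩ := h2.2 a
  exact ⟨x.1, x.2, y.1, y.2, hxy⟩

/-- The restriction of the pairing to an invariant subgroup. -/
lemma restrict (h : IsAniso G β) (X : AddSubgroup W) (hX : ∀ (g : G), ∀ x ∈ X, g • x ∈ X) :
    let _ := restrictAction G X hX
    IsAniso G (AddMonoidHom.compHom' X.subtype |>.comp (β.comp X.subtype)) := by
  intro _
  refine ⟨fun a => h.alt a, fun g a b hab => h.inv g a.1 b.1 hab, fun Y hY hiso => ?_⟩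
  have h1 := h.aniso (Y.map X.subtype) (by
    rintro g _ ⟨y, hy, rfl⟩
    exact ⟨g • y, hY g y hy, rfl⟩) (by
    rintro _ ⟨a, ha, rfl⟩ _ ⟨b, hb, rfl⟩
    exact hiso a ha b hb)
  exact (AddSubgroup.map_eq_bot_iff_of_injective Y Subtype.val_injective).1 h1

lemma card_eq_sq (h : IsAniso G β) [Finite W] : ∃ e, Nat.card W = e ^ 2 :=
  exists_card_eq_sq h.alt h.nondeg

lemma card_sub_eq_sq (h : IsAniso G β) [Finite W] {X : AddSubgroup W}
    (hX : ∀ (g : G), ∀ x ∈ X, g • x ∈ X) : ∃ e, Nat.card X = e ^ 2 := by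
  let _ := restrictAction G X hX
  exact (h.restrict X hX).card_eq_sq

/-- Prime divisors of the order divide the order of the multiplicative group. -/
lemma prime_dvd (h : IsAniso G β) [Finite W] [Finite L] {r : ℕ} (hr : r.Prime)
    (hrW : r ∣ Nat.card W) : r ∣ Nat.card L - 1 := by
  have := Fact.mk hr
  obtain ⟨a, ha⟩ := exists_prime_addOrderOf_dvd_card' r hrW
  have ha0 : a ≠ 0 := by
    rintro rfl
    rw [addOrderOf_zero] at ha
    exact hr.one_lt.ne ha
  obtain ⟨b, hb⟩ : ∃ b, β a b ≠ 0 := by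
    by_contra hcon
    push Not at hcon
    exact ha0 (h.nondeg a hcon)
  have h1 : addOrderOf (β a b) = r := addOrderOf_eq_prime (by
    have : r • a = 0 := by rw [← ha]; exact addOrderOf_nsmul_eq_zero a
    rw [← AddMonoidHom.nsmul_apply, ← map_nsmul, this, map_zero, AddMonoidHom.zero_apply]) hb
  have h2 := addOrderOf_dvd_natCard (β a b)
  rw [h1] at h2
  have h3 : Nat.card (Additive Lˣ) = Nat.card L - 1 := Nat.card_units L
  rwa [h3] at h2

end IsAniso

section ClassTwo

variable {G : Type*} [Group G]

lemma commutator_le_iff_quotient (Z X Y : Subgroup G) [Z.Normal] :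
    ⁅X, Y⁆ ≤ Z ↔ X ≤ (Subgroup.centralizer (Y.map (QuotientGroup.mk' Z) : Set (G ⧸ Z))).comap
      (QuotientGroup.mk' Z) := by
  rw [← Subgroup.map_le_iff_le_comap, ← Subgroup.commutator_eq_bot_iff_le_centralizer,
    ← Subgroup.map_commutator, Subgroup.map_eq_bot_iff, QuotientGroup.ker_mk']

lemma sup_commutator_le {Z X Y T : Subgroup G} [Z.Normal] (h1 : ⁅X, T⁆ ≤ Z) (h2 : ⁅Y, T⁆ ≤ Z) :
    ⁅X ⊔ Y, T⁆ ≤ Z := by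
  rw [commutator_le_iff_quotient] at *
  exact sup_le h1 h2

lemma sup_commutator_sup_le {Z X Y : Subgroup G} [Z.Normal] (h1 : ⁅X, X⁆ ≤ Z) (h2 : ⁅Y, Y⁆ ≤ Z)
    (h3 : ⁅X, Y⁆ ≤ Z) : ⁅X ⊔ Y, X ⊔ Y⁆ ≤ Z := by
  have h4 : ⁅Y, X⁆ ≤ Z := by rwa [Subgroup.commutator_comm]
  apply sup_commutator_le <;> rw [Subgroup.commutator_comm] <;> apply sup_commutator_le <;>
    assumption

/-- A normal subgroup of class two over a maximal abelian normal subgroup which controls the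
whole centralizer. -/
theorem exists_maximal_class_two [Finite G] (hG : Group.IsSolvable G) (Z : Subgroup G) [Z.Normal]
    (hZ : ∀ a ∈ Z, ∀ b ∈ Z, a * b = b * a)
    (hmax : ∀ A : Subgroup G, A.Normal → (∀ a ∈ A, ∀ b ∈ A, a * b = b * a) → Z ≤ A → A ≤ Z)
    (hC : ¬ Subgroup.centralizer (Z : Set G) ≤ Z) :
    ∃ E : Subgroup G, E.Normal ∧ Z ≤ E ∧ ¬ E ≤ Z ∧ E ≤ Subgroup.centralizer (Z : Set G) ∧
      ⁅E, E⁆ ≤ Z ∧ Subgroup.centralizer (E : Set G) ≤ Z ∧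
      ∀ x ∈ Subgroup.centralizer (Z : Set G), (∀ y ∈ E, ⁅x, y⁆ ∈ Z) → x ∈ E := by
  set C := Subgroup.centralizer (Z : Set G) with hCdef
  have hZC : Z ≤ C := fun a ha => Subgroup.mem_centralizer_iff.2 fun b hb => hZ b hb a ha
  have hZZ : ⁅Z, Z⁆ ≤ Z := Subgroup.commutator_le_left Z Z
  have hfin : Finite (Subgroup G) := Finite.of_injective (fun U => (U : Set G))
    SetLike.coe_injective
  obtain ⟨E, ⟨hEn, hZE, hEC, hEE⟩, hEmax⟩ := Set.exists_max_image
    {X : Subgroup G | X.Normal ∧ Z ≤ X ∧ X ≤ C ∧ ⁅X, X⁆ ≤ Z} (fun X => Nat.card X)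
    (Set.toFinite _) ⟨Z, inferInstance, le_rfl, hZC, hZZ⟩
  have hmaxE : ∀ X : Subgroup G, X.Normal → E ≤ X → X ≤ C → ⁅X, X⁆ ≤ Z → X ≤ E := by
    intro X h1 h2 h3 h4
    have h5 := hEmax X ⟨h1, hZE.trans h2, h3, h4⟩
    exact (SetLike.coe_injective (Set.eq_of_subset_of_ncard_le h2 h5 (Set.toFinite _))).ge
  have hcomm : ∀ A : Subgroup G, A.Normal → ⁅A, A⁆ ≤ Z → A ≤ C → ¬ A ≤ Z →
      A ≤ Subgroup.centralizer (E : Set G) → False := by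
    intro A hA hAA hAC hAZ hAE
    have h1 : ⁅A, E⁆ ≤ Z := by
      rw [Subgroup.commutator_eq_bot_iff_le_centralizer.2 hAE]
      exact bot_le
    have h2 : A ≤ E := le_sup_right.trans (hmaxE (E ⊔ A) inferInstance le_sup_left
      (sup_le hEC hAC) (sup_commutator_sup_le hEE hAA (by rwa [Subgroup.commutator_comm])))
    refine hAZ (le_sup_right.trans (hmax (Z ⊔ A) inferInstance ?_ le_sup_left))
    have h3 : Z ⊔ A ≤ Subgroup.centralizer (Z ⊔ A : Subgroup G) := by
      have h4 : A ≤ Subgroup.centralizer (Z : Set G) := hAC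
      have h5 : A ≤ Subgroup.centralizer (A : Set G) :=
        hAE.trans (Subgroup.centralizer_le h2)
      refine sup_le (Subgroup.le_centralizer_iff.1 (sup_le hZC h4)) ?_
      exact Subgroup.le_centralizer_iff.1 (sup_le (Subgroup.le_centralizer_iff.1 h4) h5)
    exact fun a ha b hb => (Subgroup.mem_centralizer_iff.1 (h3 ha) b hb).symm
  have hcE : Subgroup.centralizer (E : Set G) ≤ Z := by
    by_contra hcon
    obtain ⟨A, hA, hAE, hAZ, hAA⟩ := exists_normal_commutator_le hG _ Z hcon
    exact hcomm A hA hAA (hAE.trans (Subgroup.centralizer_le hZE)) hAZ hAE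
  refine ⟨E, hEn, hZE, ?_, hEC, hEE, hcE, ?_⟩
  · intro hEZ
    obtain ⟨A, hA, hAC, hAZ, hAA⟩ := exists_normal_commutator_le hG _ Z hC
    exact hcomm A hA hAA hAC hAZ (hAC.trans (Subgroup.centralizer_le hEZ))
  · have hYn : (C ⊓ (Subgroup.centralizer (E.map (QuotientGroup.mk' Z) : Set (G ⧸ Z))).comap
      (QuotientGroup.mk' Z)).Normal := by
      have : (E.map (QuotientGroup.mk' Z)).Normal :=
        hEn.map _ (QuotientGroup.mk'_surjective Z)
      infer_instance
    set Y := C ⊓ (Subgroup.centralizer (E.map (QuotientGroup.mk' Z) : Set (G ⧸ Z))).comap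
      (QuotientGroup.mk' Z) with hY
    have hYE : ⁅Y, E⁆ ≤ Z := (commutator_le_iff_quotient Z Y E).2 inf_le_right
    have hEY : E ≤ Y := le_inf hEC ((commutator_le_iff_quotient Z E E).1 hEE)
    have hZY : ⁅Z, Y⁆ = ⊥ := by
      rw [Subgroup.commutator_comm, Subgroup.commutator_eq_bot_iff_le_centralizer]
      exact inf_le_left
    have hYY : ⁅Y, Y⁆ ≤ Z := by
      refine le_trans ?_ hcE
      rw [← Subgroup.commutator_eq_bot_iff_le_centralizer]
      apply Subgroup.commutator_commutator_eq_bot_of_rotate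
      · exact le_bot_iff.1 ((Subgroup.commutator_mono hYE le_rfl).trans hZY.le)
      · rw [Subgroup.commutator_comm E Y]
        exact le_bot_iff.1 ((Subgroup.commutator_mono hYE le_rfl).trans hZY.le)
    have hYle := hmaxE Y hYn hEY inf_le_left hYY
    intro x hxC hx
    refine hYle ⟨hxC, ?_⟩
    refine Subgroup.mem_centralizer_iff.2 ?_
    rintro _ ⟨y, hy, rfl⟩
    have h1 := hx y hy
    rw [← QuotientGroup.eq_one_iff] at h1
    have h2 : ⁅(x : G ⧸ Z), (y : G ⧸ Z)⁆ = 1 := h1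
    exact (commutatorElement_eq_one_iff_mul_comm.1 h2).symm

lemma commutatorElement_eq_of_central {Z E : Subgroup G} (hEE : ⁅E, E⁆ ≤ Z)
    (hcE : ∀ x ∈ E, ∀ z ∈ Z, x * z = z * x) {x y z : G} (hx : x ∈ E) (hy : y ∈ E) (hz : z ∈ E) :
    ⁅x * y, z⁆ = ⁅x, z⁆ * ⁅y, z⁆ ∧ ⁅z, x * y⁆ = ⁅z, x⁆ * ⁅z, y⁆ := by
  constructor
  · have h1 : ⁅x * y, z⁆ = x * ⁅y, z⁆ * x⁻¹ * ⁅x, z⁆ := by simp only [commutatorElement_def]; group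
    rw [h1, hcE x hx _ (hEE (Subgroup.commutator_mem_commutator hy hz)), mul_inv_cancel_right]
    exact (hcE _ (E.mul_mem (E.mul_mem (E.mul_mem hy hz) (E.inv_mem hy)) (E.inv_mem hz)) _
      (hEE (Subgroup.commutator_mem_commutator hx hz))).trans rfl
  · have h1 : ⁅z, x * y⁆ = ⁅z, x⁆ * (x * ⁅z, y⁆ * x⁻¹) := by
      simp only [commutatorElement_def]; group
    rw [h1, hcE x hx _ (hEE (Subgroup.commutator_mem_commutator hz hy)), mul_inv_cancel_right]

end ClassTwo

/-- The commutator pairing on the central quotient of a group of class two. -/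
theorem exists_pairing {G : Type u} {L : Type*} [Group G] [Finite G] [Field L] (Z E : Subgroup G)
    [Z.Normal] [E.Normal] (hZE : Z ≤ E) (hEE : ⁅E, E⁆ ≤ Z)
    (hcE : ∀ x ∈ E, ∀ z ∈ Z, x * z = z * x)
    (hmax : ∀ A : Subgroup G, A.Normal → (∀ a ∈ A, ∀ b ∈ A, a * b = b * a) → Z ≤ A → A ≤ Z)
    (χ : Z →* Lˣ) (hχ : Function.Injective χ) :
    ∃ (W : Type u) (_ : AddCommGroup W) (_ : Finite W) (_ : DistribMulAction G W) (w : G → W)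
      (β : W →+ W →+ Additive Lˣ), (∀ a, ∃ x ∈ E, w x = a) ∧
      (∀ x ∈ E, ∀ y ∈ E, w (x * y) = w x + w y) ∧ (∀ x ∈ E, w x = 0 ↔ x ∈ Z) ∧
      (∀ g, ∀ x ∈ E, w (g * x * g⁻¹) = g • w x) ∧
      (∀ x ∈ E, ∀ y ∈ E, ∀ h : ⁅x, y⁆ ∈ Z, β (w x) (w y) = Additive.ofMul (χ ⟨⁅x, y⁆, h⟩)) ∧
      IsAniso G β := by
  classical
  set H := E.map (QuotientGroup.mk' Z) with hH
  have hHn : H.Normal := Subgroup.Normal.map ‹_› _ (QuotientGroup.mk'_surjective Z)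
  have hHc : ∀ a b : H, a * b = b * a := by
    rintro ⟨_, x, hx, rfl⟩ ⟨_, y, hy, rfl⟩
    apply Subtype.ext
    change ((x : G ⧸ Z)) * (y : G ⧸ Z) = (y : G ⧸ Z) * (x : G ⧸ Z)
    rw [← commutatorElement_eq_one_iff_mul_comm]
    exact (QuotientGroup.eq_one_iff _).2 (hEE (Subgroup.commutator_mem_commutator hx hy))
  let _ : CommGroup H := { (inferInstance : Group H) with mul_comm := hHc }
  let act : G →* MulAut H := MulAut.conjNormal.comp (QuotientGroup.mk' Z)
  let _ : DistribMulAction G (Additive H) :=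
    { smul := fun g a => Additive.ofMul (act g a.toMul)
      one_smul := fun a => by
        change Additive.ofMul (act 1 a.toMul) = a
        rw [map_one]; rfl
      mul_smul := fun g h a => by
        change Additive.ofMul (act (g * h) a.toMul) = Additive.ofMul (act g (act h a.toMul))
        rw [map_mul]; rfl
      smul_zero := fun g => by
        change Additive.ofMul (act g 1) = 0
        rw [map_one]; rfl
      smul_add := fun g a b => by
        change Additive.ofMul (act g (a.toMul * b.toMul)) = _
        rw [map_mul]; rfl }
  have hsm : ∀ (g : G) (a : H), g • Additive.ofMul a = Additive.ofMul (act g a) := fun _ _ => rfl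
  let w : G → Additive H := fun x => if hx : x ∈ E then
    Additive.ofMul ⟨QuotientGroup.mk' Z x, x, hx, rfl⟩ else 0
  have hw : ∀ x (hx : x ∈ E), w x = Additive.ofMul ⟨QuotientGroup.mk' Z x, x, hx, rfl⟩ :=
    fun x hx => dif_pos hx
  have hws : ∀ a, ∃ x ∈ E, w x = a := by
    intro a
    obtain ⟨x, hx, h⟩ := a.toMul.2
    refine ⟨x, hx, ?_⟩
    rw [hw x hx]
    exact congrArg Additive.ofMul (Subtype.ext h)
  have hwm : ∀ x ∈ E, ∀ y ∈ E, w (x * y) = w x + w y := by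
    intro x hx y hy
    rw [hw x hx, hw y hy, hw _ (E.mul_mem hx hy)]
    rfl
  have hw0 : ∀ x ∈ E, w x = 0 ↔ x ∈ Z := by
    intro x hx
    rw [hw x hx, ← QuotientGroup.eq_one_iff x]
    constructor
    · intro h
      exact congrArg Subtype.val (congrArg Additive.toMul h)
    · intro h
      exact congrArg Additive.ofMul (Subtype.ext h)
  have hwg : ∀ g, ∀ x ∈ E, w (g * x * g⁻¹) = g • w x := by
    intro g x hx
    rw [hw x hx, hw _ (Subgroup.Normal.conj_mem ‹_› x hx g), hsm]
    refine congrArg Additive.ofMul (Subtype.ext ?_)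
    change _ = ((MulAut.conjNormal (QuotientGroup.mk' Z g)) _ : H).1
    rw [MulAut.conjNormal_apply]
    rfl
  have hmem : ∀ x ∈ E, ∀ y ∈ E, ⁅x, y⁆ ∈ Z := fun x hx y hy =>
    hEE (Subgroup.commutator_mem_commutator hx hy)
  choose s hsE hs using hws
  let b : Additive H → Additive H → Additive Lˣ := fun a c =>
    Additive.ofMul (χ ⟨⁅s a, s c⁆, hmem _ (hsE a) _ (hsE c)⟩)
  have hdiff : ∀ x ∈ E, ∃ z ∈ Z, s (w x) = x * z := by
    intro x hx
    refine ⟨x⁻¹ * s (w x), ?_, by group⟩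
    have h1 := hwm x hx _ (E.mul_mem (E.inv_mem hx) (hsE (w x)))
    rw [mul_inv_cancel_left, hs, left_eq_add] at h1
    exact (hw0 _ (E.mul_mem (E.inv_mem hx) (hsE (w x)))).1 h1
  have hbw : ∀ x ∈ E, ∀ y ∈ E, ∀ h : ⁅x, y⁆ ∈ Z, b (w x) (w y) = Additive.ofMul (χ ⟨⁅x, y⁆, h⟩) := by
    intro x hx y hy h
    obtain ⟨z, hz, h1⟩ := hdiff x hx
    obtain ⟨t, ht, h2⟩ := hdiff y hy
    have h3 : ⁅s (w x), s (w y)⁆ = ⁅x, y⁆ := by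
      rw [h1, h2, (commutatorElement_eq_of_central hEE hcE hx (hZE hz)
        (E.mul_mem hy (hZE ht))).1, (commutatorElement_eq_of_central hEE hcE hy (hZE ht) hx).2,
        commutatorElement_eq_one_iff_mul_comm.2 (hcE _ hx _ ht),
        commutatorElement_eq_one_iff_mul_comm.2 (hcE _ (E.mul_mem hy (hZE ht)) _ hz).symm,
        mul_one, mul_one]
    exact congrArg (fun z : Z => Additive.ofMul (χ z)) (Subtype.ext h3)
  let β : Additive H →+ Additive H →+ Additive Lˣ :=
    AddMonoidHom.mk' (fun a => AddMonoidHom.mk' (b a) (by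
      intro c d
      rw [← hs a, ← hs c, ← hs d, ← hwm _ (hsE c) _ (hsE d),
        hbw _ (hsE a) _ (E.mul_mem (hsE c) (hsE d)) (hmem _ (hsE a) _ (E.mul_mem (hsE c) (hsE d))),
        hbw _ (hsE a) _ (hsE c) (hmem _ (hsE a) _ (hsE c)),
        hbw _ (hsE a) _ (hsE d) (hmem _ (hsE a) _ (hsE d)), ← ofMul_mul, ← map_mul]
      exact congrArg (fun z : Z => Additive.ofMul (χ z)) (Subtype.ext
        (commutatorElement_eq_of_central hEE hcE (hsE c) (hsE d) (hsE a)).2))) (by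
      intro c d
      refine AddMonoidHom.ext fun a => ?_
      change b _ _ = b _ _ + b _ _
      rw [← hs a, ← hs c, ← hs d, ← hwm _ (hsE c) _ (hsE d),
        hbw _ (E.mul_mem (hsE c) (hsE d)) _ (hsE a) (hmem _ (E.mul_mem (hsE c) (hsE d)) _ (hsE a)),
        hbw _ (hsE c) _ (hsE a) (hmem _ (hsE c) _ (hsE a)),
        hbw _ (hsE d) _ (hsE a) (hmem _ (hsE d) _ (hsE a)), ← ofMul_mul, ← map_mul]
      exact congrArg (fun z : Z => Additive.ofMul (χ z)) (Subtype.ext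
        (commutatorElement_eq_of_central hEE hcE (hsE c) (hsE d) (hsE a)).1))
  have hβw : ∀ x ∈ E, ∀ y ∈ E, ∀ h : ⁅x, y⁆ ∈ Z,
    β (w x) (w y) = Additive.ofMul (χ ⟨⁅x, y⁆, h⟩) := hbw
  have hβ0 : ∀ x ∈ E, ∀ y ∈ E, β (w x) (w y) = 0 ↔ ⁅x, y⁆ = 1 := by
    intro x hx y hy
    rw [hβw x hx y hy (hmem x hx y hy), ofMul_eq_zero, map_eq_one_iff χ hχ]
    exact Subtype.ext_iff
  refine ⟨Additive H, inferInstance, inferInstanceAs (Finite H), inferInstance, w, β,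
    fun a => ⟨s a, hsE a, hs a⟩, hwm, hw0, hwg, hβw, ?_, ?_, ?_⟩
  · intro a
    rw [← hs a, hβ0 _ (hsE a) _ (hsE a), commutatorElement_self]
  · intro g a c
    rw [← hs a, ← hs c, ← hwg _ _ (hsE a), ← hwg _ _ (hsE c), hβ0 _ (hsE a) _ (hsE c),
      hβ0 _ (Subgroup.Normal.conj_mem ‹_› _ (hsE a) g) _
      (Subgroup.Normal.conj_mem ‹_› _ (hsE c) g)]
    intro h
    rw [← conjugate_commutatorElement, h, mul_one, mul_inv_cancel]
  · intro X hX hXX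
    let A : Subgroup G :=
      { carrier := {x | x ∈ E ∧ w x ∈ X}
        one_mem' := ⟨E.one_mem, by rw [(hw0 1 E.one_mem).2 Z.one_mem]; exact X.zero_mem⟩
        mul_mem' := fun {x y} hx hy => ⟨E.mul_mem hx.1 hy.1, by
          rw [hwm x hx.1 y hy.1]; exact X.add_mem hx.2 hy.2⟩
        inv_mem' := fun {x} hx => ⟨E.inv_mem hx.1, by
          have h1 := hwm x hx.1 _ (E.inv_mem hx.1)
          rw [mul_inv_cancel, (hw0 1 E.one_mem).2 Z.one_mem] at h1
          rw [← neg_eq_of_add_eq_zero_right h1.symm]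
          exact X.neg_mem hx.2⟩ }
    have hAn : A.Normal := ⟨fun x hx g => ⟨Subgroup.Normal.conj_mem ‹_› x hx.1 g, by
      rw [hwg g x hx.1]; exact hX g _ hx.2⟩⟩
    have hAZ := hmax A hAn (fun x hx y hy => by
      rw [← commutatorElement_eq_one_iff_mul_comm, ← hβ0 x hx.1 y hy.1]
      exact hXX _ hx.2 _ hy.2) (fun z hz => ⟨hZE hz, by
        rw [(hw0 z (hZE hz)).2 hz]; exact X.zero_mem⟩)
    rw [eq_bot_iff]
    intro a ha
    rw [← hs a] at ha ⊢
    exact (hw0 _ (hsE a)).2 (hAZ ⟨hsE a, ha⟩)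

lemma eq_zero_of_smul_eq_neg {G W : Type*} [Group G] [AddCommGroup W]
    [DistribMulAction G W] (hG : Odd (Nat.card G)) (hW : Odd (Nat.card W)) {g : G} {w : W}
    (h : g • w = -w) : w = 0 := by
  have h1 : g • w = w := by
    refine smul_eq_of_odd_pow_smul_eq (k := 1) (odd_orderOf_of_odd_card hG g) ?_
    rw [pow_one, pow_two, mul_smul, h, smul_neg, h, neg_neg]
  have h2 : (2 : ℕ) • w = 0 := by rw [two_nsmul]; nth_rw 1 [← h1, h]; simp
  obtain ⟨k, hk⟩ := hW
  have h3 : (Nat.card W) • w = 0 := card_nsmul_eq_zero'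
  rwa [hk, add_nsmul, mul_nsmul, h2, nsmul_zero, zero_add, one_nsmul] at h3

/-- A group of odd order acting on an abelian group of order nine fixes a nonzero element. -/
lemma exists_fixed_of_card_nine {G W : Type*} [Group G] [Finite G] [AddCommGroup W]
    [DistribMulAction G W] (hG : Odd (Nat.card G)) (hW : Nat.card W = 9) :
    ∃ w : W, w ≠ 0 ∧ ∀ g : G, g • w = w := by
  by_contra hcon
  push Not at hcon
  have hfin : Finite W := Nat.finite_of_card_ne_zero (by omega)
  let O : W → Set W := fun w => MulAction.orbit G w
  have hodd : ∀ w, Odd (O w).ncard := fun w => by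
    have h1 : (O w).ncard ∣ Nat.card G := by
      rw [← MulAction.index_stabilizer G w]
      exact Subgroup.index_dvd_card _
    exact hG.of_dvd_nat h1
  have h3 : ∀ w, w ≠ 0 → 3 ≤ (O w).ncard := by
    intro w hw
    have h1 : (O w).ncard ≠ 1 := by
      intro h1
      obtain ⟨g, hg⟩ := hcon w hw
      obtain ⟨a, ha⟩ := Set.ncard_eq_one.1 h1
      have h2 : g • w ∈ O w := ⟨g, rfl⟩
      have h3 : w ∈ O w := MulAction.mem_orbit_self w
      rw [ha] at h2 h3
      exact hg (h2.trans h3.symm)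
    obtain ⟨k, hk⟩ := hodd w
    omega
  have hneg : ∀ w, (-(O w)).ncard = (O w).ncard := fun w => by
    rw [← Set.image_neg_eq_neg, Set.ncard_image_of_injective _ neg_injective]
  have hdisj : ∀ w, w ≠ 0 → Disjoint (O w) (-(O w)) := by
    intro w hw
    rw [Set.disjoint_left]
    rintro _ ⟨g, rfl⟩ ⟨k, hk⟩
    simp only at hk
    have h1 : (k⁻¹ * g) • w = -w := by
      rw [mul_smul, inv_smul_eq_iff, smul_neg, hk, neg_neg]
    exact hw (eq_zero_of_smul_eq_neg hG (by rw [hW]; decide) h1)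
  obtain ⟨w, hw⟩ : ∃ w : W, w ≠ 0 := by
    have : Nontrivial W := (Finite.one_lt_card_iff_nontrivial).1 (by omega)
    exact exists_ne 0
  have hU : ∀ w, w ≠ 0 → (O w ∪ -(O w)).ncard = 2 * (O w).ncard := fun w hw => by
    rw [Set.ncard_union_eq (hdisj w hw), hneg, two_mul]
  have h0 : ∀ w, w ≠ 0 → (0 : W) ∉ O w ∪ -(O w) := by
    rintro w hw (⟨g, hg⟩ | ⟨g, hg⟩)
    · exact hw ((smul_eq_zero_iff_eq g).1 hg)
    · simp only [neg_zero] at hg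
      exact hw ((smul_eq_zero_iff_eq g).1 hg)
  have h9 : ∀ S : Set W, (0 : W) ∉ S → S.ncard ≤ 8 := by
    intro S hS
    have h1 := Set.ncard_insert_of_notMem hS
    have h2 := Set.ncard_le_card (insert 0 S)
    omega
  have h6 : (O w ∪ -(O w)).ncard = 6 := by
    have h1 := h9 _ (h0 w hw)
    have h2 := h3 w hw
    obtain ⟨k, hk⟩ := hodd w
    rw [hU w hw] at h1 ⊢
    omega
  obtain ⟨u, hu0, huO⟩ : ∃ u : W, u ≠ 0 ∧ u ∉ O w ∪ -(O w) := by
    by_contra hc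
    push Not at hc
    have h1 : insert 0 (O w ∪ -(O w)) = Set.univ := by
      ext x
      simp only [Set.mem_insert_iff, Set.mem_univ, iff_true]
      by_cases hx : x = 0
      · exact Or.inl hx
      · exact Or.inr (hc x hx)
    have h2 := Set.ncard_insert_of_notMem (h0 w hw)
    rw [h1, Set.ncard_univ] at h2
    omega
  have hd : Disjoint (O w ∪ -(O w)) (O u) := by
    rw [Set.disjoint_right]
    rintro _ ⟨g, rfl⟩ (⟨k, hk⟩ | ⟨k, hk⟩)
    · refine huO (Or.inl ⟨g⁻¹ * k, ?_⟩)
      simp only at hk ⊢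
      rw [mul_smul, hk, inv_smul_smul]
    · refine huO (Or.inr ⟨g⁻¹ * k, ?_⟩)
      simp only at hk ⊢
      rw [mul_smul, hk, smul_neg, inv_smul_smul]
  have h10 := h9 ((O w ∪ -(O w)) ∪ O u) (by
    rintro (h | h)
    · exact h0 w hw h
    · exact h0 u hu0 (Or.inl h))
  rw [Set.ncard_union_eq hd, h6] at h10
  have := h3 u hu0
  omega

lemma IsAniso.eq_zero_of_fixed {G W L : Type*} [Group G] [AddCommGroup W] [DistribMulAction G W]
    [Field L] {β : W →+ W →+ Additive Lˣ} (h : IsAniso G β) (w : W) (hw : ∀ g : G, g • w = w) :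
    w = 0 := by
  have h1 := h.aniso (AddSubgroup.zmultiples w) (by
    rintro g _ ⟨k, rfl⟩
    refine ⟨k, ?_⟩
    have := (DistribSMul.toAddMonoidHom W g).map_zsmul k w
    simp only [DistribSMul.toAddMonoidHom_apply, hw] at this
    exact this.symm) (by
    rintro _ ⟨k, rfl⟩ _ ⟨l, rfl⟩
    simp [h.alt])
  exact AddSubgroup.zmultiples_eq_bot.1 h1

/-- Every irreducible action of a group of odd order on a module of order at most `n` has a base
of size two. -/
def HasBaseTwo (n : ℕ) : Prop :=
  ∀ (G V : Type u) [Group G] [Finite G] [AddCommGroup V] [Finite V] [DistribMulAction G V],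
    Odd (Nat.card G) → Group.IsSolvable G → Odd (Nat.card V) → Nat.card V ≤ n → IsIrr G V →
    ∃ v w : V, ∀ g : G, g • v = v → g • w = w → ∀ u : V, g • u = u

lemma fixingSubgroup_restrict {G W : Type*} [Group G] [AddCommGroup W] [DistribMulAction G W]
    (X : AddSubgroup W) (hX : ∀ (g : G), ∀ x ∈ X, g • x ∈ X) :
    let _ := restrictAction G X hX
    fixingSubgroup G (Set.univ : Set X) = fixingSubgroup G (X : Set W) := by
  intro _
  ext g
  simp only [mem_fixingSubgroup_iff, Set.mem_univ, true_imp_iff]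
  constructor
  · intro h x hx
    exact congrArg Subtype.val (h ⟨x, hx⟩)
  · intro h x
    exact Subtype.ext (h x.1 x.2)

lemma two_mul_index_le_of_base {G W : Type*} [Group G] [Finite G] [AddCommGroup W] [Finite W]
    [DistribMulAction G W] [Nontrivial W] (hG : Odd (Nat.card G)) (hW : Odd (Nat.card W)) (v w : W)
    (h : ∀ g : G, g • v = v → g • w = w → ∀ u : W, g • u = u) :
    2 * (fixingSubgroup G (Set.univ : Set W)).index ≤ Nat.card W ^ 2 := by
  have hst : fixingSubgroup G (Set.univ : Set W) = MulAction.stabilizer G (v, w) := by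
    ext g
    simp only [mem_fixingSubgroup_iff, Set.mem_univ, true_imp_iff, MulAction.mem_stabilizer_iff,
      Prod.smul_mk, Prod.mk.injEq]
    exact ⟨fun hg => ⟨hg v, hg w⟩, fun hg => h g hg.1 hg.2⟩
  have hc : Nat.card (W × W) = Nat.card W ^ 2 := by rw [Nat.card_prod, sq]
  rw [hst, MulAction.index_stabilizer, ← hc]
  set O := MulAction.orbit G (v, w)
  by_cases h0 : (v, w) = (0 : W × W)
  · have h1 : O = {0} := by
      ext x
      constructor
      · rintro ⟨g, rfl⟩
        simp only [h0, smul_zero]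
        rfl
      · rintro rfl
        exact ⟨1, by simp only [h0, smul_zero]⟩
    rw [h1, Set.ncard_singleton]
    exact Finite.one_lt_card
  · have hd : Disjoint O (-O) := by
      rw [Set.disjoint_left]
      rintro _ ⟨g, rfl⟩ ⟨k, hk⟩
      simp only at hk
      refine h0 (eq_zero_of_smul_eq_neg hG (g := k⁻¹ * g) ?_ ?_)
      · rw [hc]
        exact hW.pow
      · rw [mul_smul, inv_smul_eq_iff, smul_neg, hk, neg_neg]
    have h1 := Set.ncard_union_eq hd
    rw [← Set.image_neg_eq_neg, Set.ncard_image_of_injective _ neg_injective, ← two_mul] at h1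
    rw [← h1]
    exact Set.ncard_le_card _

/-- The order of the group induced on a module with an anisotropic pairing. -/
theorem IsAniso.two_mul_index_le {n : ℕ} (hS : HasBaseTwo.{u} n) {G : Type u} {L : Type*} [Group G]
    [Finite G] [Field L] (hG : Odd (Nat.card G)) (hs : Group.IsSolvable G) :
    ∀ (m : ℕ) (W : Type u) [AddCommGroup W] [Finite W] [Nontrivial W] [DistribMulAction G W]
      (β : W →+ W →+ Additive Lˣ), IsAniso G β → Odd (Nat.card W) → Nat.card W ≤ n →
      Nat.card W ≤ m → 2 * (fixingSubgroup G (Set.univ : Set W)).index ≤ Nat.card W ^ 2 := by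
  intro m
  induction m with
  | zero =>
    intro W _ _ _ _ β _ _ _ h
    have := Nat.card_pos (α := W)
    omega
  | succ m ih =>
    intro W _ _ _ _ β h hW hn hm
    by_cases hirr : IsIrr G W
    · obtain ⟨v, w, hvw⟩ := hS G W hG hs hW hn hirr
      exact two_mul_index_le_of_base hG hW v w hvw
    · rw [IsIrr, not_and] at hirr
      have h1 := hirr inferInstance
      push Not at h1
      obtain ⟨X, hX, hXb, hXt⟩ := h1
      have hcard := h.card_mul X
      have hkey : ∀ Y : AddSubgroup W, (∀ (g : G), ∀ x ∈ Y, g • x ∈ Y) → 1 < Nat.card Y →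
          Nat.card Y < Nat.card W →
          2 * (fixingSubgroup G (Y : Set W)).index ≤ Nat.card Y ^ 2 := by
        intro Y hY h1 h2
        let _ := restrictAction G Y hY
        have := Finite.one_lt_card_iff_nontrivial.1 h1
        rw [← fixingSubgroup_restrict Y hY]
        exact ih Y _ (h.restrict Y hY) (hW.of_dvd_nat (AddSubgroup.card_addSubgroup_dvd_card Y))
          (by omega) (by omega)
      have hX1 : 1 < Nat.card X := by
        rw [AddSubgroup.one_lt_card_iff_ne_bot]
        exact hXb
      have hX2 : Nat.card X < Nat.card W := by
        refine lt_of_le_of_ne (AddSubgroup.card_le_card_addGroup X) fun h => hXt ?_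
        exact AddSubgroup.eq_top_of_card_eq X h
      have hP1 : 1 < Nat.card (perp β X) := by
        by_contra hc
        have : Nat.card X * Nat.card (perp β X) ≤ Nat.card X * 1 :=
          Nat.mul_le_mul_left _ (by omega)
        omega
      have hP2 : Nat.card (perp β X) < Nat.card W := by
        rw [← hcard]
        exact lt_mul_of_one_lt_left (by omega) hX1
      have e1 := hkey X hX hX1 hX2
      have e2 := hkey _ (h.perp_inv hX) hP1 hP2
      have hinf : fixingSubgroup G (X : Set W) ⊓ fixingSubgroup G (perp β X : Set W) ≤
          fixingSubgroup G (Set.univ : Set W) := by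
        rintro g ⟨hg1, hg2⟩
        rw [mem_fixingSubgroup_iff]
        rintro a -
        obtain ⟨x, hx, y, hy, rfl⟩ := h.exists_add hX a
        rw [smul_add, (mem_fixingSubgroup_iff G).1 hg1 x hx, (mem_fixingSubgroup_iff G).1 hg2 y hy]
      have e3 := Nat.le_of_dvd (Nat.pos_of_ne_zero Subgroup.index_ne_zero_of_finite)
        (Subgroup.index_dvd_of_le hinf)
      have e4 := Subgroup.index_inf_le (H := fixingSubgroup G (X : Set W))
        (K := fixingSubgroup G (perp β X : Set W))
      rw [← hcard, mul_pow]
      calc _ ≤ 2 * ((fixingSubgroup G (X : Set W)).index *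
            (fixingSubgroup G (perp β X : Set W)).index) := by omega
        _ ≤ (2 * (fixingSubgroup G (X : Set W)).index) *
            (2 * (fixingSubgroup G (perp β X : Set W)).index) := by
          nlinarith [Nat.zero_le ((fixingSubgroup G (X : Set W)).index *
            (fixingSubgroup G (perp β X : Set W)).index)]
        _ ≤ _ := Nat.mul_le_mul e1 e2

lemma pow_odd_cases {b m N : ℕ} (hN : N = 25 ∨ N = 49 ∨ N = 81 ∨ N = 121 ∨ N = 729)
    (h : N = b ^ m) (hm : Odd m) : m = 1 ∨ (N = 729 ∧ m = 3 ∧ b = 9) := by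
  have hm0 : m ≠ 0 := by rintro rfl; simp at hm
  by_cases hm1 : m = 1
  · exact Or.inl hm1
  right
  have hm3 : 3 ≤ m := by obtain ⟨k, rfl⟩ := hm; omega
  have hN9 : N ≤ 729 := by omega
  have hb2 : 2 ≤ b := by
    by_contra hb
    have : b ^ m ≤ 1 := pow_le_one₀ (by omega) (by omega)
    omega
  have hb9 : b ≤ 9 := by
    by_contra hb
    have h1 : 10 ^ 3 ≤ b ^ m :=
      (Nat.pow_le_pow_left (by omega : 10 ≤ b) 3).trans (Nat.pow_le_pow_right (by omega) hm3)
    omega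
  have hm9 : m ≤ 9 := by
    by_contra hb
    have h1 : 2 ^ 10 ≤ b ^ m :=
      (Nat.pow_le_pow_left hb2 10).trans (Nat.pow_le_pow_right (by omega) (by omega))
    omega
  obtain ⟨k, rfl⟩ := hm
  have hk1 : 1 ≤ k := by omega
  have hk4 : k ≤ 4 := by omega
  interval_cases k <;> interval_cases b <;> omega

namespace IsAniso

variable {G W L : Type*} [Group G] [Finite G] [AddCommGroup W] [DistribMulAction G W]
    [Field L] {β : W →+ W →+ Additive Lˣ}

lemma card_ne_nine (h : IsAniso G β) (hG : Odd (Nat.card G)) {X : AddSubgroup W}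
    (hX : ∀ (g : G), ∀ x ∈ X, g • x ∈ X) : Nat.card X ≠ 9 := by
  intro h9
  let _ := restrictAction G X hX
  obtain ⟨w, hw0, hw⟩ := exists_fixed_of_card_nine (G := G) hG h9
  exact hw0 ((h.restrict X hX).eq_zero_of_fixed w hw)

variable [Finite W]

lemma isIrr (h : IsAniso G β) (hG : Odd (Nat.card G)) (hN : Nat.card W = 25 ∨ Nat.card W = 49 ∨
    Nat.card W = 81 ∨ Nat.card W = 121 ∨ Nat.card W = 729) : IsIrr G W := by
  refine ⟨Finite.one_lt_card_iff_nontrivial.1 (by omega), fun X hX => ?_⟩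
  obtain ⟨a, ha⟩ := h.card_sub_eq_sq hX
  obtain ⟨b, hb⟩ := h.card_sub_eq_sq (h.perp_inv hX)
  have hab := h.card_mul X
  have h1 := h.card_ne_nine hG hX
  have h2 := h.card_ne_nine hG (h.perp_inv hX)
  rw [ha] at h1
  rw [hb] at h2
  rw [ha, hb, ← mul_pow] at hab
  have h3 : a = 1 ∨ b = 1 := by
    have hle : a * b ≤ 27 := by
      by_contra hc
      have : 28 ^ 2 ≤ (a * b) ^ 2 := Nat.pow_le_pow_left (by omega) 2
      omega
    have hab' : a * b = 5 ∨ a * b = 7 ∨ a * b = 9 ∨ a * b = 11 ∨ a * b = 27 := by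
      generalize a * b = t at hab hle
      interval_cases t <;> omega
    have ha3 : a ≠ 3 := by rintro rfl; exact h1 rfl
    have hb3 : b ≠ 3 := by rintro rfl; exact h2 rfl
    have ha0 : a ≠ 0 := by rintro rfl; omega
    have hb0 : b ≠ 0 := by rintro rfl; omega
    by_contra hc
    have ha27 : a ≤ 27 := (Nat.le_mul_of_pos_right a (by omega)).trans hle
    interval_cases a <;> omega
  rcases h3 with rfl | rfl
  · left
    rw [← AddSubgroup.card_eq_one, ha, one_pow]
  · right
    apply AddSubgroup.eq_top_of_card_eq
    rw [ha, ← hab, mul_one]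

lemma isPrim (h : IsAniso G β) (hG : Odd (Nat.card G)) (hN : Nat.card W = 25 ∨ Nat.card W = 49 ∨
    Nat.card W = 81 ∨ Nat.card W = 121 ∨ Nat.card W = 729) : IsPrim G W := by
  intro ε hε
  have hirr := h.isIrr hG hN
  obtain ⟨N, e, hsys, he, hNe⟩ := IsBlock.exists_blockSystem hirr hε
  have hc := hsys.card_eq
  rcases pow_odd_cases hN hc (hG.of_dvd_nat (Subgroup.index_dvd_card N)) with h1 | ⟨h1, -, h9⟩
  · rw [h1, pow_one] at hc
    have htop := AddSubgroup.eq_top_of_card_eq _ hc.symm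
    ext x
    have hx : x ∈ endRange (e (1 : G)) := htop ▸ AddSubgroup.mem_top x
    have := hsys.eq_of_mem hx
    rwa [he] at this
  · exfalso
    set B := endRange (e (1 : G)) with hB
    let _ := restrictAction N B hsys.smul_mem
    obtain ⟨w, hw0, hw⟩ := exists_fixed_of_card_nine (G := N)
      (hG.of_dvd_nat (Subgroup.card_subgroup_dvd_card N)) h9
    have hw' : ∀ g ∈ N, g • w.1 = w.1 := fun g hg => congrArg Subtype.val (hw ⟨g, hg⟩)
    have hz : ∀ k : ℤ, AddSubgroup.zmultiples (k • w.1) = ⊥ ∨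
        B ≤ AddSubgroup.zmultiples (k • w.1) := by
      intro k
      refine hsys.eq_bot_or_le hirr _ ?_ ?_
      · rw [AddSubgroup.zmultiples_le]
        exact B.zsmul_mem w.2 k
      · rintro g hg _ ⟨l, rfl⟩
        have := (DistribSMul.toAddMonoidHom W g).map_zsmul l (k • w.1)
        have h3 := (DistribSMul.toAddMonoidHom W g).map_zsmul k w.1
        simp only [DistribSMul.toAddMonoidHom_apply] at this h3
        exact ⟨l, by simp only; rw [this, h3, hw' g hg]⟩
    have hw3 : (3 : ℤ) • w.1 = 0 ∨ B ≤ AddSubgroup.zmultiples ((3 : ℤ) • w.1) := by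
      rw [← AddSubgroup.zmultiples_eq_bot]
      exact hz 3
    have h9w : (9 : ℕ) • w.1 = 0 := by
      have : (9 : ℕ) • w = 0 := by rw [← h9]; exact card_nsmul_eq_zero'
      exact congrArg Subtype.val this
    have hle : ∀ v : W, (3 : ℕ) • v = 0 → ¬ B ≤ AddSubgroup.zmultiples v := by
      intro v hv hle
      have h3 : Nat.card (AddSubgroup.zmultiples v) ≤ 3 := by
        rw [Nat.card_zmultiples]
        exact addOrderOf_le_of_nsmul_eq_zero (by norm_num) hv
      have h4 := AddSubgroup.card_le_of_le hle
      omega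
    rcases hw3 with h3 | h3
    · rcases hz 1 with h4 | h4
      · rw [one_zsmul, AddSubgroup.zmultiples_eq_bot] at h4
        exact hw0 (Subtype.ext h4)
      · rw [one_zsmul] at h4
        exact hle _ (by exact_mod_cast h3) h4
    · refine hle _ ?_ h3
      rw [← natCast_zsmul, ← mul_smul]
      exact_mod_cast h9w

end IsAniso

/-- The degree of the field extension fixed by a group of automorphisms. -/
lemma exists_card_eq_pow_index {G L : Type*} [Group G] [Finite G] [Field L] [Finite L]
    [MulSemiringAction G L] :
    ∃ k, Nat.card L = k ^ (fixingSubgroup G (Set.univ : Set L)).index := by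
  classical
  let φ := MulSemiringAction.toRingAut G L
  have hker : φ.ker = fixingSubgroup G (Set.univ : Set L) := by
    ext g
    rw [MonoidHom.mem_ker, mem_fixingSubgroup_iff]
    constructor
    · intro h x _
      exact DFunLike.congr_fun h x
    · intro h
      ext x
      exact h x (Set.mem_univ x)
  have : Finite φ.range := Finite.of_surjective _ φ.rangeRestrict_surjective
  have := Fintype.ofFinite φ.range
  have := Fintype.ofFinite L
  have h1 := FixedPoints.finrank_eq_card φ.range L
  have := Fintype.ofFinite (FixedPoints.subfield φ.range L)
  have h2 := Module.card_eq_pow_finrank (K := FixedPoints.subfield φ.range L) (V := L)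
  rw [h1] at h2
  refine ⟨Fintype.card (FixedPoints.subfield φ.range L), ?_⟩
  rw [← hker, Subgroup.index_ker, Nat.card_eq_fintype_card, h2, Nat.card_eq_fintype_card]

/-- The order of a group of semilinear maps of a one-dimensional space. -/
lemma IsSemiLin.index_dvd {G : Type*} {W : Type u} [Group G] [Finite G] [AddCommGroup W] [Finite W]
    [Nontrivial W] [DistribMulAction G W] (hG : Odd (Nat.card G)) (h : IsSemiLin G W) :
    ∃ k f s, Nat.card W = k ^ f ∧ Odd f ∧ Odd s ∧ s ∣ Nat.card W - 1 ∧
      (fixingSubgroup G (Set.univ : Set W)).index = f * s := by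
  obtain ⟨L, _, _, _, hsl, v, hv⟩ := h
  have hv0 : v ≠ 0 := by
    rintro rfl
    obtain ⟨w, hw⟩ := exists_ne (0 : W)
    obtain ⟨a, ha⟩ := hv w
    exact hw (by rw [← ha, smul_zero])
  let eq : L ≃ W := Equiv.ofBijective (fun a => a • v) ⟨smul_left_injective L hv0, hv⟩
  have : Finite L := Finite.of_equiv _ eq.symm
  have hc : Nat.card L = Nat.card W := Nat.card_congr eq
  obtain ⟨k, hk⟩ := exists_card_eq_pow_index (G := G) (L := L)
  set H := fixingSubgroup G (Set.univ : Set L) with hH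
  have hHL : ∀ g : H, ∀ a : L, g.1 • a = a := fun g a =>
    (mem_fixingSubgroup_iff G).1 g.2 a (Set.mem_univ a)
  choose c hcv using fun g : H => hv (g.1 • v)
  have hscal : ∀ (g : H) (w : W), g.1 • w = c g • w := by
    intro g w
    obtain ⟨a, rfl⟩ := hv w
    rw [hsl, hHL, ← hcv, smul_comm]
  let χ : H →* L :=
    { toFun := c
      map_one' := smul_left_injective L hv0 (by
        simp only
        rw [hcv, one_smul]
        exact one_smul G v)
      map_mul' := fun g l => smul_left_injective L hv0 (by
        simp only
        rw [hcv, mul_smul, hcv l, ← hscal]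
        exact mul_smul g.1 l.1 v) }
  have hker : χ.toHomUnits.ker.map H.subtype = fixingSubgroup G (Set.univ : Set W) := by
    ext g
    rw [mem_fixingSubgroup_iff]
    constructor
    · rintro ⟨g, hg, rfl⟩ w _
      have h1 : c g = 1 := congrArg Units.val hg
      rw [Subgroup.coe_subtype, hscal, h1, one_smul]
    · intro h
      have hgH : g ∈ H := (mem_fixingSubgroup_iff G).2 fun a _ => by
        apply smul_left_injective L hv0
        simp only
        have h1 := hsl g a v
        rw [h _ (Set.mem_univ _), h _ (Set.mem_univ _)] at h1
        exact h1.symm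
      refine ⟨⟨g, hgH⟩, ?_, rfl⟩
      refine Units.ext (smul_left_injective L hv0 ?_)
      change c ⟨g, hgH⟩ • v = (1 : L) • v
      rw [hcv, one_smul]
      exact h _ (Set.mem_univ _)
  refine ⟨k, H.index, Nat.card χ.toHomUnits.range, hc ▸ hk,
    hG.of_dvd_nat (Subgroup.index_dvd_card H), ?_, ?_, ?_⟩
  · exact hG.of_dvd_nat ((Subgroup.card_range_dvd χ.toHomUnits).trans
      (Subgroup.card_subgroup_dvd_card H))
  · rw [← hc, ← Nat.card_units]
    exact Subgroup.card_subgroup_dvd_card _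
  · rw [← hker, Subgroup.index_map, Subgroup.ker_subtype, sup_bot_eq, Subgroup.index_ker,
      Subgroup.range_subtype, mul_comm]

/-- Explicit bounds for the order of a semilinear group of small degree. -/
lemma IsSemiLin.index_le {G : Type*} {W : Type u} [Group G] [Finite G] [AddCommGroup W] [Finite W]
    [Nontrivial W] [DistribMulAction G W] (hG : Odd (Nat.card G)) (h : IsSemiLin G W) :
    (Nat.card W = 25 → (fixingSubgroup G (Set.univ : Set W)).index ≤ 3) ∧
    (Nat.card W = 49 → (fixingSubgroup G (Set.univ : Set W)).index ≤ 3) ∧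
    (Nat.card W = 81 → (fixingSubgroup G (Set.univ : Set W)).index ≤ 5) ∧
    (Nat.card W = 121 → (fixingSubgroup G (Set.univ : Set W)).index ≤ 15) ∧
    (Nat.card W = 729 → (fixingSubgroup G (Set.univ : Set W)).index ≤ 273) := by
  obtain ⟨k, f, s, hk, hf, hs, hd, hi⟩ := h.index_dvd hG
  rw [hi]
  have key : ∀ a b, Nat.card W - 1 = 2 ^ a * b → b ≠ 0 → s ≤ b := by
    intro a b h1 hb
    rw [h1] at hd
    exact Nat.le_of_dvd (Nat.pos_of_ne_zero hb)
      ((Nat.Coprime.pow_right a (Nat.coprime_two_right.2 hs)).dvd_of_dvd_mul_left hd)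
  refine ⟨fun hN => ?_, fun hN => ?_, fun hN => ?_, fun hN => ?_, fun hN => ?_⟩ <;>
    have hcase := pow_odd_cases (by omega) hk hf
  · have := key 3 3 (by rw [hN]; norm_num) (by norm_num)
    have hf1 : f = 1 := by omega
    rw [hf1]; omega
  · have := key 4 3 (by rw [hN]; norm_num) (by norm_num)
    have hf1 : f = 1 := by omega
    rw [hf1]; omega
  · have := key 4 5 (by rw [hN]; norm_num) (by norm_num)
    have hf1 : f = 1 := by omega
    rw [hf1]; omega
  · have := key 3 15 (by rw [hN]; norm_num) (by norm_num)
    have hf1 : f = 1 := by omega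
    rw [hf1]; omega
  · have := key 3 91 (by rw [hN]; norm_num) (by norm_num)
    have hf1 : f ≤ 3 := by omega
    calc f * s ≤ 3 * 91 := Nat.mul_le_mul hf1 this
      _ = 273 := by norm_num

lemma mul_pow_sub_one_le {q m D : ℕ} (hq : 2 ≤ q) (h : m ≤ D) :
    D * (q ^ m - 1) ≤ m * (q ^ D - 1) := by
  rcases Nat.eq_zero_or_pos m with rfl | hm
  · simp
  induction D, h using Nat.le_induction with
  | base => exact le_rfl
  | succ D hD ih =>
    have h1 : q ^ m ≤ q ^ D := Nat.pow_le_pow_right (by omega) hD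
    have h2 : 2 * q ^ D ≤ q ^ (D + 1) := by rw [pow_succ']; exact Nat.mul_le_mul_right _ hq
    have h3 : 1 ≤ q ^ m := Nat.one_le_pow _ _ (by omega)
    calc (D + 1) * (q ^ m - 1) = D * (q ^ m - 1) + (q ^ m - 1) := by ring
      _ ≤ m * (q ^ D - 1) + m * q ^ D := by
        refine Nat.add_le_add ih ?_
        calc q ^ m - 1 ≤ q ^ D := by omega
          _ ≤ m * q ^ D := Nat.le_mul_of_pos_left _ hm
      _ = m * (q ^ D - 1 + q ^ D) := by ring
      _ ≤ m * (q ^ (D + 1) - 1) := Nat.mul_le_mul_left _ (by omega)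

lemma sum_finrank_le_of_iSupIndep {ι L V : Type*} [Fintype ι] [Field L] [AddCommGroup V] [Module L V]
    [FiniteDimensional L V] {p : ι → Submodule L V} (h : iSupIndep p) :
    ∑ i, Module.finrank L (p i) ≤ Module.finrank L V := by
  classical
  rw [← Module.finrank_pi_fintype]
  obtain ⟨f, hf⟩ : ∃ f : (Π₀ i, p i) →ₗ[L] V, Function.Injective f :=
    ⟨_, h.dfinsupp_lsum_injective⟩
  exact LinearMap.finrank_le_finrank_of_injective
    (f := f ∘ₗ (DFinsupp.linearEquivFunOnFintype (R := L)).symm.toLinearMap)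
    (hf.comp (LinearEquiv.injective _))

lemma eq_zero_of_vandermonde {L V : Type*} [Field L] [AddCommGroup V] [Module L V] {c : L}
    (hc0 : c ≠ 0) (hc1 : c ≠ 1) (hc2 : c ^ 2 ≠ 1) {u v w : V}
    (h : u + v + w = 0) (e1 : u + c • v + c ^ 2 • w = 0) (e2 : u + c ^ 2 • v + c ^ 4 • w = 0) :
    v = 0 ∧ w = 0 := by
  have k1 : (c - 1) • (v + (c + 1) • w) = 0 := by
    rw [← sub_self (0 : V)]
    nth_rw 1 [← e1]
    rw [← h]
    module
  have k2 : (c ^ 2 - 1) • (v + (c ^ 2 + 1) • w) = 0 := by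
    rw [← sub_self (0 : V)]
    nth_rw 1 [← e2]
    rw [← h]
    module
  replace k1 := (smul_eq_zero.1 k1).resolve_left (sub_ne_zero.2 hc1)
  replace k2 := (smul_eq_zero.1 k2).resolve_left (sub_ne_zero.2 hc2)
  have k3 : (c * (c - 1)) • w = 0 := by
    rw [← sub_self (0 : V)]
    nth_rw 1 [← k2]
    rw [← k1]
    module
  have hw0 := (smul_eq_zero.1 k3).resolve_left (mul_ne_zero hc0 (sub_ne_zero.2 hc1))
  rw [hw0, smul_zero, add_zero] at k1
  exact ⟨k1, hw0⟩

section Fixed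

variable {G V : Type*} [Group G] [AddCommGroup V] [DistribMulAction G V]

/-- The subgroup of vectors fixed by a group element. -/
def fixedVec (V : Type*) [AddCommGroup V] [DistribMulAction G V] (g : G) : AddSubgroup V where
  carrier := {v | g • v = v}
  zero_mem' := smul_zero g
  add_mem' := fun {a b} (ha : g • a = a) (hb : g • b = b) => by
    change g • (a + b) = a + b
    rw [smul_add, ha, hb]
  neg_mem' := fun {a} (ha : g • a = a) => by
    change g • (-a) = -a
    rw [smul_neg, ha]

lemma mem_fixedVec {g : G} {v : V} : v ∈ fixedVec V g ↔ g • v = v := Iff.rfl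

variable [Finite V]

lemma card_cube_le_of_injective (U : AddSubgroup V) (f₁ f₂ : V →+ V)
    (h : ∀ a ∈ U, ∀ b ∈ U, ∀ c ∈ U, a + f₁ b + f₂ c = 0 → b = 0 ∧ c = 0) :
    Nat.card U ^ 3 ≤ Nat.card V := by
  have hinj : Function.Injective (fun t : U × U × U => t.1.1 + f₁ t.2.1 + f₂ t.2.2) := by
    rintro ⟨a, b, c⟩ ⟨a', b', c'⟩ h1
    simp only at h1
    have h2 := h (a.1 - a') (U.sub_mem a.2 a'.2) (b.1 - b') (U.sub_mem b.2 b'.2) (c.1 - c')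
      (U.sub_mem c.2 c'.2) (by
        rw [map_sub, map_sub, ← sub_eq_zero.2 h1]
        abel)
    have hb := sub_eq_zero.1 h2.1
    have hc := sub_eq_zero.1 h2.2
    rw [hb, hc] at h1
    exact Prod.ext (Subtype.ext (add_right_cancel (add_right_cancel h1)))
      (Prod.ext (Subtype.ext hb) (Subtype.ext hc))
  have := Nat.card_le_card_of_injective _ hinj
  rw [Nat.card_prod, Nat.card_prod] at this
  calc _ = _ := by ring
    _ ≤ _ := this

lemma card_fixedVec_sq_le (x y : G) :
    Nat.card (fixedVec V x) ^ 2 ≤ Nat.card V * Nat.card (fixedVec V ⁅x, y⁆) := by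
  set U := fixedVec V x with hU
  let f : U × U →+ V := AddMonoidHom.coprod U.subtype
    (-((DistribSMul.toAddMonoidHom V y).comp U.subtype))
  have hf : ∀ a b, f (a, b) = a.1 - y • b.1 := fun a b => by
    rw [sub_eq_add_neg]; rfl
  have h1 : Nat.card f.ker ≤ Nat.card (fixedVec V ⁅x, y⁆) := by
    have hk : ∀ t : f.ker, t.1.1.1 = y • t.1.2.1 := fun t => by
      have := hf t.1.1 t.1.2
      rw [show f (t.1.1, t.1.2) = 0 from t.2] at this
      exact (sub_eq_zero.1 this.symm)
    let j : f.ker → fixedVec V ⁅x, y⁆ := fun t => ⟨t.1.1.1, by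
      have h2 : x • t.1.1.1 = t.1.1.1 := t.1.1.2
      have h3 : x • t.1.2.1 = t.1.2.1 := t.1.2.2
      have h4 : x⁻¹ • t.1.2.1 = t.1.2.1 := by rw [inv_smul_eq_iff, h3]
      have h5 := hk t
      rw [mem_fixedVec, commutatorElement_def, mul_smul, mul_smul, mul_smul]
      conv_lhs => rw [h5]
      rw [inv_smul_smul, h4, ← h5, h2]⟩
    refine Nat.card_le_card_of_injective j ?_
    intro s t hst
    have h2 : s.1.1.1 = t.1.1.1 := congrArg (fun t : fixedVec V ⁅x, y⁆ => t.1) hst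
    apply Subtype.ext
    refine Prod.ext (Subtype.ext h2) (Subtype.ext ?_)
    apply smul_left_cancel y
    rw [← hk s, ← hk t, h2]
  have h2 := AddSubgroup.card_eq_card_quotient_mul_card_addSubgroup f.ker
  rw [Nat.card_congr (QuotientAddGroup.quotientKerEquivRange f).toEquiv, Nat.card_prod, ← sq] at h2
  rw [h2]
  exact Nat.mul_le_mul (AddSubgroup.card_le_card_addGroup _) h1

variable {L : Type*} [Field L] [Module L V] [MulSemiringAction G L]

lemma card_fixedVec_cube_le_of_moved (hG : Odd (Nat.card G))
    (hsl : ∀ (g : G) (a : L) (v : V), g • a • v = (g • a) • g • v) {x : G} {a : L}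
    (hx : x • a ≠ a) : Nat.card (fixedVec V x) ^ 3 ≤ Nat.card V := by
  have h2 : x • x • a ≠ a := by
    intro h
    refine hx (smul_eq_of_odd_pow_smul_eq (k := 1) (odd_orderOf_of_odd_card hG x) ?_)
    rw [pow_one, pow_two, mul_smul, h]
  have h3 : x • x • a ≠ x • a := fun h => hx (smul_left_cancel x h)
  let f : L → V →+ V := fun c => DistribSMul.toAddMonoidHom V c
  refine card_cube_le_of_injective _ (f a) (f (a ^ 2)) ?_
  intro u hu v hv w hw h
  rw [mem_fixedVec] at hu hv hw
  replace h : u + a • v + a ^ 2 • w = 0 := h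
  have e1 := congrArg (x • ·) h
  have e2 := congrArg (x • x • ·) h
  simp only [smul_add, hsl, hu, hv, hw, smul_zero, smul_pow'] at e1 e2
  have k1 : (x • a - a) • (v + (x • a + a) • w) = 0 := by
    rw [← sub_self (0 : V)]
    nth_rw 1 [← e1]
    rw [← h]
    module
  have k2 : (x • x • a - a) • (v + (x • x • a + a) • w) = 0 := by
    rw [← sub_self (0 : V)]
    nth_rw 1 [← e2]
    rw [← h]
    module
  replace k1 := (smul_eq_zero.1 k1).resolve_left (sub_ne_zero.2 hx)
  replace k2 := (smul_eq_zero.1 k2).resolve_left (sub_ne_zero.2 h2)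
  have k3 : (x • x • a - x • a) • w = 0 := by
    rw [← sub_self (0 : V)]
    nth_rw 1 [← k2]
    rw [← k1]
    module
  have hw0 := (smul_eq_zero.1 k3).resolve_left (sub_ne_zero.2 h3)
  rw [hw0, smul_zero, add_zero] at k1
  exact ⟨k1, hw0⟩

lemma card_fixedVec_cube_le_of_twist
    (hsl : ∀ (g : G) (a : L) (v : V), g • a • v = (g • a) • g • v) {x f : G} {c : L}
    (hx : ∀ a : L, x • a = a) (hf : ∀ a : L, f • a = a) (hc0 : c ≠ 0) (hc1 : c ≠ 1) (hc2 : c ^ 2 ≠ 1)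
    (hxf : ∀ v : V, x • f • v = c • f • x • v) : Nat.card (fixedVec V x) ^ 3 ≤ Nat.card V := by
  refine card_cube_le_of_injective _ (DistribSMul.toAddMonoidHom V f)
    (DistribSMul.toAddMonoidHom V (f * f)) ?_
  intro u hu v hv w hw h
  rw [mem_fixedVec] at hu hv hw
  replace h : u + f • v + (f * f) • w = 0 := h
  rw [mul_smul] at h
  have e1 := congrArg (x • ·) h
  simp only [smul_add, hxf, hsl, hf, hu, hv, hw, smul_zero] at e1
  have e2 := congrArg (x • ·) e1
  simp only [smul_add, hxf, hsl, hf, hx, hu, hv, hw, smul_zero] at e2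
  have key := eq_zero_of_vandermonde hc0 hc1 hc2 h (by rw [← e1]; simp only [← mul_smul, sq])
    (by rw [← e2]; simp only [← mul_smul, ← mul_assoc]; ring_nf)
  rw [smul_eq_zero_iff_eq, smul_eq_zero_iff_eq, smul_eq_zero_iff_eq] at key
  exact key

/-- The fixed spaces of a coset of scalars are eigenspaces for different eigenvalues. -/
lemma sum_card_fixedVec_coset_le [Finite L]
    (hsl : ∀ (g : G) (a : L) (v : V), g • a • v = (g • a) • g • v) {x : G}
    (hx : ∀ a : L, x • a = a) (Z : Subgroup G) [Fintype Z] (χ : Z →* Lˣ)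
    (hχ : Function.Injective χ) (hZ : ∀ (z : Z) (v : V), z.1 • v = (χ z : L) • v) (D : ℕ)
    (hD : ∀ z : Z, Nat.card (fixedVec V (z.1 * x)) ≤ Nat.card L ^ D) :
    D * ∑ z : Z, (Nat.card (fixedVec V (z.1 * x)) - 1) ≤
      Module.finrank L V * (Nat.card L ^ D - 1) := by
  have hq : 2 ≤ Nat.card L := Finite.one_lt_card
  have : Module.Finite L V := Module.Finite.of_finite
  let T : Module.End L V :=
    { toFun := fun v => x • v
      map_add' := smul_add x
      map_smul' := fun a v => by rw [hsl, hx]; rfl }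
  let μ : Z → L := fun z => ((χ z)⁻¹ : Lˣ)
  have hμ : Function.Injective μ := fun z w h => hχ (inv_injective (Units.ext h))
  have hcard : ∀ z, Nat.card (fixedVec V (z.1 * x)) =
      Nat.card L ^ Module.finrank L (T.eigenspace (μ z)) := by
    intro z
    have := Fintype.ofFinite L
    have := Fintype.ofFinite (T.eigenspace (μ z))
    have h1 : ∀ v, v ∈ fixedVec V (z.1 * x) ↔ v ∈ T.eigenspace (μ z) := by
      intro v
      rw [mem_fixedVec, mul_smul, hZ, Module.End.mem_eigenspace_iff]
      change (χ z : L) • x • v = v ↔ x • v = (((χ z)⁻¹ : Lˣ) : L) • v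
      rw [← Units.smul_def, ← Units.smul_def, eq_inv_smul_iff]
    rw [Nat.card_congr (Equiv.subtypeEquivRight h1), Nat.card_eq_fintype_card,
      Nat.card_eq_fintype_card (α := L)]
    exact Module.card_eq_pow_finrank
  have hind := T.eigenspaces_iSupIndep.comp hμ
  have hsum := sum_finrank_le_of_iSupIndep hind
  rw [Finset.mul_sum]
  calc _ ≤ ∑ z : Z, Module.finrank L (T.eigenspace (μ z)) * (Nat.card L ^ D - 1) := by
        refine Finset.sum_le_sum fun z _ => ?_
        have h1 := hD z
        rw [hcard z] at h1 ⊢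
        exact mul_pow_sub_one_le hq ((Nat.pow_le_pow_iff_right hq).1 h1)
    _ = (∑ z : Z, Module.finrank L (T.eigenspace (μ z))) * (Nat.card L ^ D - 1) := by
        rw [Finset.sum_mul]
    _ ≤ _ := Nat.mul_le_mul_right _ hsum

end Fixed

/-- Endomorphisms commuting up to a nondegenerate bicharacter are linearly independent. -/
lemma card_le_finrank_sq {W L V : Type*} [AddCommGroup W] [Finite W] [Field L] [AddCommGroup V]
    [Module L V] [FiniteDimensional L V] [Nontrivial V] (β : W →+ W →+ Additive Lˣ)
    (hβ : ∀ a, (∀ b, β b a = 0) → a = 0) (T : W → Module.End L V)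
    (hT : ∀ a, Function.Bijective (T a))
    (hcomm : ∀ b a v, T b (T a v) = ((β b a).toMul : L) • T a (T b v)) :
    Nat.card W ≤ Module.finrank L V ^ 2 := by
  classical
  have := Fintype.ofFinite W
  let ψ : W → (Multiplicative W →* L) := fun a =>
    { toFun := fun b => ((β b.toAdd a).toMul : L)
      map_one' := by simp
      map_mul' := fun b c => by simp }
  have hψ : Function.Injective ψ := by
    intro a a' h
    rw [← sub_eq_zero]
    refine hβ _ fun b => ?_
    have h1 : ((β b a).toMul : L) = (β b a').toMul := DFunLike.congr_fun h (Multiplicative.ofAdd b)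
    have h2 : β b a = β b a' := Additive.toMul.injective (Units.ext h1)
    rw [map_sub, h2, sub_self]
  have hind : LinearIndependent L T := by
    rw [Fintype.linearIndependent_iff]
    intro c hc a
    have h1 : ∀ b v, ∑ x, (c x * (β b x).toMul) • T x v = 0 := by
      intro b v
      obtain ⟨u, rfl⟩ := (hT b).2 v
      have h2 := congrArg (T b) (LinearMap.congr_fun hc u)
      simp only [LinearMap.sum_apply, LinearMap.smul_apply, map_sum, map_smul, hcomm b,
        LinearMap.zero_apply, map_zero, smul_smul] at h2
      exact h2
    obtain ⟨v, hv⟩ := exists_ne (0 : V)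
    have h2 : T a v ≠ 0 := fun h => hv ((hT a).1 (h.trans (map_zero _).symm))
    have h3 : c a • T a v = 0 := by
      rw [← Module.forall_dual_apply_eq_zero_iff L]
      intro φ
      have h4 := (linearIndependent_monoidHom (Multiplicative W) L).comp ψ hψ
      rw [Fintype.linearIndependent_iff] at h4
      have h5 := h4 (fun x => φ (c x • T x v)) (by
        funext b
        have h6 := congrArg φ (h1 b.toAdd v)
        rw [map_sum, map_zero] at h6
        rw [Finset.sum_apply]
        simp only [Pi.zero_apply]
        rw [← h6]
        refine Finset.sum_congr rfl fun x _ => ?_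
        simp only [Function.comp_apply, Pi.smul_apply, smul_eq_mul, map_smul, ψ, MonoidHom.coe_mk,
          OneHom.coe_mk]
        ring)
      exact h5 a
    exact (smul_eq_zero.1 h3).resolve_right h2
  rw [Nat.card_eq_fintype_card, pow_two, ← Module.finrank_linearMap L L V V]
  exact hind.fintype_card_le_finrank

section Count

variable {G V : Type*} [Group G] [AddCommGroup V] [Finite V] [DistribMulAction G V]

lemma two_mul_card_sub_one_le [Fintype G] (hG : Odd (Nat.card G)) (Z : Subgroup G)
    [DecidablePred (· ∈ Z)] (hfree : ∀ z ∈ Z, ∀ v : V, z • v = v → v ≠ 0 → z = 1)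
    (hreg : ∀ v : V, ∃ g : G, g • v = v ∧ g ≠ 1) :
    2 * (Nat.card V - 1) ≤ ∑ g : G with g ∉ Z, (Nat.card (fixedVec V g) - 1) := by
  classical
  have := Fintype.ofFinite V
  have h1 : ∀ g : G, Nat.card (fixedVec V g) - 1 = ∑ v : V with v ≠ 0, if g • v = v then 1 else 0 := by
    intro g
    have h2 : Nat.card (fixedVec V g) = (Finset.univ.filter fun v : V => g • v = v).card := by
      rw [Nat.card_eq_fintype_card, Fintype.card_subtype]
      rfl
    rw [h2, Finset.sum_boole, Nat.cast_id, Finset.filter_filter, ← Finset.card_erase_of_mem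
      (a := (0 : V)) (by simp)]
    congr 1
    ext v
    simp
  have h3 : ∀ v : V, v ≠ 0 → 2 ≤ ∑ g : G with g ∉ Z, if g • v = v then 1 else 0 := by
    intro v hv
    rw [Finset.sum_boole, Nat.cast_id, Finset.filter_filter]
    have h4 : (Finset.univ.filter fun g : G => g ∉ Z ∧ g • v = v) =
        (Finset.univ.filter fun g : G => g ∈ MulAction.stabilizer G v).erase 1 := by
      ext g
      simp only [Finset.mem_filter, Finset.mem_univ, true_and, Finset.mem_erase,
        MulAction.mem_stabilizer_iff]
      constructor
      · rintro ⟨h, h'⟩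
        exact ⟨fun h1 => h (h1 ▸ Z.one_mem), h'⟩
      · rintro ⟨h, h'⟩
        exact ⟨fun h1 => h (hfree g h1 v h' hv), h'⟩
    rw [h4, Finset.card_erase_of_mem (by simp), ← Fintype.card_subtype]
    have h5 : Fintype.card {g : G // g ∈ MulAction.stabilizer G v} =
      Nat.card (MulAction.stabilizer G v) := (Nat.card_eq_fintype_card).symm
    rw [h5]
    have h6 : Odd (Nat.card (MulAction.stabilizer G v)) :=
      hG.of_dvd_nat (Subgroup.card_subgroup_dvd_card _)
    have h7 : Nat.card (MulAction.stabilizer G v) ≠ 1 := by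
      intro h
      obtain ⟨g, hg, hg1⟩ := hreg v
      rw [Subgroup.card_eq_one] at h
      have : g ∈ MulAction.stabilizer G v := hg
      rw [h, Subgroup.mem_bot] at this
      exact hg1 this
    obtain ⟨m, hm⟩ := h6
    omega
  simp only [h1]
  rw [Finset.sum_comm]
  calc 2 * (Nat.card V - 1) = ∑ v : V with v ≠ 0, 2 := by
        rw [Finset.sum_const, smul_eq_mul, mul_comm, Finset.filter_ne', Finset.card_erase_of_mem
          (Finset.mem_univ _), Finset.card_univ, Nat.card_eq_fintype_card]
    _ ≤ _ := Finset.sum_le_sum fun v hv => h3 v (Finset.mem_filter.1 hv).2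

lemma exists_regular_of_coset_bound [Finite G] (hG : Odd (Nat.card G)) (Z : Subgroup G) [Fintype Z]
    (hfree : ∀ z ∈ Z, ∀ v : V, z • v = v → v ≠ 0 → z = 1) {q d D : ℕ} (hV : Nat.card V = q ^ d)
    (hq : 2 ≤ q) (hD : 0 < D) (hDd : D ≤ d)
    (hB : ∀ x ∉ Z, D * ∑ z : Z, (Nat.card (fixedVec V (z.1 * x)) - 1) ≤ d * (q ^ D - 1))
    (hM : Z.index * d ≤ 2 * D * q ^ (d - D)) : ∃ v : V, ∀ g : G, g • v = v → g = 1 := by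
  classical
  have := Fintype.ofFinite G
  by_contra! hreg
  have h1 := two_mul_card_sub_one_le hG Z hfree hreg
  set S := ∑ g : G with g ∉ Z, (Nat.card (fixedVec V g) - 1) with hS
  have h2 : Nat.card Z * (D * S) =
      ∑ x : G with x ∉ Z, D * ∑ z : Z, (Nat.card (fixedVec V (z.1 * x)) - 1) := by
    rw [← Finset.mul_sum, Finset.sum_comm]
    have h3 : ∀ z : Z, ∑ x : G with x ∉ Z, (Nat.card (fixedVec V (z.1 * x)) - 1) = S := by
      intro z
      refine Finset.sum_equiv (Equiv.mulLeft z.1) (fun x => ?_) (fun x _ => rfl)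
      simp [Z.mul_mem_cancel_left z.2]
    simp only [h3, Finset.sum_const, Finset.card_univ, smul_eq_mul, Nat.card_eq_fintype_card]
    ring
  have h4 : (Finset.univ.filter fun x : G => x ∉ Z).card + Nat.card Z = Z.index * Nat.card Z := by
    rw [mul_comm, Z.card_mul_index, Nat.card_eq_fintype_card (α := G), Nat.card_eq_fintype_card,
      Fintype.card_subtype, add_comm, ← Finset.card_univ]
    exact Finset.card_filter_add_card_filter_not _
  have h5 : Nat.card Z * (D * S) ≤ Nat.card Z * ((Z.index - 1) * (d * (q ^ D - 1))) := by
    rw [h2]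
    refine (Finset.sum_le_card_nsmul _ _ _ fun x hx => hB x (Finset.mem_filter.1 hx).2).trans ?_
    rw [smul_eq_mul, ← mul_assoc (Nat.card Z), mul_comm (Nat.card Z), Nat.sub_mul Z.index, one_mul,
      ← h4, Nat.add_sub_cancel]
  have h6 := Nat.le_of_mul_le_mul_left h5 Nat.card_pos
  rw [hV] at h1
  have hqD : 1 < q ^ D := Nat.one_lt_pow hD.ne' hq
  have h7 : q ^ (d - D) * (q ^ D - 1) ≤ q ^ d - 1 := by
    rw [Nat.mul_sub, ← pow_add, Nat.sub_add_cancel hDd, mul_one]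
    exact Nat.sub_le_sub_left (Nat.one_le_pow _ _ (by omega)) _
  have h8 : 2 * D * q ^ (d - D) * (q ^ D - 1) ≤ (Z.index - 1) * d * (q ^ D - 1) := by
    calc 2 * D * q ^ (d - D) * (q ^ D - 1) = D * (2 * (q ^ (d - D) * (q ^ D - 1))) := by ring
      _ ≤ D * (2 * (q ^ d - 1)) := by gcongr
      _ ≤ D * S := by gcongr
      _ ≤ _ := by rw [mul_assoc]; exact h6
  have h9 := Nat.le_of_mul_le_mul_right h8 (by omega)
  have h10 : 0 < Z.index := Nat.pos_of_ne_zero Subgroup.index_ne_zero_of_finite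
  have h11 := hM.trans h9
  have h12 := Nat.le_of_mul_le_mul_right h11 (hD.trans_le hDd)
  omega

end Count

lemma cube_pow_six_le {k : ℕ} (hk : 11 ≤ k) : 7 * (3 * k) ^ 6 ≤ 16 * 7 ^ k := by
  induction k, hk using Nat.le_induction with
  | base => norm_num
  | succ k hk ih =>
    have h : 11 * (3 * (k + 1)) ≤ 12 * (3 * k) := by omega
    have h1 := Nat.pow_le_pow_left h 6
    rw [mul_pow, mul_pow 12] at h1
    rw [pow_succ 7]
    norm_num at h1
    omega

lemma cube_pow_six_le' {k : ℕ} (hk : 6 ≤ k) : 7 * (3 * k) ^ 6 ≤ 144 * 27 ^ (k - 1) := by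
  induction k, hk using Nat.le_induction with
  | base => norm_num
  | succ k hk ih =>
    have h : 6 * (3 * (k + 1)) ≤ 7 * (3 * k) := by omega
    have h1 := Nat.pow_le_pow_left h 6
    rw [mul_pow, mul_pow 7] at h1
    obtain ⟨j, rfl⟩ : ∃ j, k = j + 1 := ⟨k - 1, by omega⟩
    rw [Nat.add_sub_cancel] at ih ⊢
    rw [pow_succ 27]
    norm_num at h1
    omega

lemma two_mul_succ_le_of_prime_dvd {e q r : ℕ} (he : Odd e) (hq : Odd q) (hq1 : 1 < q) (hre : r ∣ e)
    (h : r ∣ q - 1) : 2 * r + 1 ≤ q := by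
  obtain ⟨c, hc⟩ := h
  have hro : Odd r := he.of_dvd_nat hre
  obtain ⟨a, ha⟩ := hq
  have : 2 * a = r * c := by omega
  have h2 : 2 ∣ r * c := ⟨a, this.symm⟩
  obtain ⟨b, rfl⟩ : 2 ∣ c := Nat.Coprime.dvd_of_dvd_mul_left (by simpa using hro) h2
  rcases b with _ | b
  · omega
  · nlinarith

lemma seven_le_of_prime_dvd {e q : ℕ} (he : Odd e) (he1 : e ≠ 1) (hq : Odd q) (hq1 : 1 < q)
    (hr : ∀ r, r.Prime → r ∣ e → r ∣ q - 1) : 7 ≤ q := by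
  have h0 := Nat.minFac_prime he1
  have h1 := two_mul_succ_le_of_prime_dvd he hq hq1 (Nat.minFac_dvd e) (hr _ h0 (Nat.minFac_dvd e))
  have h2 := h0.two_le
  obtain ⟨m, hm⟩ : Odd e.minFac := he.of_dvd_nat (Nat.minFac_dvd e)
  omega

/-- The numerical estimate behind the counting argument for extraspecial-type subgroups. -/
lemma extraspecial_bound {e g i q : ℕ} (he : Odd e) (he1 : e ≠ 1) (he3 : e ≠ 3) (hq : Odd q)
    (hq1 : 1 < q) (hr : ∀ r, r.Prime → r ∣ e → r ∣ q - 1) (hg : g = 1 ∨ (27 ≤ q ∧ 9 * g ≤ q))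
    (hi : 2 * i ≤ e ^ 4) (h5 : e = 5 → i ≤ 3) (h7 : e = 7 → i ≤ 3) (h9 : e = 9 → i ≤ 5)
    (h11 : e = 11 → i ≤ 15) (h27 : e = 27 → i ≤ 273) :
    7 * (g * i * e ^ 2) ≤ 8 * q ^ ((e + 2) / 3) ∨
      9 ≤ e ∧ 5 * (g * i * e ^ 2) ≤ 6 * q ^ ((e + 2) / 3) := by
  have hr' : ∀ r, r.Prime → r ∣ e → 2 * r + 1 ≤ q := fun r hrp hre =>
    two_mul_succ_le_of_prime_dvd he hq hq1 hre (hr r hrp hre)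
  have hq7 : 7 ≤ q := seven_le_of_prime_dvd he he1 hq hq1 hr
  set k := (e + 2) / 3 with hk
  have hk1 : 1 ≤ k := by
    have : 0 < e := he.pos
    omega
  -- reduction to an estimate without the field automorphisms
  have key : ∀ {A B : ℕ}, (g = 1 → A ≤ B * q ^ k) → (27 ≤ q → A ≤ 9 * B * q ^ (k - 1)) →
      g * A ≤ B * q ^ k := by
    intro A B h1 h2
    rcases hg with rfl | ⟨h27, hg⟩
    · rw [one_mul]; exact h1 rfl
    · calc g * A ≤ g * (9 * B * q ^ (k - 1)) := Nat.mul_le_mul_left _ (h2 h27)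
        _ = 9 * g * (B * q ^ (k - 1)) := by ring
        _ ≤ q * (B * q ^ (k - 1)) := Nat.mul_le_mul_right _ hg
        _ = B * q ^ k := by
          obtain ⟨j, hj⟩ : ∃ j, k = j + 1 := ⟨k - 1, by omega⟩
          rw [hj, Nat.add_sub_cancel, pow_succ]; ring
  have small : ∀ {i₀ a : ℕ}, i ≤ i₀ → a ≤ q → 7 * i₀ * e ^ 2 ≤ 8 * a ^ k →
      7 * i₀ * e ^ 2 ≤ 72 * 27 ^ (k - 1) → 7 * (g * i * e ^ 2) ≤ 8 * q ^ k := by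
    intro i₀ a hi₀ ha h1 h2
    have : 7 * (g * i * e ^ 2) = g * (7 * i * e ^ 2) := by ring
    rw [this]
    have h3 : 7 * i * e ^ 2 ≤ 7 * i₀ * e ^ 2 := by gcongr
    refine key (fun _ => (h3.trans h1).trans ?_) fun h27 => (h3.trans h2).trans ?_ <;> gcongr
  have large : ∀ {a b : ℕ}, a ≤ q → b ≤ q → 7 * e ^ 6 ≤ 16 * a ^ k →
      (27 ≤ q → 7 * e ^ 6 ≤ 144 * b ^ (k - 1)) → 7 * (g * i * e ^ 2) ≤ 8 * q ^ k := by
    intro a b ha hb h1 h2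
    have h0 : 2 * (7 * (g * i * e ^ 2)) ≤ g * (7 * e ^ 6) := by
      calc 2 * (7 * (g * i * e ^ 2)) = g * (7 * ((2 * i) * e ^ 2)) := by ring
        _ ≤ g * (7 * (e ^ 4 * e ^ 2)) := by gcongr
        _ = _ := by ring
    have h3 : g * (7 * e ^ 6) ≤ 16 * q ^ k := by
      refine key (fun _ => h1.trans ?_) fun h27 => (h2 h27).trans ?_ <;> norm_num <;> gcongr
    omega
  by_cases he33 : 33 ≤ e
  · left
    have h1 : 7 * e ^ 6 ≤ 7 * (3 * k) ^ 6 := by gcongr; omega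
    refine large (a := 7) (b := if 27 ≤ q then 27 else 7) hq7 (by split_ifs <;> omega)
      (h1.trans (cube_pow_six_le (by omega))) fun h => ?_
    rw [if_pos h]
    exact h1.trans (cube_pow_six_le' (by omega))
  · have he' : e < 33 := by omega
    clear_value k
    obtain ⟨m, rfl⟩ := he
    have hm : m < 16 := by omega
    interval_cases m
    · exact absurd rfl he1
    · exact absurd rfl he3
    · subst hk
      exact .inl (small (h5 rfl) (hr' 5 (by norm_num) (by norm_num)) (by norm_num) (by norm_num))
    · subst hk
      exact .inl (small (h7 rfl) (hr' 7 (by norm_num) (by norm_num)) (by norm_num) (by norm_num))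
    · subst hk
      refine .inr ⟨by norm_num, ?_⟩
      have h1 := h9 rfl
      rw [show 5 * (g * i * (2 * 4 + 1) ^ 2) = g * (5 * i * 81) by ring]
      refine key (fun _ => ?_) fun h27 => ?_
      · calc 5 * i * 81 ≤ 6 * 7 ^ 3 := by omega
          _ ≤ 6 * q ^ 3 := by gcongr
      · calc 5 * i * 81 ≤ 9 * 6 * 27 ^ 2 := by omega
          _ ≤ 9 * 6 * q ^ 2 := by gcongr
    · subst hk
      exact .inl (small (h11 rfl) (hr' 11 (by norm_num) (by norm_num)) (by norm_num) (by norm_num))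
    · subst hk
      have := hr' 13 (by norm_num) (by norm_num)
      exact .inl (large this this (by norm_num) (by norm_num))
    · subst hk
      have h1 := hr 3 (by norm_num) (by norm_num)
      have h2 := hr 5 (by norm_num) (by norm_num)
      have : 31 ≤ q := by
        obtain ⟨a, ha⟩ := hq
        omega
      exact .inl (large this this (by norm_num) (by norm_num))
    · subst hk
      have := hr' 17 (by norm_num) (by norm_num)
      exact .inl (large this this (by norm_num) (by norm_num))
    · subst hk
      have := hr' 19 (by norm_num) (by norm_num)
      exact .inl (large this this (by norm_num) (by norm_num))
    · subst hk
      have := hr' 7 (by norm_num) (by norm_num)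
      exact .inl (large this this (by norm_num) (by norm_num))
    · subst hk
      have := hr' 23 (by norm_num) (by norm_num)
      exact .inl (large this this (by norm_num) (by norm_num))
    · subst hk
      have := hr' 5 (by norm_num) (by norm_num)
      exact .inl (large this this (by norm_num) (by norm_num))
    · subst hk
      exact .inl (small (h27 rfl) hq7 (by norm_num) (by norm_num))
    · subst hk
      have := hr' 29 (by norm_num) (by norm_num)
      exact .inl (large this this (by norm_num) (by norm_num))
    · subst hk
      have := hr' 31 (by norm_num) (by norm_num)
      exact .inl (large this this (by norm_num) (by norm_num))

lemma index_mul_le_of_extraspecial_bound {M B e d q : ℕ} (hM : M ≤ B) (he : 5 ≤ e) (hd : e ≤ d)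
    (hq : 1 < q) (h : 7 * B ≤ 8 * q ^ ((e + 2) / 3) ∨ 9 ≤ e ∧ 5 * B ≤ 6 * q ^ ((e + 2) / 3)) :
    M * d ≤ 2 * (2 * d / 3) * q ^ (d - 2 * d / 3) := by
  have h1 : q ^ ((e + 2) / 3) ≤ q ^ (d - 2 * d / 3) := Nat.pow_le_pow_right (by omega) (by omega)
  set D := 2 * d / 3 with hD
  set Q := q ^ (d - D)
  rcases h with h | ⟨h9, h⟩
  · have h2 : 4 * d ≤ 7 * D := by
      rcases Nat.lt_or_ge d 7 with h7 | h7
      · have : d = 5 ∨ d = 6 := by omega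
        rcases this with rfl | rfl <;> norm_num [hD]
      · omega
    have h3 : 7 * M ≤ 8 * Q := by omega
    nlinarith [Nat.zero_le Q]
  · have h2 : 3 * d ≤ 5 * D := by omega
    have h3 : 5 * M ≤ 6 * Q := by omega
    nlinarith [Nat.zero_le Q]

section Semilinear

variable {G L V : Type*} [Group G] [Field L] [AddCommGroup V] [Finite V]
  [DistribMulAction G V] [Module L V] [MulSemiringAction G L]

lemma card_fixedVec_cube_le_of_commutator (hG : Odd (Nat.card G))
    (hsl : ∀ (g : G) (a : L) (v : V), g • a • v = (g • a) • g • v) (Z : Subgroup G)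
    (χ : Z →* Lˣ) (hχ : Function.Injective χ) (hZ : ∀ (z : Z) (v : V), z.1 • v = (χ z : L) • v)
    {x f : G} (hx : ∀ a : L, x • a = a) (hf : ∀ a : L, f • a = a) (hxf : ⁅x, f⁆ ∈ Z)
    (h1 : ⁅x, f⁆ ≠ 1) : Nat.card (fixedVec V x) ^ 3 ≤ Nat.card V := by
  set z : Z := ⟨⁅x, f⁆, hxf⟩ with hz
  have hz1 : z ≠ 1 := fun h => h1 (congrArg Subtype.val h)
  have hc1 : χ z ≠ 1 := fun h => hz1 (hχ (h.trans (map_one χ).symm))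
  have hc2 : χ z ^ 2 ≠ 1 := by
    intro h
    rw [← map_pow] at h
    have h2 : z ^ 2 = 1 := hχ (h.trans (map_one χ).symm)
    refine hz1 ?_
    rw [← orderOf_eq_one_iff]
    have h3 : Odd (orderOf z) :=
      (hG.of_dvd_nat (Subgroup.card_subgroup_dvd_card Z)).of_dvd_nat (orderOf_dvd_natCard z)
    exact Nat.Coprime.eq_one_of_dvd (h3.coprime_two_right) (orderOf_dvd_of_pow_eq_one h2)
  refine card_fixedVec_cube_le_of_twist (c := (χ z : L)) hsl hx hf (χ z).ne_zero
    (fun h => hc1 (Units.ext h)) (fun h => hc2 (Units.ext (by push_cast; exact h))) fun v => ?_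
  rw [← hZ, ← mul_smul, ← mul_smul, ← mul_smul]
  congr 1
  simp only [hz, commutatorElement_def]
  group

variable [Finite L]

lemma card_fixedVec_le_pow (hsl : ∀ (g : G) (a : L) (v : V), g • a • v = (g • a) • g • v)
    {x : G} (hx : ∀ a : L, x • a = a) (h : Nat.card (fixedVec V x) ^ 3 ≤ Nat.card V ^ 2) :
    Nat.card (fixedVec V x) ≤ Nat.card L ^ (2 * Module.finrank L V / 3) := by
  have := Fintype.ofFinite L
  have := Fintype.ofFinite V
  have hq : 1 < Nat.card L := Finite.one_lt_card
  let U : Submodule L V := { fixedVec V x with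
    smul_mem' := fun a v (hv : x • v = v) => by
      change x • a • v = a • v
      rw [hsl, hx, hv] }
  have hU : Nat.card (fixedVec V x) = Nat.card L ^ Module.finrank L U := by
    have := Fintype.ofFinite U
    have h1 := Module.card_eq_pow_finrank (K := L) (V := U)
    rw [← Nat.card_eq_fintype_card, ← Nat.card_eq_fintype_card] at h1
    exact h1
  have hV : Nat.card V = Nat.card L ^ Module.finrank L V := by
    rw [Nat.card_eq_fintype_card, Nat.card_eq_fintype_card]
    exact Module.card_eq_pow_finrank
  rw [hU, hV, ← pow_mul, ← pow_mul, Nat.pow_le_pow_iff_right hq] at h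
  rw [hU]
  exact Nat.pow_le_pow_right hq.le (by omega)

/-- The coset estimate for elements acting nontrivially on the field. -/
lemma sum_card_fixedVec_coset_le_of_moved (hG : Odd (Nat.card G))
    (hsl : ∀ (g : G) (a : L) (v : V), g • a • v = (g • a) • g • v) (Z : Subgroup G) [Fintype Z]
    (χ : Z →* Lˣ) (hχ : Function.Injective χ) {x : G} {a : L} (hZL : ∀ (z : Z) (b : L), z.1 • b = b)
    (hx : x • a ≠ a) (hd : 5 ≤ Module.finrank L V) :
    2 * Module.finrank L V / 3 * ∑ z : Z, (Nat.card (fixedVec V (z.1 * x)) - 1) ≤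
      Module.finrank L V * (Nat.card L ^ (2 * Module.finrank L V / 3) - 1) := by
  have hfin := Fintype.ofFinite L
  have := Fintype.ofFinite V
  have hq : 1 < Nat.card L := Finite.one_lt_card
  have hV : Nat.card V = Nat.card L ^ Module.finrank L V := by
    rw [Nat.card_eq_fintype_card, Nat.card_eq_fintype_card]
    exact Module.card_eq_pow_finrank
  set d := Module.finrank L V with hd'
  set q := Nat.card L with hq'
  obtain ⟨D, hD⟩ : ∃ D, 2 * d / 3 = D + 1 := ⟨2 * d / 3 - 1, by omega⟩
  have h1 : ∀ z : Z, Nat.card (fixedVec V (z.1 * x)) ≤ q ^ D := by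
    intro z
    have h2 : Nat.card (fixedVec V (z.1 * x)) ^ 3 ≤ q ^ d := by
      rw [← hV]
      exact card_fixedVec_cube_le_of_moved hG hsl (a := a) (by rwa [mul_smul, hZL])
    refine le_of_pow_le_pow_left₀ (n := 3) (by norm_num) (Nat.zero_le _) (h2.trans ?_)
    rw [← pow_mul]
    exact Nat.pow_le_pow_right hq.le (by omega)
  have h3 : Fintype.card Z ≤ q - 1 := by
    rw [← Nat.card_eq_fintype_card, hq', ← Nat.card_units]
    exact Nat.card_le_card_of_injective χ hχ
  rw [hD]
  refine Nat.mul_le_mul (by omega) ?_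
  refine (Finset.sum_le_card_nsmul _ _ (q ^ D - 1) fun z _ => Nat.sub_le_sub_right (h1 z) 1).trans ?_
  rw [smul_eq_mul, Finset.card_univ]
  calc Fintype.card Z * (q ^ D - 1) ≤ (q - 1) * (q ^ D - 1) := Nat.mul_le_mul_right _ h3
    _ ≤ q * (q ^ D - 1) := Nat.mul_le_mul_right _ (Nat.sub_le _ _)
    _ = q ^ (D + 1) - q := by rw [Nat.mul_sub, mul_one, pow_succ']
    _ ≤ _ := Nat.sub_le_sub_left hq.le _

end Semilinear

lemma exists_maximal_abelian_normal (G : Type*) [Group G] [Finite G] :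
    ∃ Z : Subgroup G, Z.Normal ∧ (∀ a ∈ Z, ∀ b ∈ Z, a * b = b * a) ∧
      ∀ A : Subgroup G, A.Normal → (∀ a ∈ A, ∀ b ∈ A, a * b = b * a) → Z ≤ A → A ≤ Z := by
  have hfin : Finite (Subgroup G) := Finite.of_injective (fun U => (U : Set G))
    SetLike.coe_injective
  obtain ⟨Z, ⟨hZn, hZ⟩, hmax⟩ := Set.exists_max_image
    {X : Subgroup G | X.Normal ∧ ∀ a ∈ X, ∀ b ∈ X, a * b = b * a} (fun X => Nat.card X)
    (Set.toFinite _) ⟨⊥, inferInstance, by simp⟩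
  exact ⟨Z, hZn, hZ, fun A hAn hA hZA =>
    (Subgroup.eq_of_le_of_card_ge hZA (hmax A ⟨hAn, hA⟩)).ge⟩

lemma sq_lt_pow {d q : ℕ} (hq : 3 ≤ q) : d ^ 2 < q ^ d := by
  refine lt_of_lt_of_le ?_ (Nat.pow_le_pow_left hq d)
  rcases Nat.lt_or_ge d 2 with h | h
  · interval_cases d <;> norm_num
  · induction d, h using Nat.le_induction with
    | base => norm_num
    | succ d hd ih => rw [pow_succ 3]; nlinarith

/-- Primitive odd-order linear groups up to size `n` are semilinear or large with a regular orbit. -/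
def PrimDichotomy (n : ℕ) : Prop :=
  ∀ (G V : Type u) [Group G] [Finite G] [AddCommGroup V] [Finite V] [DistribMulAction G V],
    Odd (Nat.card G) → Group.IsSolvable G → Odd (Nat.card V) → Nat.card V ≤ n → IsIrr G V →
    IsPrim G V → IsSemiLin G V ∨
      161051 ≤ Nat.card V ∧ ∃ v : V, ∀ g : G, g • v = v → ∀ w : V, g • w = w

/-- The index of the kernel on an anisotropic module. -/
lemma IsAniso.index_fixingSubgroup_le {n : ℕ} (hP : PrimDichotomy.{u} n) {G W : Type u} {L : Type*}
    [Group G] [Finite G] [Field L] [AddCommGroup W] [Finite W] [Nontrivial W] [DistribMulAction G W]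
    {β : W →+ W →+ Additive Lˣ} (h : IsAniso G β) (hG : Odd (Nat.card G)) (hs : Group.IsSolvable G)
    (hW : Odd (Nat.card W)) (hn : Nat.card W ≤ n) :
    (Nat.card W = 25 → (fixingSubgroup G (Set.univ : Set W)).index ≤ 3) ∧
    (Nat.card W = 49 → (fixingSubgroup G (Set.univ : Set W)).index ≤ 3) ∧
    (Nat.card W = 81 → (fixingSubgroup G (Set.univ : Set W)).index ≤ 5) ∧
    (Nat.card W = 121 → (fixingSubgroup G (Set.univ : Set W)).index ≤ 15) ∧
    (Nat.card W = 729 → (fixingSubgroup G (Set.univ : Set W)).index ≤ 273) := by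
  have key : (Nat.card W = 25 ∨ Nat.card W = 49 ∨ Nat.card W = 81 ∨ Nat.card W = 121 ∨
      Nat.card W = 729) → IsSemiLin G W := by
    intro hN
    rcases hP G W hG hs hW hn (h.isIrr hG hN) (h.isPrim hG hN) with h1 | ⟨h1, -⟩
    · exact h1
    · omega
  refine ⟨fun hN => ?_, fun hN => ?_, fun hN => ?_, fun hN => ?_, fun hN => ?_⟩ <;>
    obtain ⟨h1, h2, h3, h4, h5⟩ := IsSemiLin.index_le hG (key (by omega))
  · exact h1 hN
  · exact h2 hN
  · exact h3 hN
  · exact h4 hN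
  · exact h5 hN

lemma isSemiLin_or_regular_of_faithful {n : ℕ} (hP : PrimDichotomy.{u} n) (hS : HasBaseTwo.{u} n)
    {G V : Type u} [Group G] [Finite G] [AddCommGroup V] [Finite V] [DistribMulAction G V]
    [FaithfulSMul G V] (hG : Odd (Nat.card G)) (hs : Group.IsSolvable G) (hVo : Odd (Nat.card V))
    (hn : Nat.card V ≤ n + 1) (hirr : IsIrr G V) (hprim : IsPrim G V) :
    IsSemiLin G V ∨ 161051 ≤ Nat.card V ∧ ∃ v : V, ∀ g : G, g • v = v → g = 1 := by
  classical
  have := hirr.1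
  obtain ⟨v₀, hv₀⟩ := exists_ne (0 : V)
  obtain ⟨Z, hZn, hZab, hmax⟩ := exists_maximal_abelian_normal G
  obtain ⟨L, _, _, _, _, χ, hsl, hZχ, hχL⟩ := exists_field_of_normal hirr hprim Z hZab
  have hχ : Function.Injective χ := by
    intro z z' h
    refine Subtype.ext (FaithfulSMul.eq_of_smul_eq_smul (α := V) fun v => ?_)
    rw [hZχ, hZχ, h]
  set C := Subgroup.centralizer (Z : Set G) with hCdef
  have hC : ∀ x : G, x ∈ C ↔ ∀ a : L, x • a = a := by
    intro x
    rw [hCdef, Subgroup.mem_centralizer_iff]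
    constructor
    · intro h
      refine hχL x fun z => ?_
      have h1 : (x • (χ z : L)) • x • v₀ = (χ z : L) • x • v₀ := by
        rw [← hsl, ← hZχ, ← hZχ, ← mul_smul, ← mul_smul, h z.1 z.2]
      exact smul_left_injective L (m := x • v₀) (fun h => hv₀ ((smul_eq_zero_iff_eq x).1 h)) h1
    · intro h z hz
      refine FaithfulSMul.eq_of_smul_eq_smul (α := V) fun v => ?_
      rw [mul_smul, mul_smul, hZχ ⟨z, hz⟩, hZχ ⟨z, hz⟩, hsl, h]
  by_cases hCZ : C ≤ Z
  · left
    refine ⟨L, _, _, _, hsl, exists_generator_of_scalar hirr hsl fun g hg => ?_⟩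
    exact ⟨_, fun v => hZχ ⟨g, hCZ ((hC g).2 hg)⟩ v⟩
  right
  have := Fintype.ofFinite L
  have := Fintype.ofFinite V
  have := Fintype.ofFinite Z
  have hfd : Module.Finite L V := Module.Finite.of_finite
  have hq1 : 1 < Nat.card L := Finite.one_lt_card
  have hV : Nat.card V = Nat.card L ^ Module.finrank L V := by
    rw [Nat.card_eq_fintype_card, Nat.card_eq_fintype_card]
    exact Module.card_eq_pow_finrank
  have hd0 : 0 < Module.finrank L V := Module.finrank_pos
  have hqo : Odd (Nat.card L) := hVo.of_dvd_nat (hV ▸ dvd_pow_self _ hd0.ne')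
  obtain ⟨E, hEn, hZE, hEZ, hEC, hEE, hCE, hEmax⟩ := exists_maximal_class_two hs Z hZab hmax hCZ
  have hcE : ∀ x ∈ E, ∀ z ∈ Z, x * z = z * x := fun x hx z hz =>
    (Subgroup.mem_centralizer_iff.1 (hEC hx) z hz).symm
  obtain ⟨W, _, _, _, w, β, hwE, hwmul, hwZ, hwconj, hwβ, hani⟩ :=
    exists_pairing Z E hZE hEE hcE hmax χ hχ
  have hcomm : ∀ x ∈ E, ∀ y ∈ E, ⁅x, y⁆ ∈ Z := fun x hx y hy =>
    hEE (Subgroup.commutator_mem_commutator hx hy)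
  -- the symplectic module embeds in the endomorphism ring
  have hNd : Nat.card W ≤ Module.finrank L V ^ 2 := by
    choose s hsE hsw using hwE
    refine card_le_finrank_sq β (fun a ha => hani.nondeg a fun b => ?_) (fun a =>
      { toFun := fun v => s a • v
        map_add' := smul_add _
        map_smul' := fun c v => by rw [hsl, (hC _).1 (hEC (hsE a))]; rfl })
      (fun a => MulAction.bijective (s a)) fun b a v => ?_
    · rw [pairing_antisymm hani.alt, ha, neg_zero]
    · have h1 := hwβ (s b) (hsE b) (s a) (hsE a) (hcomm _ (hsE b) _ (hsE a))
      rw [hsw, hsw] at h1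
      change s b • s a • v = ((β b a).toMul : L) • s a • s b • v
      rw [h1, toMul_ofMul, ← hZχ, ← mul_smul, ← mul_smul, ← mul_smul]
      congr 1
      simp only [commutatorElement_def]
      group
  have hWnt : Nontrivial W := by
    obtain ⟨x, hx, hxZ⟩ := SetLike.not_le_iff_exists.1 hEZ
    exact ⟨w x, 0, fun h => hxZ ((hwZ x hx).1 h)⟩
  -- orders of the sections
  have hw1 : w 1 = 0 := (hwZ 1 E.one_mem).2 Z.one_mem
  have hwinv : ∀ x ∈ E, w x⁻¹ = - w x := fun x hx => by
    rw [eq_neg_iff_add_eq_zero, ← hwmul _ (E.inv_mem hx) _ hx, inv_mul_cancel, hw1]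
  let φ : E →* Multiplicative W :=
    { toFun := fun x => Multiplicative.ofAdd (w x)
      map_one' := by rw [OneMemClass.coe_one, hw1]; rfl
      map_mul' := fun x y => by rw [Subgroup.coe_mul, hwmul _ x.2 _ y.2]; rfl }
  have hZE' : Z.relIndex E = Nat.card W := by
    have h1 : Z.subgroupOf E = φ.ker := by
      ext x
      rw [Subgroup.mem_subgroupOf, MonoidHom.mem_ker, ← hwZ _ x.2]
      rfl
    have h2 : Function.Surjective φ := fun a => by
      obtain ⟨x, hx, hxa⟩ := hwE a.toAdd
      exact ⟨⟨x, hx⟩, congrArg Multiplicative.ofAdd hxa⟩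
    rw [Subgroup.relIndex, h1, Subgroup.index_ker, MonoidHom.range_eq_top.2 h2, Subgroup.card_top]
    rfl
  have hWo : Odd (Nat.card W) :=
    (hG.of_dvd_nat (Subgroup.card_subgroup_dvd_card E)).of_dvd_nat
      (hZE' ▸ Subgroup.relIndex_dvd_card Z E)
  set K := fixingSubgroup G (Set.univ : Set W) with hK
  have hKC : K ⊓ C ≤ E := by
    rintro x ⟨hxK, hxC⟩
    refine hEmax x hxC fun y hy => ?_
    have h1 : x * y * x⁻¹ ∈ E := hEn.conj_mem y hy x
    rw [commutatorElement_def, ← hwZ _ (E.mul_mem h1 (E.inv_mem hy)), hwmul _ h1 _ (E.inv_mem hy),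
      hwconj x y hy, hwinv y hy, (mem_fixingSubgroup_iff G).1 hxK _ (Set.mem_univ _), add_neg_cancel]
  have hEC' : E.relIndex C ≤ K.index :=
    calc E.relIndex C ≤ (K ⊓ C).relIndex C :=
          Subgroup.relIndex_le_of_le_left hKC Subgroup.index_ne_zero_of_finite
      _ = K.relIndex C := Subgroup.inf_relIndex_right _ _
      _ ≤ K.relIndex ⊤ := Subgroup.relIndex_le_of_le_right le_top Subgroup.index_ne_zero_of_finite
      _ = K.index := Subgroup.relIndex_top_right _
  have hM : Z.index ≤ C.index * K.index * Nat.card W := by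
    rw [← Subgroup.relIndex_mul_index hZE, ← Subgroup.relIndex_mul_index hEC, hZE']
    calc Nat.card W * (E.relIndex C * C.index) ≤ Nat.card W * (K.index * C.index) := by gcongr
      _ = _ := by ring
  have hCi : C.index = 1 ∨ 27 ≤ Nat.card L ∧ 9 * C.index ≤ Nat.card L := by
    obtain ⟨k, hk⟩ := exists_card_eq_pow_index (G := G) (L := L)
    have h1 : fixingSubgroup G (Set.univ : Set L) = C := by
      ext x
      rw [hC, mem_fixingSubgroup_iff]
      simp
    rw [h1] at hk
    obtain ⟨m, hm⟩ : Odd C.index := hG.of_dvd_nat (Subgroup.index_dvd_card C)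
    rcases Nat.eq_zero_or_pos m with rfl | hm0
    · exact .inl hm
    · right
      have hk3 : 3 ≤ k := by
        have h2 : Odd k := hqo.of_dvd_nat (hk ▸ dvd_pow_self k (by omega))
        have h3 : k ≠ 1 := by rintro rfl; rw [one_pow] at hk; omega
        obtain ⟨j, hj⟩ := h2
        omega
      have h4 : 3 ^ C.index ≤ Nat.card L := hk ▸ Nat.pow_le_pow_left hk3 _
      have h5 : ∀ m, 1 ≤ m → 9 * (2 * m + 1) ≤ 3 ^ (2 * m + 1) := by
        intro m hm
        induction m, hm using Nat.le_induction with
        | base => norm_num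
        | succ m hm ih =>
          rw [show 2 * (m + 1) + 1 = (2 * m + 1) + 2 by ring, pow_add 3]
          omega
      have h6 := h5 m hm0
      rw [← hm] at h6
      omega
  obtain ⟨e, he⟩ := hani.card_eq_sq
  rw [he] at hNd
  have heo : Odd e := hWo.of_dvd_nat (he ▸ dvd_pow_self e two_ne_zero)
  have hed : e ≤ Module.finrank L V := (Nat.pow_le_pow_iff_left two_ne_zero).1 hNd
  have hq3 : 3 ≤ Nat.card L := by
    obtain ⟨m, hm⟩ := hqo
    omega
  have hWn : Nat.card W ≤ n := by
    have := sq_lt_pow (d := Module.finrank L V) hq3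
    omega
  have he1 : e ≠ 1 := by
    rintro rfl
    have : 1 < Nat.card W := Finite.one_lt_card
    omega
  have he3 : e ≠ 3 := by
    rintro rfl
    have h1 := hani.card_ne_nine hG (X := ⊤) fun _ _ _ => AddSubgroup.mem_top _
    rw [AddSubgroup.card_top] at h1
    omega
  have he5 : 5 ≤ e := by
    obtain ⟨m, hm⟩ := heo
    omega
  have hr : ∀ r, r.Prime → r ∣ e → r ∣ Nat.card L - 1 := fun r hrp hre =>
    hani.prime_dvd hrp (he ▸ dvd_pow hre two_ne_zero)
  have hi := IsAniso.two_mul_index_le hS hG hs _ W β hani hWo hWn le_rfl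
  obtain ⟨i5, i7, i9, i11, i27⟩ := hani.index_fixingSubgroup_le hP hG hs hWo hWn
  rw [← hK] at hi i5 i7 i9 i11 i27
  rw [he] at hi hM i5 i7 i9 i11 i27
  have hbound := extraspecial_bound heo he1 he3 hqo hq1 hr hCi (by rw [← pow_mul] at hi; exact hi)
    (fun h => i5 (by rw [h]; norm_num)) (fun h => i7 (by rw [h]; norm_num))
        (fun h => i9 (by rw [h]; norm_num))
    (fun h => i11 (by rw [h]; norm_num)) (fun h => i27 (by rw [h]; norm_num))
  have hMd := index_mul_le_of_extraspecial_bound hM he5 hed hq1 hbound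
  have hZL : ∀ (z : Z) (b : L), z.1 • b = b := fun z => (hC _).1 (hEC (hZE z.2))
  refine ⟨?_, exists_regular_of_coset_bound hG Z (fun z hz v hzv hv => ?_) hV hq1 (by omega)
    (by omega) (fun x hxZ => ?_) hMd⟩
  · rw [hV]
    rcases Nat.lt_or_ge e 7 with h | h
    · have h5 : e = 5 := by
        obtain ⟨m, hm⟩ := heo
        omega
      subst h5
      have h1 := two_mul_succ_le_of_prime_dvd heo hqo hq1 dvd_rfl (hr 5 (by norm_num) dvd_rfl)
      calc 161051 = 11 ^ 5 := by norm_num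
        _ ≤ Nat.card L ^ 5 := Nat.pow_le_pow_left h1 5
        _ ≤ _ := Nat.pow_le_pow_right hq1.le hed
    · have h1 := seven_le_of_prime_dvd heo he1 hqo hq1 hr
      calc 161051 ≤ 7 ^ 7 := by norm_num
        _ ≤ Nat.card L ^ 7 := Nat.pow_le_pow_left h1 7
        _ ≤ _ := Nat.pow_le_pow_right hq1.le (h.trans hed)
  · have h1 : χ ⟨z, hz⟩ = 1 := by
      refine Units.ext (smul_left_injective L hv ?_)
      change (χ ⟨z, hz⟩ : L) • v = (1 : L) • v
      rw [← hZχ, one_smul]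
      exact hzv
    exact congrArg Subtype.val (hχ (h1.trans (map_one χ).symm))
  · by_cases hxC : x ∈ C
    · have hfix : ∀ y ∈ C, y ∉ Z → Nat.card (fixedVec V y) ^ 3 ≤ Nat.card V ^ 2 := by
        have hfixE : ∀ y ∈ E, y ∉ Z → Nat.card (fixedVec V y) ^ 3 ≤ Nat.card V := by
          intro y hyE hyZ
          have h1 : ∃ f ∈ E, ⁅y, f⁆ ≠ 1 := by
            by_contra! h
            refine hyZ (hCE (Subgroup.mem_centralizer_iff.2 fun f hf => ?_))
            exact (commutatorElement_eq_one_iff_mul_comm.1 (h f hf)).symm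
          obtain ⟨f, hf, hyf⟩ := h1
          exact card_fixedVec_cube_le_of_commutator hG hsl Z χ hχ hZχ ((hC _).1 (hEC hyE))
            ((hC _).1 (hEC hf)) (hcomm y hyE f hf) hyf
        intro y hyC hyZ
        have hV1 : 1 ≤ Nat.card V := Nat.card_pos
        by_cases hyE : y ∈ E
        · exact (hfixE y hyE hyZ).trans (Nat.le_self_pow two_ne_zero _)
        · have h1 : ∃ f ∈ E, ⁅y, f⁆ ∉ Z := by
            by_contra! h
            exact hyE (hEmax y hyC h)
          obtain ⟨f, hf, hyf⟩ := h1
          have h2 : ⁅y, f⁆ ∈ E := E.mul_mem (hEn.conj_mem f hf y) (E.inv_mem hf)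
          have h3 := hfixE _ h2 hyf
          have h4 := card_fixedVec_sq_le (V := V) y f
          refine le_of_pow_le_pow_left₀ (n := 2) two_ne_zero (Nat.zero_le _) ?_
          calc (Nat.card (fixedVec V y) ^ 3) ^ 2 = (Nat.card (fixedVec V y) ^ 2) ^ 3 := by ring
            _ ≤ (Nat.card V * Nat.card (fixedVec V ⁅y, f⁆)) ^ 3 := Nat.pow_le_pow_left h4 3
            _ = Nat.card V ^ 3 * Nat.card (fixedVec V ⁅y, f⁆) ^ 3 := mul_pow _ _ _
            _ ≤ Nat.card V ^ 3 * Nat.card V := Nat.mul_le_mul_left _ h3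
            _ = (Nat.card V ^ 2) ^ 2 := by ring
      refine sum_card_fixedVec_coset_le hsl ((hC x).1 hxC) Z χ hχ hZχ _ fun z => ?_
      have hzC : z.1 * x ∈ C := C.mul_mem (hEC (hZE z.2)) hxC
      exact card_fixedVec_le_pow hsl ((hC _).1 hzC) (hfix _ hzC fun h =>
        hxZ ((Z.mul_mem_cancel_left z.2).1 h))
    · have h1 : ∃ a : L, x • a ≠ a := by
        by_contra! h
        exact hxC ((hC x).2 h)
      obtain ⟨a, ha⟩ := h1
      exact sum_card_fixedVec_coset_le_of_moved hG hsl Z χ hχ hZL ha (he5.trans hed)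

section Transfer

variable {G G' : Type*} {V : Type u} [Group G] [Group G'] [AddCommGroup V] [DistribMulAction G V]
  [DistribMulAction G' V]

lemma IsIrr.of_hom (f : G →* G')
    (hfv : ∀ (g : G) (v : V), f g • v = g • v) (h : IsIrr G V) : IsIrr G' V :=
  ⟨h.1, fun W hW => h.2 W fun g w hw => hfv g w ▸ hW (f g) w hw⟩

lemma IsPrim.of_hom (f : G →* G')
    (hfv : ∀ (g : G) (v : V), f g • v = g • v) (h : IsPrim G V) : IsPrim G' V := by
  intro ε hε
  refine h ε ⟨hε.1, hε.2.1, fun g => ?_⟩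
  have h1 : conjEnd g ε = conjEnd (f g) ε := by
    refine AddMonoidHom.ext fun v => ?_
    change g • ε (g⁻¹ • v) = f g • ε ((f g)⁻¹ • v)
    rw [← map_inv, hfv, hfv]
  rw [h1]
  exact hε.2.2 (f g)

lemma IsSemiLin.of_hom (f : G →* G')
    (hfv : ∀ (g : G) (v : V), f g • v = g • v) (h : IsSemiLin G' V) : IsSemiLin G V := by
  obtain ⟨L, _, _, _, hsl, hv⟩ := h
  refine ⟨L, _, _, MulSemiringAction.compHom L f, fun g a v => ?_, hv⟩
  rw [← hfv, hsl, hfv]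
  rfl

end Transfer

/-- The image of a group in the automorphisms of a module. -/
abbrev actRange (G V : Type*) [Group G] [AddCommGroup V] [DistribMulAction G V] :
    Subgroup (AddMonoid.End V)ˣ :=
  (DistribMulAction.toAddMonoidEnd G V).toHomUnits.range

/-- The surjection of a group onto its image in the automorphisms of a module. -/
abbrev toActRange (G V : Type*) [Group G] [AddCommGroup V] [DistribMulAction G V] :
    G →* actRange G V :=
  (DistribMulAction.toAddMonoidEnd G V).toHomUnits.rangeRestrict

lemma toActRange_surjective (G V : Type*) [Group G] [AddCommGroup V] [DistribMulAction G V] :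
    Function.Surjective (toActRange G V) := MonoidHom.rangeRestrict_surjective _

lemma toActRange_smul {G V : Type*} [Group G] [AddCommGroup V] [DistribMulAction G V] (g : G)
    (v : V) : toActRange G V g • v = g • v := rfl

lemma primDichotomy_succ {n : ℕ} (hP : PrimDichotomy.{u} n) (hS : HasBaseTwo.{u} n) :
    PrimDichotomy.{u} (n + 1) := by
  intro G V _ _ _ _ _ hG hs hV hn hirr hprim
  have hsurj := toActRange_surjective G V
  have : Finite (actRange G V) := Finite.of_surjective _ hsurj
  have hG' : Odd (Nat.card (actRange G V)) := hG.of_dvd_nat (Subgroup.card_range_dvd _)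
  have hs' : Group.IsSolvable (actRange G V) := Group.isSolvable_of_surjective hsurj
  rcases isSemiLin_or_regular_of_faithful hP hS hG' hs' hV hn
    (hirr.of_hom (toActRange G V) toActRange_smul)
    (hprim.of_hom (toActRange G V) toActRange_smul) with h | ⟨h, v, hv⟩
  · exact .inl (h.of_hom (toActRange G V) toActRange_smul)
  · refine .inr ⟨h, v, fun g hg w => ?_⟩
    rw [← toActRange_smul, hv (toActRange G V g) hg, one_smul]

lemma BlockSystem.exists_vec {G V : Type*} [Group G] [AddCommGroup V] [DistribMulAction G V]
    {N : Subgroup G} [Finite (G ⧸ N)] {e : G ⧸ N → AddMonoid.End V} (h : BlockSystem N e) [Finite V]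
    (hV : Odd (Nat.card V)) (hG : Odd (Nat.card G)) (hs : Group.IsSolvable G) {x : V}
    (hx : x ∈ endRange (e (1 : G))) (hx0 : x ≠ 0) :
    ∃ v : V, ∀ g : G, g • v = v → ∀ q : G ⧸ N, q.out⁻¹ * g * q.out ∈ N ∧
      (q.out⁻¹ * g * q.out) • x = x := by
  obtain ⟨v, hv⟩ := h.exists_signs hV hG hs (fun q => q.out • x) (fun q => h.out_smul_mem q hx)
    (fun q => fun h => hx0 ((smul_eq_zero_iff_eq _).1 h))
  refine ⟨v, fun g hg q => ⟨conj_mem ((hv g hg).1 q), ?_⟩⟩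
  rw [mul_smul, mul_smul, (hv g hg).2 q, inv_smul_smul]

lemma hasBaseTwo_of_primDichotomy {n : ℕ} (hP : PrimDichotomy.{u} n) : HasBaseTwo.{u} n := by
  intro G V _ _ _ _ _ hG hs hV hn hirr
  have := hirr.1
  obtain ⟨N, e, h, hirr₁, hprim₁⟩ := exists_blockSystem hirr
  let _ := restrictAction N (endRange (e (1 : G))) h.smul_mem
  have hcard : Nat.card (endRange (e (1 : G))) ∣ Nat.card V :=
    AddSubgroup.card_addSubgroup_dvd_card _
  have := hirr₁.1
  rcases hP N (endRange (e (1 : G))) (hG.of_dvd_nat (Subgroup.card_subgroup_dvd_card N))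
    inferInstance (hV.of_dvd_nat hcard) ((Nat.le_of_dvd Nat.card_pos hcard).trans hn) hirr₁ hprim₁
    with ⟨L, _, _, _, hsl, x, hx⟩ | ⟨-, x, hx⟩
  · have hx0 : x ≠ 0 := by
      rintro rfl
      obtain ⟨y, hy⟩ := exists_ne (0 : endRange (e (1 : G)))
      obtain ⟨a, ha⟩ := hx y
      exact hy (by rw [← ha, smul_zero])
    have : Finite L := Finite.of_injective _ (smul_left_injective L hx0)
    obtain ⟨θ, hθ⟩ := IsCyclic.exists_generator (α := Lˣ)
    have hθx : (θ : L) • x ≠ 0 := smul_ne_zero θ.ne_zero hx0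
    obtain ⟨v, hv⟩ := h.exists_vec hV hG hs x.2 fun h => hx0 (Subtype.ext h)
    obtain ⟨w, hw⟩ := h.exists_vec hV hG hs ((θ : L) • x).2 fun h => hθx (Subtype.ext h)
    refine ⟨v, w, fun g hgv hgw u => h.smul_eq_of_forall (fun q y hy => ?_) u⟩
    obtain ⟨hN, h1⟩ := hv g hgv q
    obtain ⟨-, h2⟩ := hw g hgw q
    set k : N := ⟨_, hN⟩
    replace h1 : k • x = x := Subtype.ext h1
    replace h2 : k • (θ : L) • x = (θ : L) • x := Subtype.ext h2
    rw [hsl, h1] at h2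
    have h3 : k • (θ : L) = θ := smul_left_injective L hx0 h2
    have h4 : ∀ a : L, k • a = a := by
      intro a
      by_cases ha : a = 0
      · rw [ha, smul_zero]
      · obtain ⟨m, hm⟩ := mem_powers_iff_mem_zpowers.2 (hθ (Units.mk0 a ha))
        have h5 : a = (θ : L) ^ m := by
          have := congrArg Units.val hm
          simpa using this.symm
        rw [h5, smul_pow', h3]
    obtain ⟨a, ha⟩ := hx ⟨y, hy⟩
    have h5 : k • (⟨y, hy⟩ : endRange (e (1 : G))) = ⟨y, hy⟩ := by
      rw [← ha, hsl, h4, h1]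
    exact congrArg Subtype.val h5
  · have hx0 : x ≠ 0 ∨ ∀ (k : N) (y : endRange (e (1 : G))), k • y = y := by
      by_cases h0 : x = 0
      · exact .inr fun k y => hx k (by rw [h0, smul_zero]) y
      · exact .inl h0
    rcases hx0 with hx0 | htriv
    · obtain ⟨v, hv⟩ := h.exists_vec hV hG hs x.2 fun h => hx0 (Subtype.ext h)
      refine ⟨v, v, fun g hgv _ u => h.smul_eq_of_forall (fun q y hy => ?_) u⟩
      obtain ⟨hN, h1⟩ := hv g hgv q
      exact congrArg Subtype.val (hx ⟨_, hN⟩ (Subtype.ext h1) ⟨y, hy⟩)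
    · obtain ⟨x, hx0⟩ := exists_ne (0 : endRange (e (1 : G)))
      obtain ⟨v, hv⟩ := h.exists_vec hV hG hs x.2 fun h => hx0 (Subtype.ext h)
      refine ⟨v, v, fun g hgv _ u => h.smul_eq_of_forall (fun q y hy => ?_) u⟩
      exact congrArg Subtype.val (htriv ⟨_, (hv g hgv q).1⟩ ⟨y, hy⟩)

theorem primDichotomy (n : ℕ) : PrimDichotomy.{u} n := by
  induction n with
  | zero =>
    intro G V _ _ _ _ _ _ _ _ hn
    exact absurd hn (Nat.card_pos (α := V)).not_ge
  | succ n ih => exact primDichotomy_succ ih (hasBaseTwo_of_primDichotomy ih)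

lemma exists_ne_zero_of_regular {G V : Type*} [Group G] [AddCommGroup V] [Nontrivial V]
    [DistribMulAction G V] (h : ∃ v : V, ∀ g : G, g • v = v → ∀ w : V, g • w = w) :
    ∃ v : V, v ≠ 0 ∧ ∀ g : G, g • v = v → ∀ w : V, g • w = w := by
  obtain ⟨v, hv⟩ := h
  by_cases h0 : v = 0
  · obtain ⟨u, hu⟩ := exists_ne (0 : V)
    exact ⟨u, hu, fun g _ => hv g (by rw [h0, smul_zero])⟩
  · exact ⟨v, h0, hv⟩

/-- A semilinear group in dimension one acts on the units of the field by twisted translations. -/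
lemma exists_unit_action {N L U : Type*} [Group N] [Field L] [Finite L] [AddCommGroup U]
    [Module L U] [DistribMulAction N U] [MulSemiringAction N L]
    (hsl : ∀ (n : N) (a : L) (u : U), n • a • u = (n • a) • n • u) {x : U} (hx0 : x ≠ 0)
    (hx : ∀ u : U, ∃ a : L, a • x = u) :
    ∃ (act : N → Lˣ → Lˣ) (σ : N → Lˣ →* Lˣ),
      (∀ n a, (act n a : L) • x = n • (a : L) • x) ∧ (∀ a, act 1 a = a) ∧
      (∀ m n a, act (m * n) a = act m (act n a)) ∧ (∀ n a b, act n (a * b) = σ n a * act n b) ∧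
      ∀ m n a, σ m (σ n a) = σ n (σ m a) := by
  choose c hc using hx
  have hne : ∀ (n : N) (a : Lˣ), c (n • (a : L) • x) ≠ 0 := by
    intro n a h
    have h1 := hc (n • (a : L) • x)
    rw [h, zero_smul] at h1
    exact smul_ne_zero a.ne_zero hx0 ((smul_eq_zero_iff_eq n).1 h1.symm)
  have hinj : ∀ {a b : Lˣ}, (a : L) • x = (b : L) • x → a = b := fun h =>
    Units.ext (smul_left_injective L hx0 h)
  have hact : ∀ (n : N) (a : Lˣ), ((Units.mk0 _ (hne n a) : Lˣ) : L) • x = n • (a : L) • x :=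
    fun n a => hc _
  refine ⟨fun n a => Units.mk0 _ (hne n a),
    fun n => Units.map (MulSemiringAction.toRingHom N L n : L →* L), hact, fun a => hinj ?_,
    fun m n a => hinj ?_, fun n a b => hinj ?_, fun m n a => ?_⟩
  · rw [hact, one_smul]
  · rw [hact, hact, hact, mul_smul]
  · rw [hact, Units.val_mul, Units.val_mul, mul_smul, mul_smul, hact, hsl]
    rfl
  · obtain ⟨i, hi⟩ :=
      (Units.map (MulSemiringAction.toRingHom N L m : L →* L)).map_cyclic
    rw [hi, hi, map_zpow]

theorem exists_regular_of_isIrr {G V : Type u} [Group G] [Finite G] [AddCommGroup V] [Finite V]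
    [DistribMulAction G V] [FaithfulSMul G V] (hG : Odd (Nat.card G)) (hs : Group.IsSolvable G)
    (hV : Odd (Nat.card V)) (hirr : IsIrr G V)
    (hp : ∀ p : ℕ, p.Prime → ∃ v : V, ¬ p ∣ Nat.card (MulAction.stabilizer G v)) :
    ∃ v : V, ∀ g : G, g • v = v → g = 1 := by
  classical
  obtain ⟨N, e, h, hirr₁, hprim₁⟩ := exists_blockSystem hirr
  let _ := restrictAction N (endRange (e (1 : G))) h.smul_mem
  have hcard : Nat.card (endRange (e (1 : G))) ∣ Nat.card V :=
    AddSubgroup.card_addSubgroup_dvd_card _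
  have := hirr₁.1
  rcases primDichotomy _ N (endRange (e (1 : G))) (hG.of_dvd_nat (Subgroup.card_subgroup_dvd_card N))
    inferInstance (hV.of_dvd_nat hcard) le_rfl hirr₁ hprim₁
    with ⟨L, _, _, _, hsl, x, hx⟩ | ⟨-, hreg⟩
  · have hx0 : x ≠ 0 := by
      rintro rfl
      obtain ⟨y, hy⟩ := exists_ne (0 : endRange (e (1 : G)))
      obtain ⟨a, ha⟩ := hx y
      exact hy (by rw [← ha, smul_zero])
    have : Finite L := Finite.of_injective _ (smul_left_injective L hx0)
    obtain ⟨act, σ, hact, hact1, hactm, hactσ, hσ⟩ := exists_unit_action hsl hx0 hx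
    have hactx : ∀ {n : N} {a : Lˣ}, n • (a : L) • x = (a : L) • x → act n a = a := by
      intro n a h
      rw [← hact] at h
      exact Units.ext (smul_left_injective L hx0 h)
    let K := fixingSubgroup G (Set.univ : Set (G ⧸ N))
    have hK : ∀ (k : K) (q : G ⧸ N), q.out⁻¹ * k.1 * q.out ∈ N := fun k q =>
      BlockSystem.conj_mem ((mem_fixingSubgroup_iff G).1 k.2 q (Set.mem_univ q))
    let κ : K → G ⧸ N → N := fun k q => ⟨_, hK k q⟩
    let _ : MulAction K (G ⧸ N → Additive Lˣ) :=
      { smul := fun k t q => Additive.ofMul (act (κ k q) (t q).toMul)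
        one_smul := fun t => funext fun q => by
          change Additive.ofMul (act (κ 1 q) (t q).toMul) = t q
          rw [show κ 1 q = 1 from Subtype.ext (by simp [κ]), hact1, ofMul_toMul]
        mul_smul := fun k l t => funext fun q => by
          change Additive.ofMul (act (κ (k * l) q) (t q).toMul) =
            Additive.ofMul (act (κ k q) (act (κ l q) (t q).toMul))
          rw [show κ (k * l) q = κ k q * κ l q from Subtype.ext (by simp [κ, mul_assoc]), hactm] }
    have hsmul : ∀ (k : K) (t : G ⧸ N → Additive Lˣ) (q : G ⧸ N),
        (k • t) q = Additive.ofMul (act (κ k q) (t q).toMul) := fun _ _ _ => rfl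
    obtain ⟨t, ht⟩ := exists_free_point_of_twisted (K := K) (T := G ⧸ N → Additive Lˣ)
      (fun k t q => Additive.ofMul (σ (κ k q) (t q).toMul))
      (fun k t s => funext fun q => by
        rw [Pi.add_apply, hsmul, hsmul, Pi.add_apply, toMul_add, hactσ, ofMul_mul])
      (fun k l t => funext fun q => congrArg Additive.ofMul (hσ _ _ _)) fun p hpp => by
        obtain ⟨v, hv⟩ := hp p hpp
        have h1 : ∀ q : G ⧸ N, ∃ a : Lˣ, ∀ n : N, act n a = a →
            n.1 • q.out⁻¹ • e q v = q.out⁻¹ • e q v := by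
          intro q
          by_cases h0 : q.out⁻¹ • e q v = 0
          · exact ⟨1, fun n _ => by rw [h0, smul_zero]⟩
          · obtain ⟨a, ha⟩ := hx ⟨_, h.out_inv_smul_mem q v⟩
            have ha0 : a ≠ 0 := by
              rintro rfl
              rw [zero_smul] at ha
              exact h0 (congrArg Subtype.val ha.symm)
            refine ⟨Units.mk0 a ha0, fun n hn => ?_⟩
            have h2 := hact n (Units.mk0 a ha0)
            rw [hn, Units.val_mk0, ha] at h2
            exact congrArg Subtype.val h2.symm
        choose a ha using h1
        refine ⟨fun q => Additive.ofMul (a q), fun hdvd => hv (hdvd.trans ?_)⟩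
        rw [← Subgroup.card_map_of_injective K.subtype_injective]
        refine Subgroup.card_dvd_of_le ?_
        rintro _ ⟨k, hk, rfl⟩
        change k.1 • v = v
        have := Fintype.ofFinite (G ⧸ N)
        rw [← h.sum_eq v, Finset.smul_sum]
        refine Finset.sum_congr rfl fun q _ => ?_
        have h3 : act (κ k q) (a q) = a q := congrArg Additive.toMul (congrFun hk q)
        have h4 := ha q _ h3
        simp only [κ] at h4
        rw [← mul_smul, mul_assoc, mul_inv_cancel, mul_one, mul_smul] at h4
        exact smul_left_cancel _ h4
    let y : G ⧸ N → endRange (e (1 : G)) := fun q => ((t q).toMul : L) • x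
    have hy0 : ∀ q, y q ≠ 0 := fun q => smul_ne_zero (Units.ne_zero _) hx0
    obtain ⟨v, hv⟩ := h.exists_signs hV hG hs (fun q => q.out • (y q).1)
      (fun q => h.out_smul_mem q (y q).2)
      (fun q h => hy0 q (Subtype.ext ((smul_eq_zero_iff_eq _).1 h)))
    refine ⟨v, fun g hg => ?_⟩
    obtain ⟨h1, h2⟩ := hv g hg
    have hgK : g ∈ K := (mem_fixingSubgroup_iff G).2 fun q _ => h1 q
    have h3 : (⟨g, hgK⟩ : K) ∈ MulAction.stabilizer K t := by
      refine funext fun q => ?_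
      rw [hsmul, hactx, ofMul_toMul]
      refine Subtype.ext ?_
      change (q.out⁻¹ * g * q.out) • (y q).1 = (y q).1
      rw [mul_smul, mul_smul, h2 q, inv_smul_smul]
    rw [ht, Subgroup.mem_bot] at h3
    exact congrArg Subtype.val h3
  · obtain ⟨x, hx0, hx⟩ := exists_ne_zero_of_regular hreg
    obtain ⟨v, hv⟩ := h.exists_vec hV hG hs x.2 fun h => hx0 (Subtype.ext h)
    refine ⟨v, fun g hg => FaithfulSMul.eq_of_smul_eq_smul (α := V) fun u => ?_⟩
    rw [one_smul]
    refine h.smul_eq_of_forall (fun q y hy => ?_) u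
    obtain ⟨hN, h1⟩ := hv g hg q
    exact congrArg Subtype.val (hx ⟨_, hN⟩ (Subtype.ext h1) ⟨y, hy⟩)

theorem exists_regular_of_forall_prime {F : Type*} {V G : Type u} [Field F] [AddCommGroup V]
    [Module F V] [Finite V] [Nontrivial V] [Group G] [Finite G] [DistribMulAction G V]
    [SMulCommClass G F V] [FaithfulSMul G V] (hs : Group.IsSolvable G) (hG : Odd (Nat.card G))
    (hV : Odd (Nat.card V))
    (hirr : ∀ W : Submodule F V, (∀ (g : G), ∀ v ∈ W, g • v ∈ W) → W = ⊥ ∨ W = ⊤)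
    (hp : ∀ p : ℕ, p.Prime → ∃ v : V, ¬ p ∣ Nat.card (MulAction.stabilizer G v)) :
    ∃ v : V, ∀ g : G, g • v = v → g = 1 := by
  have hfin : Finite (AddSubgroup V) := Finite.of_injective (fun U => (U : Set V))
    SetLike.coe_injective
  obtain ⟨W, ⟨hW, hWb⟩, hmin⟩ := Set.exists_min_image
    {X : AddSubgroup V | (∀ g : G, ∀ w ∈ X, g • w ∈ X) ∧ X ≠ ⊥} (fun X => Nat.card X)
    (Set.toFinite _) ⟨⊤, fun _ _ _ => AddSubgroup.mem_top _, top_ne_bot⟩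
  have hmin' : ∀ X : AddSubgroup V, (∀ g : G, ∀ w ∈ X, g • w ∈ X) → X ≤ W → X ≠ ⊥ → X = W :=
    fun X hX hXW hXb => AddSubgroup.eq_of_le_of_card_ge hXW (hmin X ⟨hX, hXb⟩)
  by_cases hc : ∃ c : F, ∀ w ∈ W, c • w ∈ W → w = 0
  · obtain ⟨c, hc⟩ := hc
    have hspan : Submodule.span F (W : Set V) = ⊤ := by
      refine (hirr _ fun g v hv => ?_).resolve_left fun h => ?_
      · induction hv using Submodule.span_induction with
        | mem x hx => exact Submodule.subset_span (hW g x hx)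
        | zero => rw [smul_zero]; exact Submodule.zero_mem _
        | add x y _ _ hx hy => rw [smul_add]; exact Submodule.add_mem _ hx hy
        | smul a x _ hx => rw [smul_comm]; exact Submodule.smul_mem _ a hx
      · refine hWb ((AddSubgroup.eq_bot_iff_forall _).2 fun w hw => ?_)
        have : w ∈ Submodule.span F (W : Set V) := Submodule.subset_span hw
        rwa [h, Submodule.mem_bot] at this
    have hfaith : ∀ g : G, (∀ w ∈ W, g • w = w) → g = 1 := by
      intro g hg
      refine FaithfulSMul.eq_of_smul_eq_smul (α := V) fun v => ?_
      rw [one_smul]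
      have hv : v ∈ Submodule.span F (W : Set V) := hspan ▸ Submodule.mem_top
      induction hv using Submodule.span_induction with
      | mem x hx => exact hg x hx
      | zero => exact smul_zero g
      | add x y _ _ hx hy => rw [smul_add, hx, hy]
      | smul a x _ hx => rw [smul_comm, hx]
    let _ := restrictAction G W hW
    have hWirr : IsIrr G W := by
      refine ⟨(AddSubgroup.nontrivial_iff_ne_bot W).2 hWb, fun X hX => ?_⟩
      by_cases hXb : X = ⊥
      · exact .inl hXb
      · right
        have h1 := hmin' (X.map W.subtype) (by
          rintro g _ ⟨w, hw, rfl⟩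
          exact ⟨g • w, hX g w hw, rfl⟩) (by
          rintro _ ⟨w, -, rfl⟩
          exact w.2) fun h => hXb ((AddSubgroup.map_eq_bot_iff_of_injective X
            W.subtype_injective).1 h)
        refine (AddSubgroup.eq_top_iff' X).2 fun w => ?_
        have h2 : w.1 ∈ X.map W.subtype := h1.ge w.2
        obtain ⟨w', hw', h3⟩ := h2
        rwa [← Subtype.ext h3]
    obtain ⟨w₁, w₂, hw⟩ := hasBaseTwo_of_primDichotomy (primDichotomy _) G W hG hs
      (hV.of_dvd_nat (AddSubgroup.card_addSubgroup_dvd_card W)) le_rfl hWirr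
    refine ⟨w₁.1 + c • w₂.1, fun g hg => ?_⟩
    rw [smul_add, smul_comm] at hg
    have h1 : c • (w₂.1 - g • w₂.1) = g • w₁.1 - w₁.1 := by
      rw [smul_sub, sub_eq_sub_iff_add_eq_add, add_comm _ w₁.1, hg]
    have h2 : w₂.1 - g • w₂.1 = 0 := hc _ (W.sub_mem w₂.2 (hW g _ w₂.2))
      (h1 ▸ W.sub_mem (hW g _ w₁.2) w₁.2)
    rw [h2, smul_zero] at h1
    have h3 := hw g (Subtype.ext (sub_eq_zero.1 h1.symm)) (Subtype.ext (sub_eq_zero.1 h2).symm)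
    exact hfaith g fun w hw => congrArg Subtype.val (h3 ⟨w, hw⟩)
  · push Not at hc
    have hsub : ∀ (c : F), ∀ w ∈ W, c • w ∈ W := by
      intro c w hw
      obtain ⟨u, huW, hu, hu0⟩ := hc c
      have h1 := hmin' (W ⊓ W.comap (DistribSMul.toAddMonoidHom V c))
        (fun g w hw => ⟨hW g w hw.1, by
          change c • g • w ∈ W
          rw [← smul_comm]
          exact hW g _ hw.2⟩) inf_le_left fun h => hu0 (by
          have : u ∈ W ⊓ W.comap (DistribSMul.toAddMonoidHom V c) := ⟨huW, hu⟩
          rwa [h, AddSubgroup.mem_bot] at this)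
      rw [← h1] at hw
      exact hw.2
    have hWt : W = ⊤ := by
      rcases hirr { W with smul_mem' := fun c w hw => hsub c w hw } hW with h | h
      · exact absurd (congrArg Submodule.toAddSubgroup h) hWb
      · exact congrArg Submodule.toAddSubgroup h
    subst hWt
    refine exists_regular_of_isIrr hG hs hV ⟨‹_›, fun X hX => ?_⟩ hp
    by_cases hXb : X = ⊥
    · exact .inl hXb
    · exact .inr (hmin' X hX le_top hXb)

/-- A finite solvable group `G` of odd order acting faithfully and
irreducibly on a finite vector space `V` over a finite field `F` of odd characteristic:
if `G` has a `p`-regular orbit on `V` for every prime `p` dividing `|G|`, then `G` has a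
regular orbit on `V`. -/
theorem stmt_0 {F V G : Type*} [Field F] [Fintype F] [AddCommGroup V] [Module F V]
    [Fintype V] [Nontrivial V] [Group G] [Fintype G]
    [DistribMulAction G V] [SMulCommClass G F V] [FaithfulSMul G V]
    (hsolv : IsSolvable G) (hodd : Odd (Fintype.card G)) (hchar : Odd (ringChar F))
    (hirr : ∀ W : Submodule F V, (∀ (g : G), ∀ v ∈ W, g • v ∈ W) → W = ⊥ ∨ W = ⊤)
    (hpreg : ∀ p : ℕ, p.Prime → p ∣ Fintype.card G →
      ∃ v : V, ¬ p ∣ Nat.card (MulAction.stabilizer G v)) :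
    ∃ v : V, MulAction.stabilizer G v = ⊥ := by
  have hsurj := toActRange_surjective G V
  have : Group.IsSolvable G := hsolv
  have hG : Odd (Nat.card G) := by rwa [Nat.card_eq_fintype_card]
  have hfin : Finite (actRange G V) := Finite.of_surjective _ hsurj
  have hcomm : SMulCommClass (actRange G V) F V := ⟨fun a c v => by
    obtain ⟨g, rfl⟩ := hsurj a
    exact smul_comm g c v⟩
  have hV : Odd (Nat.card V) := by
    have hprime : Fact (ringChar F).Prime := ⟨CharP.char_is_prime F _⟩
    obtain ⟨n, -, hn⟩ := FiniteField.card F (ringChar F)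
    rw [Module.natCard_eq_pow_finrank (K := F), Nat.card_eq_fintype_card, hn]
    exact (hchar.pow).pow
  obtain ⟨v, hv⟩ := exists_regular_of_forall_prime (F := F) (V := V) (G := actRange G V)
    (Group.isSolvable_of_surjective hsurj)
    (hG.of_dvd_nat (Subgroup.card_range_dvd _)) hV
    (fun W hW => hirr W fun g v hv => hW (toActRange G V g) v hv) (fun p hp => by
      obtain ⟨v, hv⟩ : ∃ v : V, ¬ p ∣ Nat.card (MulAction.stabilizer G v) := by
        by_cases h : p ∣ Fintype.card G
        · exact hpreg p hp h
        · refine ⟨0, fun h' => h ?_⟩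
          rw [← Nat.card_eq_fintype_card]
          exact h'.trans (Subgroup.card_subgroup_dvd_card _)
      have hmap : MulAction.stabilizer (actRange G V) v =
          (MulAction.stabilizer G v).map (toActRange G V) := by
        ext a
        obtain ⟨g, rfl⟩ := hsurj a
        refine ⟨fun h => ⟨g, h, rfl⟩, ?_⟩
        rintro ⟨g', hg', h⟩
        rw [← h]
        exact hg'
      refine ⟨v, fun h => hv (h.trans ?_)⟩
      rw [hmap]
      exact Subgroup.card_map_dvd _ _)
  refine ⟨v, (Subgroup.eq_bot_iff_forall _).2 fun g hg => ?_⟩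
  have h1 : toActRange G V g = 1 := hv _ hg
  refine FaithfulSMul.eq_of_smul_eq_smul (α := V) fun w => ?_
  rw [← toActRange_smul g, h1, one_smul, one_smul]
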